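/- arXiv:0911.0956 — 2 statements merged into one kernel-verified Lean document; each statement's English description precedes it below -/
import Mathlib

section
/- Assume conditions (C1) and (C2) on b and σ. Let W be a viscosity subsolution and V a viscosity supersolution of the HJB equation −∂_t v + H(t,x,D_x v,D²_x v) = 0 on O = [0,T)×Q with boundary/terminal condition v = −Pξ on ∂*O, such that there exist L₀ > 0 and m > 3 with |W(t,x)| ≤ L₀(‖x‖^m + 1) and |V(s,y)| ≤ L₀(‖y‖^m + 1) for all (t,x),(s,y) ∈ [0,T]×Q̄, and such that W(t,x) = −P₁ξ₁ and V(s,y) = −P₂ξ₂ for all (t,x),(s,y) ∈ ∂*O (where x = (P₁,ξ₁,Θ₁), y = (P₂,ξ₂,Θ₂)). Then W(t,x) ≤ V(t,x) for every (t,x) ∈ [0,T]×Q̄. -/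
open Set Filter Topology Matrix

noncomputable section

/-- ℝ³, realized as `Fin 3 → ℝ`; the state variable is `x = (P, ξ, Θ)`. -/
abbrev Vec3 := Fin 3 → ℝ
/-- Real 3×3 matrices (`S³` is the subset of symmetric ones). -/
abbrev Mat3 := Matrix (Fin 3) (Fin 3) ℝ

/-- Euclidean norm on ℝ³. -/
def enorm3 (x : Vec3) : ℝ := Real.sqrt (∑ j, x j ^ 2)

/-- `Q = (R,∞) × (0,∞) × (−H,H)`. -/
def Qset (R H : ℝ) : Set Vec3 := {x | R < x 0 ∧ 0 < x 1 ∧ x 2 ∈ Ioo (-H) H}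

/-- `Q̄ = [R,∞) × [0,∞) × [−H,H]`. -/
def Qbar (R H : ℝ) : Set Vec3 := {x | R ≤ x 0 ∧ 0 ≤ x 1 ∧ x 2 ∈ Icc (-H) H}

/-- The data of the stochastic control problem: the constants
`T, R, H, N, C, A, α, β, ϱ, k, γ`, the drift and volatility coefficients `b, σ` of the
pay-off process, the coefficients `θf, sf` of the quality process, the operating cost
`ℓf`, and the cut-off function `ζ`. -/
structure HJBData where
  T : ℝ
  R : ℝ
  H : ℝ
  N : ℝ
  C : ℝ
  A : ℝ
  α : ℝ
  β : ℝ
  ϱ : ℝ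
  k : ℝ
  γ : ℝ
  b : ℝ → ℝ → ℝ × ℝ → ℝ
  σ : ℝ → ℝ → ℝ × ℝ → ℝ
  θf : ℝ → ℝ
  sf : ℝ → ℝ
  ℓf : ℝ → ℝ
  ζ : ℝ → ℝ

namespace HJBData

variable (D : HJBData)

/-- The control set `U = [0,N] × [0,C]`, `u = (η,c)`. -/
def ctrl : Set (ℝ × ℝ) := Icc 0 D.N ×ˢ Icc 0 D.C

/-- The domain `[0,T] × Q̄`. -/
def dom : Set (ℝ × Vec3) := Icc 0 D.T ×ˢ Qbar D.R D.H

/-- `O = [0,T) × Q`. -/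
def intO : Set (ℝ × Vec3) := Ico 0 D.T ×ˢ Qset D.R D.H

/-- The parabolic boundary `∂*O = ([0,T] × ∂Q) ∪ ({T} × Q)`. -/
def parBdry : Set (ℝ × Vec3) :=
  {p | (p.1 ∈ Icc 0 D.T ∧ p.2 ∈ Qbar D.R D.H \ Qset D.R D.H) ∨
    (p.1 = D.T ∧ p.2 ∈ Qset D.R D.H)}

/-- The drift vector `f(t,x,u) = (b(t,P,u), 0, θ(t)ζ_H(Θ))`. -/
def drift (t : ℝ) (x : Vec3) (u : ℝ × ℝ) : Vec3 :=
  ![D.b t (x 0) u, 0, D.θf t * D.ζ (x 2)]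

/-- The volatility vector
`σ⃗(t,x,u) = (σ(t,P,u), −ϱ⁻¹ ξ (Θ + A c^α η^β − ℓ(t)), s̄(t)ζ_H(Θ))`. -/
def vol (t : ℝ) (x : Vec3) (u : ℝ × ℝ) : Vec3 :=
  ![D.σ t (x 0) u, -(D.ϱ⁻¹) * x 1 * (x 2 + D.A * u.2 ^ D.α * u.1 ^ D.β - D.ℓf t),
    D.sf t * D.ζ (x 2)]

/-- `a(t,x,u) = σ⃗ σ⃗ᵀ`. -/
def aMat (t : ℝ) (x : Vec3) (u : ℝ × ℝ) : Mat3 :=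
  Matrix.vecMulVec (D.vol t x u) (D.vol t x u)

/-- The running cost `L(x,u) = k η^γ ξ`. -/
def runCost (x : Vec3) (u : ℝ × ℝ) : ℝ := D.k * u.1 ^ D.γ * x 1

/-- The Hamiltonian
`H(t,x,z,M) = sup_{u∈U} [−f(t,x,u)·z − ½ tr(a(t,x,u)M) − L(x,u)]`. -/
def Ham (t : ℝ) (x : Vec3) (z : Vec3) (M : Mat3) : ℝ :=
  sSup ((fun u => -(∑ j, D.drift t x u j * z j) - (1 / 2) * (D.aMat t x u * M).trace
    - D.runCost x u) '' D.ctrl)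

end HJBData

/-- The continuous linear map `h ↦ v·h` on ℝ³. -/
def dotCLM (v : Vec3) : Vec3 →L[ℝ] ℝ :=
  ∑ j, v j • (ContinuousLinearMap.proj j : Vec3 →L[ℝ] ℝ)

/-- The continuous linear map `h ↦ M h` on ℝ³ associated to a 3×3 matrix `M`. -/
def matCLM (M : Mat3) : Vec3 →L[ℝ] Vec3 :=
  ContinuousLinearMap.pi fun i => dotCLM (M i)

/-- `φ ∈ C^{1,2}([0,T]×Q̄)`, with the data of its partial derivatives: `φt` is the
first partial derivative in `t`, `φx` the spatial gradient, `φxx` the spatial Hessian;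
all exist and are continuous on `[0,T]×Q̄`. -/
structure IsC12 (T R H : ℝ) (φ φt : ℝ × Vec3 → ℝ) (φx : ℝ × Vec3 → Vec3)
    (φxx : ℝ × Vec3 → Mat3) : Prop where
  contPhi : ContinuousOn φ (Icc 0 T ×ˢ Qbar R H)
  hasDerivT : ∀ p ∈ Icc 0 T ×ˢ Qbar R H,
    HasDerivWithinAt (fun s => φ (s, p.2)) (φt p) (Icc 0 T) p.1
  hasFDerivX : ∀ p ∈ Icc 0 T ×ˢ Qbar R H,
    HasFDerivWithinAt (fun y => φ (p.1, y)) (dotCLM (φx p)) (Qbar R H) p.2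
  hasFDerivXX : ∀ p ∈ Icc 0 T ×ˢ Qbar R H,
    HasFDerivWithinAt (fun y => φx (p.1, y)) (matCLM (φxx p)) (Qbar R H) p.2
  contT : ContinuousOn φt (Icc 0 T ×ˢ Qbar R H)
  contX : ContinuousOn φx (Icc 0 T ×ˢ Qbar R H)
  contXX : ContinuousOn φxx (Icc 0 T ×ˢ Qbar R H)

/-- `v` is a viscosity subsolution of the HJB equation
`−∂_t v + H(t,x,D_x v,D²_x v) = 0` on `O = [0,T)×Q` with boundary/terminal condition
`v = −Pξ` on `∂*O`. -/
def IsViscositySubsolution (D : HJBData) (v : ℝ × Vec3 → ℝ) : Prop :=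
  ContinuousOn v D.dom ∧
  (∀ p ∈ D.parBdry, v p ≤ -(p.2 0 * p.2 1)) ∧
  ∀ (φ φt : ℝ × Vec3 → ℝ) (φx : ℝ × Vec3 → Vec3) (φxx : ℝ × Vec3 → Mat3),
    IsC12 D.T D.R D.H φ φt φx φxx →
    ∀ p ∈ D.intO, IsLocalMaxOn (fun w => v w - φ w) D.dom p →
      -(φt p) + D.Ham p.1 p.2 (φx p) (φxx p) ≤ 0

/-- `v` is a viscosity supersolution of the HJB equation
`−∂_t v + H(t,x,D_x v,D²_x v) = 0` on `O = [0,T)×Q` with boundary/terminal condition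
`v = −Pξ` on `∂*O`. -/
def IsViscositySupersolution (D : HJBData) (v : ℝ × Vec3 → ℝ) : Prop :=
  ContinuousOn v D.dom ∧
  (∀ p ∈ D.parBdry, v p ≥ -(p.2 0 * p.2 1)) ∧
  ∀ (φ φt : ℝ × Vec3 → ℝ) (φx : ℝ × Vec3 → Vec3) (φxx : ℝ × Vec3 → Mat3),
    IsC12 D.T D.R D.H φ φt φx φxx →
    ∀ p ∈ D.intO, IsLocalMinOn (fun w => v w - φ w) D.dom p →
      -(φt p) + D.Ham p.1 p.2 (φx p) (φxx p) ≥ 0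

section SecondOrderExpansion

open MeasureTheory Metric

variable {E : Type*} [NormedAddCommGroup E] [NormedSpace ℝ E]

lemma opNorm_le_of_sphere {ℓ : E →L[ℝ] ℝ} {R M : ℝ} (hR : 0 < R) (hM : 0 ≤ M)
    (h : ∀ e, ‖e‖ = R → ℓ e ≤ M * R) : ‖ℓ‖ ≤ M := by
  refine ContinuousLinearMap.opNorm_le_of_unit_norm hM fun x hx => ?_
  have key : ∀ y : E, ‖y‖ = 1 → ℓ y ≤ M := fun y hy => by
    have := h (R • y) (by rw [norm_smul, hy, Real.norm_of_nonneg hR.le, mul_one])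
    rw [map_smul, smul_eq_mul, mul_comm M] at this
    exact le_of_mul_le_mul_left this hR
  rw [Real.norm_eq_abs, abs_le]
  have := key (-x) (by rwa [norm_neg])
  rw [map_neg] at this
  exact ⟨by linarith, key x hx⟩

lemma eq_zero_of_le_sq {ℓ : E →L[ℝ] ℝ} {C r : ℝ} (hr : 0 < r)
    (h : ∀ v, ‖v‖ ≤ r → ℓ v ≤ C * ‖v‖ ^ 2) : ℓ = 0 := by
  have hC : ∀ v, ‖v‖ ≤ r → ℓ v ≤ |C| * ‖v‖ ^ 2 := fun v hv =>
    (h v hv).trans (mul_le_mul_of_nonneg_right (le_abs_self C) (sq_nonneg _))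
  rw [← norm_eq_zero]
  refine le_antisymm (le_of_forall_pos_le_add fun ε hε => ?_) (norm_nonneg _)
  have hC1 : 0 < |C| + 1 := by positivity
  rw [zero_add]
  have hRpos : 0 < min r (ε / (|C| + 1)) := lt_min hr (by positivity)
  refine opNorm_le_of_sphere hRpos hε.le fun e he => ?_
  refine (hC e (he.trans_le (min_le_left _ _))).trans ?_
  rw [he]
  have h1 : min r (ε / (|C| + 1)) * (|C| + 1) ≤ ε := by
    rw [← le_div_iff₀ hC1]; exact min_le_right _ _
  nlinarith [abs_nonneg C]

lemma norm_slope_sub_le {f : E → ℝ} {p p' : E →L[ℝ] ℝ} {C r : ℝ} {x x' : E} (hC : 0 ≤ C)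
    (h : ∀ v, ‖v‖ ≤ r → |f (x + v) - f x - p v| ≤ C * ‖v‖ ^ 2)
    (h' : ∀ v, ‖v‖ ≤ r → |f (x' + v) - f x' - p' v| ≤ C * ‖v‖ ^ 2)
    (hd : ‖x' - x‖ ≤ r / 2) (hne : x' ≠ x) : ‖p' - p‖ ≤ 6 * C * ‖x' - x‖ := by
  have hd0 : 0 < ‖x' - x‖ := norm_pos_iff.2 (sub_ne_zero.2 hne)
  refine opNorm_le_of_sphere hd0 (by positivity) fun e he => ?_
  have a1 := (abs_le.1 (h' e (by linarith))).1
  have a2 := (abs_le.1 (h (x' - x) (by linarith))).1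
  have hn : ‖x' - x + e‖ ≤ 2 * ‖x' - x‖ := (norm_add_le _ _).trans (by linarith)
  have a3 := (abs_le.1 (h (x' - x + e) (by linarith))).2
  have e1 : x + (x' - x) = x' := by abel
  have e2 : x + (x' - x + e) = x' + e := by abel
  rw [e1] at a2
  rw [e2, map_add] at a3
  rw [he] at a1
  have hsq : ‖x' - x + e‖ ^ 2 ≤ 4 * ‖x' - x‖ ^ 2 := by nlinarith [norm_nonneg (x' - x + e)]
  have := mul_le_mul_of_nonneg_left hsq hC
  rw [_root_.sub_apply]
  nlinarith

lemma ae_exists_mem_near [FiniteDimensional ℝ E] [MeasurableSpace E] [BorelSpace E]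
    (μ : Measure E) [μ.IsAddHaarMeasure] (S : Set E) :
    ∀ᵐ x ∂μ, x ∈ S → ∀ κ : ℝ, 0 < κ →
      ∃ r > 0, ∀ w, ‖w - x‖ < r → ∃ w' ∈ S, ‖w' - w‖ ≤ κ * ‖w - x‖ := by
  have key : ∀ n : ℕ, ∀ᵐ x ∂μ, x ∈ S → ∃ r > 0, ∀ w, ‖w - x‖ < r →
      ∃ w' ∈ S, ‖w' - w‖ ≤ (1 / ((n : ℝ) + 1)) * ‖w - x‖ := by
    intro n
    have h0 := IsUnifLocDoublingMeasure.ae_tendsto_measure_inter_div μ S ((n : ℝ) + 1)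
    filter_upwards [ae_imp_of_ae_restrict h0] with x hx hxS
    have hn : (0 : ℝ) < n + 1 := by positivity
    have lim : Tendsto (fun w => (1 / ((n : ℝ) + 1)) * ‖w - x‖) (𝓝[≠] x) (𝓝[>] 0) := by
      refine tendsto_nhdsWithin_iff.2 ⟨?_, ?_⟩
      · have : Continuous fun w => (1 / ((n : ℝ) + 1)) * ‖w - x‖ := by fun_prop
        simpa using (this.tendsto x).mono_left nhdsWithin_le_nhds
      · filter_upwards [self_mem_nhdsWithin] with w hw
        have : 0 < ‖w - x‖ := norm_pos_iff.2 (sub_ne_zero.2 hw)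
        exact mul_pos (by positivity) this
    have h1 := hx hxS id (fun w => (1 / ((n : ℝ) + 1)) * ‖w - x‖) lim (by
      refine Eventually.of_forall fun w => ?_
      rw [mem_closedBall, dist_comm, dist_eq_norm, ← mul_assoc, mul_one_div_cancel hn.ne', one_mul]
      rfl)
    have h2 : ∀ᶠ w in 𝓝[≠] x, ∃ w' ∈ S, ‖w' - w‖ ≤ (1 / ((n : ℝ) + 1)) * ‖w - x‖ := by
      filter_upwards [h1.eventually_ne one_ne_zero] with w hw
      have : (S ∩ closedBall (id w) ((1 / ((n : ℝ) + 1)) * ‖w - x‖)).Nonempty := by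
        by_contra hcon
        rw [not_nonempty_iff_eq_empty] at hcon
        exact hw (by rw [hcon]; simp)
      obtain ⟨w', hw', hb⟩ := this
      exact ⟨w', hw', by simpa [dist_eq_norm] using hb⟩
    rw [eventually_nhdsWithin_iff, Metric.eventually_nhds_iff] at h2
    obtain ⟨r, hr, h3⟩ := h2
    refine ⟨r, hr, fun w hw => ?_⟩
    by_cases hwx : w = x
    · exact ⟨x, hxS, by simp [hwx]⟩
    · exact h3 (by rwa [dist_eq_norm]) hwx
  filter_upwards [ae_all_iff.2 key] with x hx hxS κ hκ
  obtain ⟨n, hn⟩ := exists_nat_one_div_lt hκ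
  obtain ⟨r, hr, h⟩ := hx n hxS
  refine ⟨r, hr, fun w hw => ?_⟩
  obtain ⟨w', hw', hb⟩ := h w hw
  exact ⟨w', hw', hb.trans (mul_le_mul_of_nonneg_right hn.le (norm_nonneg _))⟩

lemma expansion_of_slope_hasFDerivWithinAt {f : E → ℝ} {S : Set E} {P : E → E →L[ℝ] ℝ}
    {L : E →L[ℝ] E →L[ℝ] ℝ} {C r : ℝ} {x : E} (hC : 0 ≤ C) (hr : 0 < r)
    (hS : ∀ x' ∈ S, ∀ v, ‖v‖ ≤ r → |f (x' + v) - f x' - P x' v| ≤ C * ‖v‖ ^ 2)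
    (hnear : ∀ κ : ℝ, 0 < κ →
      ∃ r > 0, ∀ w, ‖w - x‖ < r → ∃ w' ∈ S, ‖w' - w‖ ≤ κ * ‖w - x‖)
    (hL : HasFDerivWithinAt P L S x) :
    ∀ η > 0, ∃ ρ > 0, ∀ h, ‖h‖ < ρ →
      |f (x + h) - f x - P x h - 1 / 2 * L h h| ≤ η * ‖h‖ ^ 2 := by
  intro η hη
  obtain ⟨N, hN⟩ := exists_nat_gt ((5 * C + 2 * ‖L‖) / (η / 2))
  have hN0 : (0 : ℝ) < N := lt_of_le_of_lt (by positivity) hN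
  have hN1 : (1 : ℝ) ≤ N := by exact_mod_cast hN0
  have hNη : (5 * C + 2 * ‖L‖) / N ≤ η / 2 := by
    rw [div_le_iff₀ hN0]
    rw [div_lt_iff₀ (by positivity)] at hN
    linarith
  obtain ⟨r1, hr1, hr1S⟩ := hnear (1 / N) (by positivity)
  have hLo := hL.isLittleO.def (show (0 : ℝ) < η / 4 by positivity)
  rw [eventually_nhdsWithin_iff, Metric.eventually_nhds_iff] at hLo
  obtain ⟨r2, hr2, hr2L⟩ := hLo
  refine ⟨min r1 (min (r2 / 2) (r / 2)), by positivity, fun h hh => ?_⟩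
  have hh1 : ‖h‖ < r1 := hh.trans_le (min_le_left _ _)
  have hh2 : ‖h‖ < r2 / 2 := hh.trans_le ((min_le_right _ _).trans (min_le_left _ _))
  have hh3 : ‖h‖ < r / 2 := hh.trans_le ((min_le_right _ _).trans (min_le_right _ _))
  set A : ℝ := L h h with hA
  set e : ℝ := (5 * C / N ^ 2 + ‖L‖ / N ^ 2 + η / 2 / N) * ‖h‖ ^ 2 with he
  have hAn : |A| ≤ ‖L‖ * ‖h‖ ^ 2 := by
    have := L.le_opNorm₂ h h
    rw [Real.norm_eq_abs] at this
    rw [pow_two, ← mul_assoc]; exact this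
  have step : ∀ k : ℕ, (k : ℝ) + 1 ≤ N →
      |f (x + (((k : ℝ) + 1) / N) • h) - f (x + ((k : ℝ) / N) • h) - (1 / N) * P x h
        - k / N ^ 2 * A| ≤ e := by
    intro k hk
    have hk0 : (0 : ℝ) ≤ k / N := by positivity
    have hk1 : (k : ℝ) / N ≤ 1 := by rw [div_le_one hN0]; linarith
    have hkn : ‖((k : ℝ) / N) • h‖ ≤ ‖h‖ := by
      rw [norm_smul, Real.norm_of_nonneg hk0]
      exact mul_le_of_le_one_left (norm_nonneg _) hk1
    obtain ⟨w, hwS, hw⟩ := hr1S (x + ((k : ℝ) / N) • h) (by rw [add_sub_cancel_left]; linarith)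
    rw [add_sub_cancel_left] at hw
    set a : E := x + ((k : ℝ) / N) • h - w with ha
    have han : ‖a‖ ≤ 1 / N * ‖h‖ := by
      rw [ha, norm_sub_rev]
      exact hw.trans (mul_le_mul_of_nonneg_left hkn (by positivity))
    have hNinv : 1 / (N : ℝ) ≤ 1 := by rw [div_le_one hN0]; exact hN1
    have han1 : ‖a‖ ≤ ‖h‖ := han.trans (mul_le_of_le_one_left (norm_nonneg _) hNinv)
    set b : E := a + (1 / (N : ℝ)) • h with hb
    have hbn : ‖b‖ ≤ 2 * (1 / N * ‖h‖) := by
      refine (norm_add_le _ _).trans ?_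
      rw [norm_smul, Real.norm_of_nonneg (by positivity)]; linarith
    have hbn1 : ‖b‖ ≤ r := by
      have := mul_le_of_le_one_left (norm_nonneg h) hNinv
      linarith
    have f1 := abs_le.1 (hS w hwS a (by linarith))
    have f2 := abs_le.1 (hS w hwS b hbn1)
    have ea : w + a = x + ((k : ℝ) / N) • h := by rw [ha]; abel
    have eb : w + b = x + (((k : ℝ) + 1) / N) • h := by
      rw [hb, ha, add_div, add_smul]; abel
    rw [ea] at f1
    rw [eb] at f2
    have hasq : C * ‖a‖ ^ 2 ≤ C * (1 / N * ‖h‖) ^ 2 := by gcongr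
    have hbsq : C * ‖b‖ ^ 2 ≤ C * (2 * (1 / N * ‖h‖)) ^ 2 := by gcongr
    have hwx : w - x = ((k : ℝ) / N) • h - a := by rw [ha]; abel
    have hwxn : ‖w - x‖ ≤ 2 * ‖h‖ := by
      rw [hwx]; exact (norm_sub_le _ _).trans (by linarith)
    have g1 := hr2L (by rw [dist_eq_norm]; linarith) hwS
    have g2 : ‖(P w - P x - L (w - x)) h‖ ≤ η / 4 * (2 * ‖h‖) * ‖h‖ :=
      (ContinuousLinearMap.le_opNorm _ _).trans
        (mul_le_mul_of_nonneg_right (g1.trans (by gcongr)) (norm_nonneg _))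
    have g3 : ‖L a h‖ ≤ ‖L‖ * (1 / N * ‖h‖) * ‖h‖ := (L.le_opNorm₂ a h).trans (by gcongr)
    rw [Real.norm_eq_abs] at g2 g3
    have e3 : (P w - P x - L (w - x)) h = P w h - P x h - (k / N * A - L a h) := by
      rw [hwx]; simp [hA]
    rw [e3] at g2
    have e4 : P w b = P w a + 1 / N * P w h := by rw [hb]; simp
    rw [e4] at f2
    have hinv : (0 : ℝ) < 1 / N := by positivity
    have g2' := abs_le.1 g2
    have g3' := abs_le.1 g3
    have m1 := mul_le_mul_of_nonneg_left g2'.1 hinv.le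
    have m2 := mul_le_mul_of_nonneg_left g2'.2 hinv.le
    have m3 := mul_le_mul_of_nonneg_left g3'.1 hinv.le
    have m4 := mul_le_mul_of_nonneg_left g3'.2 hinv.le
    have e5 : e = C * (2 * (1 / N * ‖h‖)) ^ 2 + C * (1 / N * ‖h‖) ^ 2
        + 1 / N * (‖L‖ * (1 / N * ‖h‖) * ‖h‖) + 1 / N * (η / 4 * (2 * ‖h‖) * ‖h‖) := by
      rw [he]; field_simp; ring
    have e6 : (k : ℝ) / N ^ 2 * A = 1 / N * (k / N * A) := by field_simp
    rw [abs_le, e5, e6]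
    constructor <;> linarith [f1.1, f1.2, f2.1, f2.2]
  have sum : ∀ k : ℕ, (k : ℝ) ≤ N →
      |f (x + ((k : ℝ) / N) • h) - f x - (k / N) * P x h
        - k * (k - 1) / (2 * N ^ 2) * A| ≤ k * e := by
    intro k
    induction k with
    | zero => intro _; simp
    | succ k ih =>
      intro hk
      push_cast at hk ⊢
      have i1 := abs_le.1 (ih (by linarith))
      have i2 := abs_le.1 (step k hk)
      have e1 : ((k : ℝ) + 1) / N * P x h = k / N * P x h + 1 / N * P x h := by ring
      have e2 : ((k : ℝ) + 1) * (k + 1 - 1) / (2 * N ^ 2) * A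
          = k * (k - 1) / (2 * N ^ 2) * A + k / N ^ 2 * A := by field_simp; ring
      rw [abs_le, e1, e2]
      constructor <;> linarith [i1.1, i1.2, i2.1, i2.2]
  have fin := abs_le.1 (sum N le_rfl)
  rw [div_self hN0.ne', one_smul, one_mul] at fin
  have e1 : (N : ℝ) * (N - 1) / (2 * N ^ 2) * A = 1 / 2 * A - 1 / N * (A / 2) := by
    field_simp
  have e2 : (N : ℝ) * e = ((5 * C + 2 * ‖L‖) / N + η / 2) * ‖h‖ ^ 2 - 1 / N * (‖L‖ * ‖h‖ ^ 2) := by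
    rw [he]; field_simp; ring
  have hinv : (0 : ℝ) < 1 / N := by positivity
  have m0 := abs_le.1 hAn
  have m1 := mul_le_mul_of_nonneg_left m0.1 hinv.le
  have m2 := mul_le_mul_of_nonneg_left m0.2 hinv.le
  have m3 : ((5 * C + 2 * ‖L‖) / N + η / 2) * ‖h‖ ^ 2 ≤ η * ‖h‖ ^ 2 := by
    gcongr; linarith
  have m4 : 0 ≤ 1 / N * (‖L‖ * ‖h‖ ^ 2) := by positivity
  rw [e1, e2] at fin
  rw [abs_le]
  constructor <;> linarith [fin.1, fin.2]

lemma slope_bound_of_time_lipschitz {F : ℝ → E → ℝ} {p q : E →L[ℝ] ℝ} {C K r R m : ℝ} {s t : ℝ}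
    {x w : E} (hC : 0 ≤ C) (hK : 0 ≤ K) (hR : 0 < R) (hm : m ≤ 2)
    (hRr : 3 * R ≤ r)
    (hx : ∀ v, ‖v‖ ≤ r → |F t (x + v) - F t x - p v| ≤ C * ‖v‖ ^ 2)
    (hlip : ∀ y, |F s y - F t y| ≤ K * |s - t|) (hs : |s - t| ≤ R ^ 2)
    (hw : ‖w - x‖ ≤ m * R)
    (hq : ∀ v, F s w + q v - C * ‖v‖ ^ 2 ≤ F s (w + v)) :
    ‖q - p‖ ≤ (2 * K + 14 * C) * R := by
  refine opNorm_le_of_sphere hR (by positivity) fun e he => ?_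
  have h1 := hq e
  have h2 := (abs_le.1 (hlip (w + e))).2
  have h3 := (abs_le.1 (hlip w)).1
  have hKs : K * |s - t| ≤ K * R ^ 2 := by gcongr
  have hw2 : ‖w - x‖ ≤ 2 * R := hw.trans (by gcongr)
  have hn : ‖w - x + e‖ ≤ 3 * R := (norm_add_le _ _).trans (by linarith)
  have h4 := (abs_le.1 (hx (w - x + e) (by linarith))).2
  have h5 := (abs_le.1 (hx (w - x) (by linarith))).1
  have e1 : x + (w - x) = w := by abel
  have e2 : x + (w - x + e) = w + e := by abel
  rw [e1] at h5
  rw [e2, map_add] at h4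
  rw [he] at h1
  have q1 : C * ‖w - x‖ ^ 2 ≤ C * (2 * R) ^ 2 := by gcongr
  have q2 : C * ‖w - x + e‖ ^ 2 ≤ C * (3 * R) ^ 2 := by gcongr
  rw [_root_.sub_apply]
  nlinarith

lemma abs_increment_sub_slope_le {F : ℝ → E → ℝ} {p : E →L[ℝ] ℝ} {C K r R κ : ℝ} {s t : ℝ}
    {x w w' : E} (hC : 0 ≤ C) (hK : 0 ≤ K) (hR : 0 < R) (hRr : 3 * R ≤ r)
    (hκ0 : 0 ≤ κ) (hκ : κ ≤ 1)
    (hx : ∀ v, ‖v‖ ≤ r → |F t (x + v) - F t x - p v| ≤ C * ‖v‖ ^ 2)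
    (hlip : ∀ y, |F s y - F t y| ≤ K * |s - t|) (hs : |s - t| ≤ R ^ 2)
    (hlow : ∀ y, ∃ q : E →L[ℝ] ℝ, ∀ v, F s y + q v - C * ‖v‖ ^ 2 ≤ F s (y + v))
    (hw : ‖w - x‖ ≤ R) (hww : ‖w - w'‖ ≤ κ * R) :
    |F s w - F s w' - p (w - w')| ≤ (2 * K + 15 * C) * κ * R ^ 2 := by
  obtain ⟨q, hq⟩ := hlow w
  obtain ⟨q', hq'⟩ := hlow w'
  have hw' : ‖w' - x‖ ≤ 2 * R := by
    have : w' - x = (w - x) - (w - w') := by abel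
    rw [this]
    refine (norm_sub_le _ _).trans ?_
    nlinarith
  have b1 := slope_bound_of_time_lipschitz hC hK hR one_le_two hRr hx hlip hs
    (by rwa [one_mul]) hq
  have b2 := slope_bound_of_time_lipschitz hC hK hR le_rfl hRr hx hlip hs hw' hq'
  have h1 := hq (w' - w)
  have h2 := hq' (w - w')
  have e1 : w + (w' - w) = w' := by abel
  have e2 : w' + (w - w') = w := by abel
  have e3 : w' - w = -(w - w') := by abel
  rw [e1, e3, map_neg, norm_neg] at h1
  rw [e2] at h2
  have c1 : |(q - p) (w - w')| ≤ (2 * K + 14 * C) * R * (κ * R) :=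
    ((q - p).le_opNorm _).trans (by gcongr)
  have c2 : |(q' - p) (w - w')| ≤ (2 * K + 14 * C) * R * (κ * R) :=
    ((q' - p).le_opNorm _).trans (by gcongr)
  rw [_root_.sub_apply] at c1 c2
  have d1 := abs_le.1 c1
  have d2 := abs_le.1 c2
  have d3 : C * ‖w - w'‖ ^ 2 ≤ C * (κ * R ^ 2) := by
    have : ‖w - w'‖ ^ 2 ≤ (κ * R) ^ 2 := by gcongr
    have h5 : κ ^ 2 ≤ κ := by nlinarith
    have : (κ * R) ^ 2 ≤ κ * R ^ 2 := by rw [mul_pow]; gcongr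
    exact mul_le_mul_of_nonneg_left (by linarith) hC
  rw [abs_le]
  constructor <;> nlinarith

set_option maxHeartbeats 1000000 in
/-- Joint first order in time and second order in space expansion, at almost every point of
upper contact, of a function which is Lipschitz in time and semiconvex in space. -/
lemma ae_parabolic_expansion [FiniteDimensional ℝ E] [MeasurableSpace E] [BorelSpace E]
    (μ : Measure E) [μ.IsAddHaarMeasure] {F : ℝ → E → ℝ} {C K r : ℝ} {t : ℝ}
    (hC : 0 ≤ C) (hK : 0 ≤ K) (hr : 0 < r)
    (hlip : ∀ s s' y, |F s y - F s' y| ≤ K * |s - s'|)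
    (hlow : ∀ s y, ∃ q : E →L[ℝ] ℝ, ∀ v, F s y + q v - C * ‖v‖ ^ 2 ≤ F s (y + v))
    (hdiff : ∀ᵐ x ∂μ, DifferentiableAt ℝ (fun s => F s x) t) :
    ∀ᵐ x ∂μ, (∃ p : E →L[ℝ] ℝ, ∀ v, ‖v‖ ≤ r → F t (x + v) ≤ F t x + p v + C * ‖v‖ ^ 2) →
      ∃ (p : E →L[ℝ] ℝ) (L : E →L[ℝ] E →L[ℝ] ℝ), ∀ η > 0, ∃ ρ > 0, ∀ s w,
        |s - t| < ρ → ‖w - x‖ < ρ →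
        |F s w - F t x - deriv (fun s => F s x) t * (s - t) - p (w - x)
          - 1 / 2 * L (w - x) (w - x)| ≤ η * (|s - t| + ‖w - x‖ ^ 2) := by
  classical
  set two : E → (E →L[ℝ] ℝ) → Prop := fun x p =>
    ∀ v, ‖v‖ ≤ r → |F t (x + v) - F t x - p v| ≤ C * ‖v‖ ^ 2 with htwo
  set B : Set E := {x | ∃ p, two x p} with hB
  set P : E → E →L[ℝ] ℝ := fun x => if h : ∃ p, two x p then h.choose else 0 with hP
  have hPB : ∀ x ∈ B, two x (P x) := fun x hx => by
    have : ∃ p, two x p := hx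
    simp only [hP, dif_pos this]
    exact this.choose_spec
  set a : E → ℝ := fun x => deriv (fun s => F s x) t with ha
  obtain ⟨c, hc⟩ := TopologicalSpace.exists_dense_seq E
  set T : ℕ → Set E := fun i => B ∩ closedBall (c i) (r / 4) with hTdef
  have hTlip : ∀ i, LipschitzOnWith (6 * C).toNNReal P (T i) := by
    intro i
    refine LipschitzOnWith.of_dist_le_mul fun x hx y hy => ?_
    rw [dist_eq_norm, dist_eq_norm, Real.coe_toNNReal _ (by positivity)]
    by_cases hxy : x = y
    · simp [hxy]
    refine norm_slope_sub_le hC (hPB y hy.1) (hPB x hx.1) ?_ hxy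
    have h1 := mem_closedBall.1 hx.2
    have h2 := mem_closedBall'.1 hy.2
    rw [← dist_eq_norm]
    linarith [dist_triangle x (c i) y]
  set S : ℕ → ℕ → ℤ → Set E := fun n j k => {x | x ∈ B ∧
    (∀ s, |s - t| < 1 / ((j : ℝ) + 1) →
      |F s x - F t x - a x * (s - t)| ≤ 1 / ((n : ℝ) + 1) * |s - t|) ∧
    ⌊a x * ((n : ℝ) + 1)⌋ = k} with hSdef
  have A1 : ∀ᵐ x ∂μ, ∀ i, x ∈ T i → DifferentiableWithinAt ℝ P (T i) x :=
    ae_all_iff.2 fun i => (hTlip i).ae_differentiableWithinAt_of_mem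
  have A2 : ∀ᵐ x ∂μ, ∀ i, x ∈ T i → ∀ κ : ℝ, 0 < κ →
      ∃ r > 0, ∀ w, ‖w - x‖ < r → ∃ w' ∈ T i, ‖w' - w‖ ≤ κ * ‖w - x‖ :=
    ae_all_iff.2 fun i => ae_exists_mem_near μ (T i)
  have A3 : ∀ᵐ x ∂μ, ∀ n j k, x ∈ S n j k → ∀ κ : ℝ, 0 < κ →
      ∃ r > 0, ∀ w, ‖w - x‖ < r → ∃ w' ∈ S n j k, ‖w' - w‖ ≤ κ * ‖w - x‖ := by
    refine ae_all_iff.2 fun n => ae_all_iff.2 fun j => ae_all_iff.2 fun k =>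
      ae_exists_mem_near μ (S n j k)
  filter_upwards [A1, A2, A3, hdiff] with x hx1 hx2 hx3 hx4 hup
  have hxB : x ∈ B := by
    obtain ⟨p, hp⟩ := hup
    obtain ⟨q, hq⟩ := hlow t x
    have hqp : q - p = 0 := by
      refine eq_zero_of_le_sq (C := 2 * C) hr fun v hv => ?_
      rw [_root_.sub_apply]
      linarith [hp v hv, hq v]
    rw [sub_eq_zero] at hqp
    refine ⟨p, fun v hv => abs_le.2 ⟨?_, ?_⟩⟩
    · have := hq v
      rw [hqp] at this
      linarith
    · linarith [hp v hv]
  obtain ⟨i, hi⟩ : ∃ i, x ∈ T i := by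
    obtain ⟨i, hy⟩ := hc.exists_dist_lt x (show 0 < r / 4 by positivity)
    exact ⟨i, hxB, hy.le⟩
  obtain ⟨L, hL⟩ := hx1 i hi
  have stat := expansion_of_slope_hasFDerivWithinAt (f := F t) hC hr
    (fun x' hx' => hPB x' hx'.1) (hx2 i hi) hL
  refine ⟨P x, L, fun η hη => ?_⟩
  obtain ⟨ρ1, hρ1, st⟩ := stat (η / 2) (by positivity)
  obtain ⟨n, hn⟩ := exists_nat_one_div_lt (show 0 < η / 8 by positivity)
  have hderiv : HasDerivAt (fun s => F s x) (a x) t := hx4.hasDerivAt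
  obtain ⟨j, hj⟩ : ∃ j : ℕ, ∀ s, |s - t| < 1 / ((j : ℝ) + 1) →
      |F s x - F t x - a x * (s - t)| ≤ 1 / ((n : ℝ) + 1) * |s - t| := by
    have := (hasDerivAt_iff_isLittleO.1 hderiv).def (show (0 : ℝ) < 1 / (n + 1) by positivity)
    rw [Metric.eventually_nhds_iff] at this
    obtain ⟨δ, hδ, h⟩ := this
    obtain ⟨j, hj⟩ := exists_nat_one_div_lt hδ
    refine ⟨j, fun s hs => ?_⟩
    have := h (y := s) (by rw [Real.dist_eq]; linarith)
    simpa [mul_comm] using this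
  have hxS : x ∈ S n j ⌊a x * ((n : ℝ) + 1)⌋ := ⟨hxB, hj, rfl⟩
  set κ : ℝ := min 1 (η / (16 * (2 * K + 15 * C) + 16)) with hκ
  have hden : 0 < 16 * (2 * K + 15 * C) + 16 := by positivity
  have hκ0 : 0 < κ := lt_min one_pos (by positivity)
  have hκ1 : κ ≤ 1 := min_le_left _ _
  have hκη : (2 * K + 15 * C) * κ ≤ η / 16 := by
    have h1 : κ * (16 * (2 * K + 15 * C) + 16) ≤ η := by
      rw [← le_div_iff₀ hden]; exact min_le_right _ _
    nlinarith
  obtain ⟨ρ2, hρ2, near⟩ := hx3 n j _ hxS κ hκ0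
  set ρ3 : ℝ := min 1 (r / 6) with hρ3
  have hρ3p : 0 < ρ3 := lt_min one_pos (by positivity)
  refine ⟨min (min ρ1 ρ2) (min (1 / ((j : ℝ) + 1)) (ρ3 ^ 2)), by positivity,
    fun s w hs hw => ?_⟩
  have hs1 : |s - t| < 1 / ((j : ℝ) + 1) :=
    hs.trans_le ((min_le_right _ _).trans (min_le_left _ _))
  have hs2 : |s - t| < ρ3 ^ 2 := hs.trans_le ((min_le_right _ _).trans (min_le_right _ _))
  have hw1 : ‖w - x‖ < ρ1 := hw.trans_le ((min_le_left _ _).trans (min_le_left _ _))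
  have hw2 : ‖w - x‖ < ρ2 := hw.trans_le ((min_le_left _ _).trans (min_le_right _ _))
  have hw3 : ‖w - x‖ < ρ3 ^ 2 := hw.trans_le ((min_le_right _ _).trans (min_le_right _ _))
  have hρ31 : ρ3 ≤ 1 := min_le_left _ _
  have hρ3r : ρ3 ≤ r / 6 := min_le_right _ _
  have s1 := st (w - x) hw1
  rw [add_sub_cancel] at s1
  have time : |F s w - F t w - a x * (s - t)| ≤ η / 2 * (|s - t| + ‖w - x‖ ^ 2) := by
    set R : ℝ := ‖w - x‖ + √|s - t| with hR
    have hsq : √|s - t| ^ 2 = |s - t| := Real.sq_sqrt (abs_nonneg _)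
    have hsn := Real.sqrt_nonneg |s - t|
    have hwn := norm_nonneg (w - x)
    rcases eq_or_lt_of_le (show 0 ≤ R by positivity) with hR0 | hR0
    · have h0 : √|s - t| = 0 := by linarith
      rw [h0] at hsq
      have : s = t := by
        have : |s - t| = 0 := by linarith
        linarith [abs_eq_zero.1 this]
      subst this
      simp only [sub_self, mul_zero, abs_zero]
      positivity
    have hRr : 3 * R ≤ r := by
      have : √|s - t| ≤ ρ3 := Real.sqrt_le_iff.2 ⟨hρ3p.le, hs2.le⟩
      nlinarith
    have hsR : |s - t| ≤ R ^ 2 := by nlinarith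
    have hR2 : R ^ 2 ≤ 2 * (|s - t| + ‖w - x‖ ^ 2) := by
      nlinarith [sq_nonneg (‖w - x‖ - √|s - t|)]
    obtain ⟨w', hw'S, hw'⟩ := near w hw2
    have hww : ‖w - w'‖ ≤ κ * R := by
      rw [norm_sub_rev]
      refine hw'.trans ?_
      gcongr; linarith
    have i1 := abs_le.1 (abs_increment_sub_slope_le hC hK hR0 hRr hκ0.le hκ1 (hPB x hxB)
      (fun y => hlip s t y) hsR (hlow s) (by linarith) hww)
    have i2 := abs_le.1 (abs_increment_sub_slope_le (s := t) hC hK hR0 hRr hκ0.le hκ1 (hPB x hxB)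
      (fun y => by simp) (by rw [sub_self, abs_zero]; positivity) (hlow t)
      (by linarith) hww)
    have i3 := abs_le.1 (hw'S.2.1 s hs1)
    have i4 : |a w' - a x| ≤ 1 / ((n : ℝ) + 1) := by
      have := Int.abs_sub_lt_one_of_floor_eq_floor hw'S.2.2
      rw [← sub_mul, abs_mul, abs_of_pos (show (0 : ℝ) < n + 1 by positivity)] at this
      rw [le_div_iff₀ (by positivity)]
      exact this.le
    have i5 : |(a w' - a x) * (s - t)| ≤ 1 / ((n : ℝ) + 1) * |s - t| := by
      rw [abs_mul]; gcongr
    have i6 := abs_le.1 i5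
    have i7 : 1 / ((n : ℝ) + 1) * |s - t| ≤ η / 8 * |s - t| := by gcongr
    have i8 : (2 * K + 15 * C) * κ * R ^ 2 ≤ η / 16 * (2 * (|s - t| + ‖w - x‖ ^ 2)) := by
      gcongr
    have i9 : 0 ≤ η * ‖w - x‖ ^ 2 := by positivity
    rw [abs_le]
    constructor <;> linarith [i1.1, i1.2, i2.1, i2.2, i3.1, i3.2, i6.1, i6.2]
  have s2 := abs_le.1 s1
  have t2 := abs_le.1 time
  change |F s w - F t x - a x * (s - t) - P x (w - x) - 1 / 2 * L (w - x) (w - x)| ≤ _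
  rw [abs_le]
  have : 0 ≤ η * |s - t| := by positivity
  constructor <;> linarith [s2.1, s2.2, t2.1, t2.2]

end SecondOrderExpansion

section TimeContact

open MeasureTheory Metric

lemma le_of_hasDerivAt_of_touching {M g : ℝ → ℝ} {α β t : ℝ} (hM : HasDerivAt M α t)
    (hg : HasDerivAt g β t) (hle : ∀ s, g s ≤ M s) (heq : g t = M t) : β = α := by
  have hmin : IsLocalMin (fun s => M s - g s) t :=
    Eventually.of_forall fun s => by
      change M t - g t ≤ M s - g s
      linarith [hle s]
  have := hmin.hasDerivAt_eq_zero (hM.sub hg)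
  linarith

lemma sub_le_of_ae_le_deriv {M : ℝ → ℝ} {K : NNReal} {a b η : ℝ} (hM : LipschitzWith K M)
    (hab : a ≤ b) (h : ∀ᵐ t, t ∈ Ioo a b → η ≤ deriv M t) : η * (b - a) ≤ M b - M a := by
  have hac : AbsolutelyContinuousOnInterval M a b :=
    hM.lipschitzOnWith.absolutelyContinuousOnInterval
  rw [← hac.integral_deriv_eq_sub]
  have : ∫ _ in a..b, η = η * (b - a) := by simp [mul_comm]
  rw [← this]
  refine intervalIntegral.integral_mono_ae_restrict hab (by simp) hac.intervalIntegrable_deriv ?_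
  rw [← restrict_Ioo_eq_restrict_Icc]
  exact (ae_restrict_iff' measurableSet_Ioo).2 h

variable {G : Type*} [NormedAddCommGroup G] [NormedSpace ℝ G] [FiniteDimensional ℝ G]
  [MeasurableSpace G] [BorelSpace G]

lemma null_image_of_lipschitzOnWith_dual (μ : Measure G) [μ.IsAddHaarMeasure]
    (ν : Measure (G →L[ℝ] ℝ)) [ν.IsAddHaarMeasure] {P : G → G →L[ℝ] ℝ} {K : NNReal} {N : Set G}
    (hP : LipschitzOnWith K P N) (hN : μ N = 0) : ν (P '' N) = 0 := by
  have hfin : Module.finrank ℝ (G →L[ℝ] ℝ) = Module.finrank ℝ G := by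
    rw [← (LinearMap.toContinuousLinearMap (𝕜 := ℝ) (E := G) (F' := ℝ)).finrank_eq]
    exact Subspace.dual_finrank_eq
  have : (Measure.hausdorffMeasure (X := G →L[ℝ] ℝ) (Module.finrank ℝ G : ℝ)).IsAddHaarMeasure := by
    rw [← hfin]; infer_instance
  refine Measure.absolutelyContinuous_isAddHaarMeasure ν
    (Measure.hausdorffMeasure (X := G →L[ℝ] ℝ) (Module.finrank ℝ G : ℝ)) ?_
  have h0 : Measure.hausdorffMeasure (X := G) (Module.finrank ℝ G : ℝ) N = 0 :=
    Measure.absolutelyContinuous_isAddHaarMeasure _ μ hN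
  have := hP.hausdorffMeasure_image_le (d := (Module.finrank ℝ G : ℝ)) (by positivity)
  rw [h0, mul_zero] at this
  exact le_antisymm this bot_le

lemma null_setOf_slope (μ : Measure G) [μ.IsAddHaarMeasure]
    (ν : Measure (G →L[ℝ] ℝ)) [ν.IsAddHaarMeasure] {f : G → ℝ} {C r : ℝ} (hC : 0 ≤ C)
    (hr : 0 < r) {N : Set G} (hN : μ N = 0) :
    ν {p | ∃ z ∈ N, ∀ v, ‖v‖ ≤ r → |f (z + v) - f z - p v| ≤ C * ‖v‖ ^ 2} = 0 := by
  classical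
  set two : G → (G →L[ℝ] ℝ) → Prop := fun x p =>
    ∀ v, ‖v‖ ≤ r → |f (x + v) - f x - p v| ≤ C * ‖v‖ ^ 2 with htwo
  set P : G → G →L[ℝ] ℝ := fun x => if h : ∃ p, two x p then h.choose else 0 with hP
  have hPB : ∀ x p, two x p → two x (P x) := fun x p hx => by
    have : ∃ p, two x p := ⟨p, hx⟩
    simp only [hP, dif_pos this]
    exact this.choose_spec
  obtain ⟨c, hc⟩ := TopologicalSpace.exists_dense_seq G
  set S : ℕ → Set G := fun i => {x | x ∈ N ∧ (∃ p, two x p) ∧ x ∈ closedBall (c i) (r / 4)}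
  have hS : ∀ i, ν (P '' S i) = 0 := by
    intro i
    refine null_image_of_lipschitzOnWith_dual (K := (6 * C).toNNReal) μ ν ?_
      (measure_mono_null (fun x hx => hx.1) hN)
    refine LipschitzOnWith.of_dist_le_mul fun x hx y hy => ?_
    rw [dist_eq_norm, dist_eq_norm, Real.coe_toNNReal _ (by positivity)]
    by_cases hxy : x = y
    · simp [hxy]
    obtain ⟨px, hpx⟩ := hx.2.1
    obtain ⟨py, hpy⟩ := hy.2.1
    refine norm_slope_sub_le hC (hPB y py hpy) (hPB x px hpx) ?_ hxy
    have h1 := mem_closedBall.1 hx.2.2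
    have h2 := mem_closedBall'.1 hy.2.2
    rw [← dist_eq_norm]
    linarith [dist_triangle x (c i) y]
  refine measure_mono_null ?_ (measure_iUnion_null hS)
  rintro p ⟨z, hz, hp⟩
  obtain ⟨i, hi⟩ := hc.exists_dist_lt z (show 0 < r / 4 by positivity)
  refine mem_iUnion.2 ⟨i, z, ⟨hz, ⟨p, hp⟩, hi.le⟩, ?_⟩
  rw [← sub_eq_zero]
  refine eq_zero_of_le_sq (C := 2 * C) hr fun v hv => ?_
  have h1 := abs_le.1 (hPB z p hp v hv)
  have h2 := abs_le.1 (hp v hv)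
  rw [_root_.sub_apply]
  linarith [h1.1, h1.2, h2.1, h2.2]

/-- Simultaneous selection of a time and of a small linear perturbation such that the perturbed
maximum is attained off a given null set, with control on the time derivative there. -/
lemma exists_perturbed_max_off_null (μ : Measure G) [μ.IsAddHaarMeasure] {u : ℝ → G → ℝ}
    {C K r ρ₀ η t₀ t₁ : ℝ} {Z Z₀ : Set G} {N : ℝ → Set G} (hC : 0 ≤ C)
    (hr : 0 < r) (hρ : 0 < ρ₀) (ht : t₀ < t₁)
    (hu : Continuous fun q : ℝ × G => u q.1 q.2)
    (hlip : ∀ s s' z, |u s z - u s' z| ≤ K * |s - s'|)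
    (hlow : ∀ s z, ∃ q : G →L[ℝ] ℝ, ∀ v, u s z + q v - C * ‖v‖ ^ 2 ≤ u s (z + v))
    (hZ : IsCompact Z) (hZne : Z.Nonempty)
    (hthick : ∀ z ∈ Z₀, ∀ v, ‖v‖ ≤ r → z + v ∈ Z)
    (hmax : ∀ p : G →L[ℝ] ℝ, ‖p‖ < ρ₀ → ∀ s ∈ Icc t₀ t₁, ∀ z ∈ Z,
      (∀ z' ∈ Z, u s z' - p z' ≤ u s z - p z) → z ∈ Z₀)
    (hrate : ∀ p : G →L[ℝ] ℝ, ‖p‖ < ρ₀ → ∀ z₁ ∈ Z,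
      ∃ z₀ ∈ Z, u t₁ z₁ - p z₁ < u t₀ z₀ - p z₀ + η * (t₁ - t₀))
    (hN : ∀ᵐ t, μ (N t) = 0) :
    ∃ t ∈ Ioo t₀ t₁, ∃ p : G →L[ℝ] ℝ, ‖p‖ < ρ₀ ∧ ∃ z ∈ Z₀, z ∉ N t ∧
      (∀ z' ∈ Z, u t z' - p z' ≤ u t z - p z) ∧
      ∀ β, HasDerivAt (fun s => u s z) β t → β ≤ η := by
  classical
  set ν : Measure (G →L[ℝ] ℝ) := Measure.addHaar
  set M : (G →L[ℝ] ℝ) → ℝ → ℝ := fun p s => sSup ((fun z => u s z - p z) '' Z) with hM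
  have hcz : ∀ s p, Continuous fun z => u s z - (p : G →L[ℝ] ℝ) z := fun s p => by fun_prop
  have hMatt : ∀ p s, ∃ z ∈ Z, M p s = u s z - p z ∧ ∀ z' ∈ Z, u s z' - p z' ≤ u s z - p z :=
    fun p s => hZ.exists_sSup_image_eq_and_ge hZne (hcz s p).continuousOn
  have hMge : ∀ p s, ∀ z ∈ Z, u s z - p z ≤ M p s := fun p s z hz => by
    obtain ⟨z', -, h1, h2⟩ := hMatt p s
    rw [h1]; exact h2 z hz
  have hMcont : Continuous (Function.uncurry M) := by
    have : Continuous ↿(fun (q : (G →L[ℝ] ℝ) × ℝ) (z : G) => u q.2 z - q.1 z) := by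
      change Continuous fun w : ((G →L[ℝ] ℝ) × ℝ) × G => u w.1.2 w.2 - w.1.1 w.2
      have : Continuous fun w : ((G →L[ℝ] ℝ) × ℝ) × G => u w.1.2 w.2 :=
        hu.comp (f := fun w : ((G →L[ℝ] ℝ) × ℝ) × G => (w.1.2, w.2)) (by fun_prop)
      fun_prop
    exact hZ.continuous_sSup this
  have hMlip : ∀ p, LipschitzWith K.toNNReal (M p) := by
    intro p
    refine LipschitzWith.of_le_add_mul' K fun s s' => ?_
    obtain ⟨z, hz, h1, -⟩ := hMatt p s
    rw [h1, Real.dist_eq]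
    linarith [hMge p s' z hz, (abs_le.1 (hlip s s' z)).2]
  by_contra hcon
  push Not at hcon
  set bad : ℝ → (G →L[ℝ] ℝ) → Prop := fun t p =>
    t ∈ Ioo t₀ t₁ ∧ p ∈ ball (0 : G →L[ℝ] ℝ) ρ₀ ∧ DifferentiableAt ℝ (M p) t ∧
      deriv (M p) t < η with hbad
  have hmeas : MeasurableSet {q : ℝ × (G →L[ℝ] ℝ) | ¬ bad q.1 q.2} := by
    refine MeasurableSet.compl ?_
    have m1 : MeasurableSet {q : (G →L[ℝ] ℝ) × ℝ | DifferentiableAt ℝ (M q.1) q.2} :=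
      measurableSet_of_differentiableAt_with_param ℝ hMcont
    have m2 : Measurable fun q : (G →L[ℝ] ℝ) × ℝ => deriv (M q.1) q.2 :=
      measurable_deriv_with_param hMcont
    exact ((measurable_fst measurableSet_Ioo).inter
      ((measurable_snd measurableSet_ball).inter
        ((measurable_swap m1).inter ((m2.comp measurable_swap) measurableSet_Iio))))
  have h1 : ∀ᵐ t, ∀ᵐ p ∂ν, ¬ bad t p := by
    filter_upwards [hN] with t htN
    rw [ae_iff]
    refine measure_mono_null ?_ (null_setOf_slope μ ν (f := u t) hC hr htN)
    intro p hp
    obtain ⟨htI, hpb, hd, hlt⟩ := not_not.1 hp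
    have hp0 : ‖p‖ < ρ₀ := mem_ball_zero_iff.1 hpb
    obtain ⟨z, hz, hzM, hzmax⟩ := hMatt p t
    have hz0 : z ∈ Z₀ := hmax p hp0 t ⟨htI.1.le, htI.2.le⟩ z hz hzmax
    have hzN : z ∈ N t := by
      by_contra hzN
      obtain ⟨β, hβ, hβη⟩ := hcon t htI p hp0 z hz0 hzN hzmax
      have := le_of_hasDerivAt_of_touching hd.hasDerivAt (hβ.sub_const (p z))
        (fun s => hMge p s z hz) hzM.symm
      linarith
    refine ⟨z, hzN, fun v hv => ?_⟩
    have up : ∀ v, ‖v‖ ≤ r → u t (z + v) - u t z - p v ≤ 0 := fun v hv => by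
      have := hzmax _ (hthick z hz0 v hv)
      rw [map_add] at this
      linarith
    obtain ⟨q, hq⟩ := hlow t z
    have hqp : q - p = 0 := by
      refine eq_zero_of_le_sq (C := C) hr fun v hv => ?_
      rw [_root_.sub_apply]
      linarith [up v hv, hq v]
    rw [sub_eq_zero] at hqp
    have hqv := hq v
    rw [hqp] at hqv
    have : 0 ≤ C * ‖v‖ ^ 2 := by positivity
    exact abs_le.2 ⟨by linarith, by linarith [up v hv]⟩
  have h2 : ∀ᵐ p ∂ν, ∀ᵐ t, ¬ bad t p := (Measure.ae_ae_comm hmeas).1 h1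
  have h3 : ∃ p ∈ ball (0 : G →L[ℝ] ℝ) ρ₀, ∀ᵐ t, ¬ bad t p := by
    by_contra hno
    push Not at hno
    have : ν (ball (0 : G →L[ℝ] ℝ) ρ₀) = 0 :=
      measure_mono_null (fun p hp => by simpa using hno p hp) (ae_iff.1 h2)
    exact (measure_ball_pos ν 0 hρ).ne' this
  obtain ⟨p, hpb, hp⟩ := h3
  have h4 : ∀ᵐ t, t ∈ Ioo t₀ t₁ → η ≤ deriv (M p) t := by
    filter_upwards [hp, (hMlip p).ae_differentiableAt_real] with t hb hd htI
    by_contra hlt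
    exact hb ⟨htI, hpb, hd, not_le.1 hlt⟩
  have h5 := sub_le_of_ae_le_deriv (hMlip p) ht.le h4
  obtain ⟨z₁, hz₁, e₁, -⟩ := hMatt p t₁
  obtain ⟨z₀, hz₀, e₀⟩ := hrate p (mem_ball_zero_iff.1 hpb) z₁ hz₁
  linarith [hMge p t₀ z₀ hz₀]

end TimeContact

section SupConvolution

/-- The squared Euclidean norm on `Vec3`. -/
def sqn (v : Vec3) : ℝ := ∑ i, v i ^ 2

lemma dotCLM_apply (a v : Vec3) : dotCLM a v = ∑ i, a i * v i := by
  simp [dotCLM]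

lemma sqn_add (a v : Vec3) : sqn (a + v) = sqn a + 2 * dotCLM a v + sqn v := by
  rw [dotCLM_apply]
  simp only [sqn, Pi.add_apply, Finset.mul_sum, ← Finset.sum_add_distrib]
  exact Finset.sum_congr rfl fun i _ => by ring

lemma sqn_nonneg (v : Vec3) : 0 ≤ sqn v := Finset.sum_nonneg fun _ _ => sq_nonneg _

lemma sqn_smul (c : ℝ) (v : Vec3) : sqn (c • v) = c ^ 2 * sqn v := by
  simp only [sqn, Pi.smul_apply, smul_eq_mul, mul_pow, Finset.mul_sum]

lemma sqn_neg (v : Vec3) : sqn (-v) = sqn v := by simp [sqn]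

lemma sqn_le (v : Vec3) : sqn v ≤ 3 * ‖v‖ ^ 2 := by
  have : ∀ i ∈ Finset.univ, v i ^ 2 ≤ ‖v‖ ^ 2 := fun i _ => by
    rw [← sq_abs (v i)]
    exact pow_le_pow_left₀ (abs_nonneg _) (norm_le_pi_norm v i) 2
  have := Finset.sum_le_card_nsmul _ _ _ this
  simpa [sqn] using this

lemma norm_sq_le_sqn (v : Vec3) : ‖v‖ ^ 2 ≤ sqn v := by
  have h : ‖v‖ ≤ √(sqn v) := by
    refine (pi_norm_le_iff_of_nonneg (Real.sqrt_nonneg _)).2 fun i => ?_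
    refine Real.abs_le_sqrt ?_
    exact Finset.single_le_sum (f := fun i => v i ^ 2) (fun i _ => sq_nonneg _) (Finset.mem_univ i)
  calc ‖v‖ ^ 2 ≤ √(sqn v) ^ 2 := by gcongr
    _ = sqn v := Real.sq_sqrt (sqn_nonneg v)

lemma continuous_sqn : Continuous sqn := by
  unfold sqn; fun_prop

/-- The sup-convolution of `w` over `Ω`, with an absolute value penalty in time and a
quadratic penalty in space. -/
def supConv (w : ℝ × Vec3 → ℝ) (Ω : Set (ℝ × Vec3)) (K c : ℝ) (t : ℝ) (x : Vec3) : ℝ :=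
  sSup ((fun q => w q - K * |t - q.1| - c * sqn (x - q.2)) '' Ω)

variable {w : ℝ × Vec3 → ℝ} {Ω : Set (ℝ × Vec3)} {K c : ℝ}

lemma supConv_attained (hw : Continuous w) (hΩ : IsCompact Ω) (hne : Ω.Nonempty) (t : ℝ)
    (x : Vec3) : ∃ q ∈ Ω, supConv w Ω K c t x = w q - K * |t - q.1| - c * sqn (x - q.2) := by
  have hc : Continuous fun q : ℝ × Vec3 => w q - K * |t - q.1| - c * sqn (x - q.2) := by
    have := continuous_sqn; fun_prop
  exact hΩ.exists_sSup_image_eq hne hc.continuousOn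

lemma le_supConv (hw : Continuous w) (hΩ : IsCompact Ω) {q : ℝ × Vec3} (hq : q ∈ Ω) (t : ℝ)
    (x : Vec3) : w q - K * |t - q.1| - c * sqn (x - q.2) ≤ supConv w Ω K c t x := by
  have hc : Continuous fun q : ℝ × Vec3 => w q - K * |t - q.1| - c * sqn (x - q.2) := by
    have := continuous_sqn; fun_prop
  exact le_csSup (hΩ.image hc).bddAbove (mem_image_of_mem _ hq)

lemma continuous_supConv (hw : Continuous w) (hΩ : IsCompact Ω) :
    Continuous fun q : ℝ × Vec3 => supConv w Ω K c q.1 q.2 := by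
  have : Continuous ↿(fun (q : ℝ × Vec3) (q' : ℝ × Vec3) =>
      w q' - K * |q.1 - q'.1| - c * sqn (q.2 - q'.2)) := by
    have := continuous_sqn
    change Continuous fun z : (ℝ × Vec3) × ℝ × Vec3 =>
      w z.2 - K * |z.1.1 - z.2.1| - c * sqn (z.1.2 - z.2.2)
    fun_prop
  exact hΩ.continuous_sSup this

lemma supConv_lipschitz (hw : Continuous w) (hΩ : IsCompact Ω) (hne : Ω.Nonempty) (hK : 0 ≤ K)
    (s s' : ℝ) (y : Vec3) : |supConv w Ω K c s y - supConv w Ω K c s' y| ≤ K * |s - s'| := by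
  have key : ∀ s s', supConv w Ω K c s y - supConv w Ω K c s' y ≤ K * |s - s'| := by
    intro s s'
    obtain ⟨q, hq, e⟩ := supConv_attained (K := K) (c := c) hw hΩ hne s y
    have h1 := le_supConv (K := K) (c := c) hw hΩ hq s' y
    have h2 : |s' - q.1| ≤ |s - q.1| + |s - s'| := by
      have := abs_sub_le s' s q.1
      rw [abs_sub_comm s' s] at this
      linarith
    have := mul_le_mul_of_nonneg_left h2 hK
    rw [e]; linarith
  have h2 := key s' s
  rw [abs_sub_comm s' s] at h2
  exact abs_le.2 ⟨by linarith, key s s'⟩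

lemma supConv_lower (hw : Continuous w) (hΩ : IsCompact Ω) (hne : Ω.Nonempty) (hc : 0 ≤ c)
    (s : ℝ) (y : Vec3) : ∃ q : Vec3 →L[ℝ] ℝ, ∀ v,
      supConv w Ω K c s y + q v - 3 * c * ‖v‖ ^ 2 ≤ supConv w Ω K c s (y + v) := by
  obtain ⟨q, hq, e⟩ := supConv_attained (K := K) (c := c) hw hΩ hne s y
  refine ⟨(-(2 * c)) • dotCLM (y - q.2), fun v => ?_⟩
  have h1 := le_supConv (K := K) (c := c) hw hΩ hq s (y + v)
  have e1 : y + v - q.2 = (y - q.2) + v := by abel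
  rw [e1, sqn_add] at h1
  have h2 := mul_le_mul_of_nonneg_left (sqn_le v) hc
  rw [e, _root_.smul_apply, smul_eq_mul]
  linarith

lemma supConv_near {t : ℝ} {x : Vec3} {b : ℝ} {q : ℝ × Vec3} (hw : Continuous w)
    (hΩ : IsCompact Ω) (hb : ∀ q ∈ Ω, |w q| ≤ b) (hK : 0 ≤ K) (hc : 0 ≤ c) (htx : (t, x) ∈ Ω)
    (hq : q ∈ Ω) (e : supConv w Ω K c t x = w q - K * |t - q.1| - c * sqn (x - q.2)) :
    K * |t - q.1| ≤ 2 * b ∧ c * ‖x - q.2‖ ^ 2 ≤ 2 * b := by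
  have h1 := le_supConv (K := K) (c := c) hw hΩ htx t x
  simp only [sub_self, abs_zero, mul_zero] at h1
  rw [e] at h1
  have h0 : sqn (0 : Vec3) = 0 := by simp [sqn]
  rw [h0] at h1
  have h2 := (abs_le.1 (hb _ htx)).1
  have h3 := (abs_le.1 (hb _ hq)).2
  have h4 := mul_nonneg hK (abs_nonneg (t - q.1))
  have h5 := mul_nonneg hc (sqn_nonneg (x - q.2))
  have h6 := mul_le_mul_of_nonneg_left (norm_sq_le_sqn (x - q.2)) hc
  constructor <;> linarith

lemma le_supConv_self (hw : Continuous w) (hΩ : IsCompact Ω) {t : ℝ} {x : Vec3}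
    (htx : (t, x) ∈ Ω) : w (t, x) ≤ supConv w Ω K c t x := by
  have h1 := le_supConv (K := K) (c := c) hw hΩ htx t x
  have h0 : sqn (0 : Vec3) = 0 := by simp [sqn]
  simpa [h0] using h1

/-- Parabolic second order upper jets relative to a set. -/
def UpperJet (w : ℝ × Vec3 → ℝ) (Ω : Set (ℝ × Vec3)) (q : ℝ × Vec3) (a : ℝ)
    (p : Vec3 →L[ℝ] ℝ) (L : Vec3 →L[ℝ] Vec3 →L[ℝ] ℝ) : Prop :=
  ∀ η > 0, ∃ ρ > 0, ∀ s v, (s, v) ∈ Ω → |s - q.1| < ρ → ‖v - q.2‖ < ρ →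
    w (s, v) ≤ w q + a * (s - q.1) + p (v - q.2) + 1 / 2 * L (v - q.2) (v - q.2)
      + η * (|s - q.1| + ‖v - q.2‖ ^ 2)

lemma upperJet_of_supConv {t : ℝ} {x : Vec3} {q : ℝ × Vec3} {a : ℝ} {p : Vec3 →L[ℝ] ℝ}
    {L : Vec3 →L[ℝ] Vec3 →L[ℝ] ℝ} (hw : Continuous w) (hΩ : IsCompact Ω)
    (e : supConv w Ω K c t x = w q - K * |t - q.1| - c * sqn (x - q.2))
    (hF : ∀ η > 0, ∃ ρ > 0, ∀ s y, |s - t| < ρ → ‖y - x‖ < ρ →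
      |supConv w Ω K c s y - supConv w Ω K c t x - a * (s - t) - p (y - x)
        - 1 / 2 * L (y - x) (y - x)| ≤ η * (|s - t| + ‖y - x‖ ^ 2)) :
    UpperJet w Ω q a p L := by
  intro η hη
  obtain ⟨ρ, hρ, h⟩ := hF η hη
  refine ⟨ρ, hρ, fun s v hsv hs hv => ?_⟩
  have e1 : t + (s - q.1) - t = s - q.1 := by ring
  have e2 : x + (v - q.2) - x = v - q.2 := by abel
  have h1 := h (t + (s - q.1)) (x + (v - q.2)) (by rwa [e1]) (by rwa [e2])
  rw [e1, e2] at h1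
  have h2 := le_supConv (K := K) (c := c) hw hΩ hsv (t + (s - q.1)) (x + (v - q.2))
  have e3 : t + (s - q.1) - s = t - q.1 := by ring
  have e4 : x + (v - q.2) - v = x - q.2 := by abel
  simp only [e3, e4] at h2
  linarith [(abs_le.1 h1).2]

lemma abs_deriv_supConv_eq {t a : ℝ} {x : Vec3} {q : ℝ × Vec3} (hw : Continuous w)
    (hΩ : IsCompact Ω) (hq : q ∈ Ω) (hK : 0 ≤ K)
    (e : supConv w Ω K c t x = w q - K * |t - q.1| - c * sqn (x - q.2))
    (ha : HasDerivAt (fun s => supConv w Ω K c s x) a t) (hne : q.1 ≠ t) : |a| = K := by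
  have key : ∀ σ : ℝ, (∀ᶠ s in 𝓝 t, |s - q.1| = |t - q.1| - σ * (s - t)) → a = K * σ := by
    intro σ hσ
    have h1 : HasDerivAt (fun s => supConv w Ω K c s x - K * σ * (s - t)) (a - K * σ) t := by
      have : HasDerivAt (fun s => K * σ * (s - t)) (K * σ) t := by
        simpa using ((hasDerivAt_id t).sub_const t).const_mul (K * σ)
      exact ha.sub this
    have h2 : IsLocalMin (fun s => supConv w Ω K c s x - K * σ * (s - t)) t := by
      filter_upwards [hσ] with s hs
      have h3 := le_supConv (K := K) (c := c) hw hΩ hq s x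
      rw [hs] at h3
      rw [e]
      linarith
    linarith [h2.hasDerivAt_eq_zero h1]
  rcases lt_or_gt_of_ne hne with h | h
  · have := key (-1) (by
      filter_upwards [lt_mem_nhds h] with s hs
      rw [abs_of_pos (by linarith), abs_of_pos (by linarith)]; ring)
    rw [this, mul_neg_one, abs_neg, abs_of_nonneg hK]
  · have := key 1 (by
      filter_upwards [gt_mem_nhds h] with s hs
      rw [abs_of_neg (by linarith), abs_of_neg (by linarith)]; ring)
    rw [this, mul_one, abs_of_nonneg hK]

end SupConvolution

section SameTimeMaximumPrinciple

open MeasureTheory Metric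

lemma supConv_approx {w : ℝ × Vec3 → ℝ} {Ω : Set (ℝ × Vec3)} (hw : Continuous w)
    (hΩ : IsCompact Ω) {δ : ℝ} (hδ : 0 < δ) :
    ∃ K₁ > 0, ∃ c₁ > 0, ∀ K ≥ K₁, ∀ c ≥ c₁, ∀ t x q, (t, x) ∈ Ω → q ∈ Ω →
      supConv w Ω K c t x = w q - K * |t - q.1| - c * sqn (x - q.2) →
      |t - q.1| ≤ δ ∧ ‖x - q.2‖ ≤ δ ∧ supConv w Ω K c t x ≤ w (t, x) + δ := by
  obtain ⟨b, hb⟩ := hΩ.exists_bound_of_continuousOn hw.continuousOn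
  obtain ⟨δ₁, hδ₁, huc⟩ := Metric.uniformContinuousOn_iff.1
    (hΩ.uniformContinuousOn_of_continuous hw.continuousOn) δ hδ
  set d : ℝ := min δ (δ₁ / 2) with hd
  have hd0 : 0 < d := lt_min hδ (by positivity)
  set b' : ℝ := |b| + 1 with hb'
  have hb0 : 0 < b' := by positivity
  have hbb : ∀ q ∈ Ω, |w q| ≤ b' := fun q hq => (hb q hq).trans (by linarith [le_abs_self b])
  refine ⟨2 * b' / d, by positivity, 2 * b' / d ^ 2, by positivity,
    fun K hK c hc t x q htx hq e => ?_⟩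
  have hK0 : 0 < K := lt_of_lt_of_le (by positivity) hK
  have hc0 : 0 < c := lt_of_lt_of_le (by positivity) hc
  obtain ⟨h1, h2⟩ := supConv_near hw hΩ hbb hK0.le hc0.le htx hq e
  have h3 : |t - q.1| ≤ d := by
    rw [ge_iff_le, div_le_iff₀ hd0] at hK
    exact le_of_mul_le_mul_left (h1.trans hK) hK0
  have h4 : ‖x - q.2‖ ≤ d := by
    rw [ge_iff_le, div_le_iff₀ (by positivity)] at hc
    have := le_of_mul_le_mul_left (h2.trans hc) hc0
    exact le_of_sq_le_sq this hd0.le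
  refine ⟨h3.trans (min_le_left _ _), h4.trans (min_le_left _ _), ?_⟩
  have h5 : dist q (t, x) < δ₁ := by
    rw [Prod.dist_eq, max_lt_iff, dist_comm, dist_comm q.2, Real.dist_eq, dist_eq_norm]
    have : d ≤ δ₁ / 2 := min_le_right _ _
    constructor <;> linarith
  have h6 := (abs_lt.1 (huc q hq (t, x) htx h5)).2
  have h7 := mul_nonneg hK0.le (abs_nonneg (t - q.1))
  have h8 := mul_nonneg hc0.le (sqn_nonneg (x - q.2))
  rw [e]; linarith

lemma eq_zero_and_nonpos_of_quadratic_le {A B : ℝ}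
    (h : ∀ η > 0, ∃ ρ > 0, ∀ τ : ℝ, |τ| < ρ → τ * A + τ ^ 2 * B ≤ η * τ ^ 2) :
    A = 0 ∧ B ≤ 0 := by
  have hA : A = 0 := by
    obtain ⟨ρ, hρ, h1⟩ := h 1 one_pos
    have : (A • ContinuousLinearMap.id ℝ ℝ : ℝ →L[ℝ] ℝ) = 0 := by
      refine eq_zero_of_le_sq (C := 1 - B) (r := ρ / 2) (by positivity) fun v hv => ?_
      have := h1 v (by rw [← Real.norm_eq_abs]; linarith)
      simp only [_root_.smul_apply, ContinuousLinearMap.id_apply, smul_eq_mul, Real.norm_eq_abs,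
        sq_abs]
      linarith
    simpa using congrArg (fun f : ℝ →L[ℝ] ℝ => f 1) this
  refine ⟨hA, le_of_forall_pos_le_add fun η hη => ?_⟩
  obtain ⟨ρ, hρ, h1⟩ := h η hη
  have := h1 (ρ / 2) (by rw [abs_of_pos (by positivity)]; linarith)
  rw [hA, mul_zero, zero_add, mul_comm] at this
  rw [zero_add]
  exact le_of_mul_le_mul_right this (by positivity)

/-- Good points: differentiability in time, and a full parabolic expansion as soon as the
function is touched from above by a paraboloid. -/
def HasExpansionIfTouched (F : ℝ → Vec3 → ℝ) (C r t : ℝ) (x : Vec3) : Prop :=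
  DifferentiableAt ℝ (fun s => F s x) t ∧
    ((∃ p : Vec3 →L[ℝ] ℝ, ∀ v, ‖v‖ ≤ r → F t (x + v) ≤ F t x + p v + C * ‖v‖ ^ 2) →
      ∃ (p : Vec3 →L[ℝ] ℝ) (L : Vec3 →L[ℝ] Vec3 →L[ℝ] ℝ), ∀ η > 0, ∃ ρ > 0, ∀ s w,
        |s - t| < ρ → ‖w - x‖ < ρ →
        |F s w - F t x - deriv (fun s => F s x) t * (s - t) - p (w - x)
          - 1 / 2 * L (w - x) (w - x)| ≤ η * (|s - t| + ‖w - x‖ ^ 2))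

lemma ae_ae_hasExpansionIfTouched {F : ℝ → Vec3 → ℝ} {C K r : ℝ} (hC : 0 ≤ C) (hK : 0 ≤ K)
    (hr : 0 < r) (hF : Continuous fun q : ℝ × Vec3 => F q.1 q.2)
    (hlip : ∀ s s' y, |F s y - F s' y| ≤ K * |s - s'|)
    (hlow : ∀ s y, ∃ q : Vec3 →L[ℝ] ℝ, ∀ v, F s y + q v - C * ‖v‖ ^ 2 ≤ F s (y + v)) :
    ∀ᵐ t : ℝ, ∀ᵐ x : Vec3, HasExpansionIfTouched F C r t x := by
  have hd : ∀ᵐ t : ℝ, ∀ᵐ x : Vec3, DifferentiableAt ℝ (fun s => F s x) t := by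
    have hc : Continuous (Function.uncurry fun (x : Vec3) (s : ℝ) => F s x) :=
      hF.comp continuous_swap
    have hm : MeasurableSet {q : Vec3 × ℝ | DifferentiableAt ℝ (fun s => F s q.1) q.2} :=
      measurableSet_of_differentiableAt_with_param ℝ hc
    refine (Measure.ae_ae_comm
      (p := fun (x : Vec3) (t : ℝ) => DifferentiableAt ℝ (fun s => F s x) t) hm).1 ?_
    refine Eventually.of_forall fun x => ?_
    have : LipschitzWith K.toNNReal fun s => F s x :=
      LipschitzWith.of_dist_le_mul fun s s' => by
        rw [Real.coe_toNNReal _ hK]; exact hlip s s' x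
    exact this.ae_differentiableAt_real
  filter_upwards [hd] with t ht
  filter_upwards [ht, ae_parabolic_expansion volume hC hK hr hlip hlow ht] with x h1 h2
  exact ⟨h1, h2⟩

/-- The maximized function of the doubled space variables. -/
def doubled (w₁ w₂ : ℝ × Vec3 → ℝ) (κ t : ℝ) (x y : Vec3) : ℝ :=
  w₁ (t, x) + w₂ (t, y) - sqn (x - y) / (2 * κ)

lemma exists_margin {w₁ w₂ : ℝ × Vec3 → ℝ} {T κ M : ℝ} {B : Set Vec3} (hB : IsCompact B)
    (hw₁ : Continuous w₁) (hw₂ : Continuous w₂)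
    (hM : ∀ t ∈ Icc 0 T, ∀ x ∈ B, ∀ y ∈ B, doubled w₁ w₂ κ t x y ≤ M)
    (hmax : ∀ t ∈ Icc 0 T, ∀ x ∈ B, ∀ y ∈ B, doubled w₁ w₂ κ t x y = M →
      x ∈ interior B ∧ y ∈ interior B) :
    ∃ r > 0, ∀ t ∈ Icc 0 T, ∀ x ∈ B, ∀ y ∈ B, M - r ≤ doubled w₁ w₂ κ t x y →
      closedBall x r ⊆ B ∧ closedBall y r ⊆ B := by
  set Z : Set (ℝ × Vec3 × Vec3) := Icc 0 T ×ˢ B ×ˢ B with hZ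
  have hZc : IsCompact Z := isCompact_Icc.prod (hB.prod hB)
  have hBne : (interior B)ᶜ.Nonempty := by
    refine nonempty_compl.2 fun h => ?_
    have h2 : B = univ := univ_subset_iff.1 (h ▸ interior_subset)
    exact noncompact_univ Vec3 (h2 ▸ hB)
  set d : ℝ × Vec3 × Vec3 → ℝ := fun z => max (M - doubled w₁ w₂ κ z.1 z.2.1 z.2.2)
    (min (infDist z.2.1 (interior B)ᶜ) (infDist z.2.2 (interior B)ᶜ)) with hd
  have hdc : Continuous d := by
    have h1 := continuous_sqn
    have h2 : Continuous fun z : ℝ × Vec3 × Vec3 => doubled w₁ w₂ κ z.1 z.2.1 z.2.2 := by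
      unfold doubled; fun_prop
    have h3 : Continuous fun z : ℝ × Vec3 × Vec3 => infDist z.2.1 (interior B)ᶜ :=
      (continuous_infDist_pt _).comp (by fun_prop)
    have h4 : Continuous fun z : ℝ × Vec3 × Vec3 => infDist z.2.2 (interior B)ᶜ :=
      (continuous_infDist_pt _).comp (by fun_prop)
    fun_prop
  have hpos : ∀ z ∈ Z, 0 < d z := by
    rintro ⟨t, x, y⟩ ⟨ht, hx, hy⟩
    rcases (hM t ht x hx y hy).lt_or_eq with h | h
    · exact lt_max_of_lt_left (by simpa using h)
    · obtain ⟨h1, h2⟩ := hmax t ht x hx y hy h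
      have hcl : IsClosed (interior B)ᶜ := isOpen_interior.isClosed_compl
      exact lt_max_of_lt_right (lt_min ((hcl.notMem_iff_infDist_pos hBne).1 (by simpa using h1))
        ((hcl.notMem_iff_infDist_pos hBne).1 (by simpa using h2)))
  rcases Z.eq_empty_or_nonempty with hZe | hZne
  · refine ⟨1, one_pos, fun t ht x hx y hy => ?_⟩
    have : ((t, x, y) : ℝ × Vec3 × Vec3) ∈ Z := ⟨ht, hx, hy⟩
    rw [hZe] at this
    exact this.elim
  obtain ⟨z₀, hz₀, hmin⟩ := hZc.exists_isMinOn hZne hdc.continuousOn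
  have hm := hpos z₀ hz₀
  refine ⟨d z₀ / 2, by positivity, fun t ht x hx y hy h => ?_⟩
  have h1 : d z₀ ≤ d (t, x, y) := hmin (show (t, x, y) ∈ Z from ⟨ht, hx, hy⟩)
  have h2 : d z₀ ≤ min (infDist x (interior B)ᶜ) (infDist y (interior B)ᶜ) := by
    rcases le_max_iff.1 h1 with h3 | h3
    · simp only at h3; linarith
    · exact h3
  have key : ∀ x : Vec3, d z₀ ≤ infDist x (interior B)ᶜ → closedBall x (d z₀ / 2) ⊆ B := by
    intro x hx v hv
    by_contra hvB
    have : infDist x (interior B)ᶜ ≤ dist x v :=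
      infDist_le_dist_of_mem fun h => hvB (interior_subset h)
    rw [mem_closedBall'] at hv
    linarith
  exact ⟨key x (h2.trans (min_le_left _ _)), key y (h2.trans (min_le_right _ _))⟩

lemma dotCLM_smul (c : ℝ) (a v : Vec3) : dotCLM (c • a) v = c * dotCLM a v := by
  simp only [dotCLM_apply, Pi.smul_apply, smul_eq_mul, Finset.mul_sum, mul_assoc]

/-- First and second order conditions at a maximum of a penalized sum. -/
lemma jets_of_isMax_penalized {f g : Vec3 → ℝ} {x y : Vec3} {k r : ℝ} (hr : 0 < r)
    {p : Vec3 × Vec3 →L[ℝ] ℝ} {p₁ p₂ : Vec3 →L[ℝ] ℝ} {L₁ L₂ : Vec3 →L[ℝ] Vec3 →L[ℝ] ℝ}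
    (hmax : ∀ v v', ‖v‖ ≤ r → ‖v'‖ ≤ r →
      f (x + v) + g (y + v') - k * sqn (x - y + (v - v')) - p (v, v')
        ≤ f x + g y - k * sqn (x - y))
    (hf : ∀ η > 0, ∃ ρ > 0, ∀ v, ‖v‖ < ρ →
      f x + p₁ v + 1 / 2 * L₁ v v - η * ‖v‖ ^ 2 ≤ f (x + v))
    (hg : ∀ η > 0, ∃ ρ > 0, ∀ v, ‖v‖ < ρ →
      g y + p₂ v + 1 / 2 * L₂ v v - η * ‖v‖ ^ 2 ≤ g (y + v)) (v v' : Vec3) :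
    p₁ v + p₂ v' = 2 * k * dotCLM (x - y) (v - v') + p (v, v') ∧
      L₁ v v + L₂ v' v' ≤ 2 * k * sqn (v - v') := by
  have key := eq_zero_and_nonpos_of_quadratic_le
    (A := p₁ v + p₂ v' - 2 * k * dotCLM (x - y) (v - v') - p (v, v'))
    (B := 1 / 2 * L₁ v v + 1 / 2 * L₂ v' v' - k * sqn (v - v')) ?_
  · constructor <;> linarith [key.1, key.2]
  intro η hη
  set m : ℝ := ‖v‖ ^ 2 + ‖v'‖ ^ 2 + 1 with hm
  have hm0 : 0 < m := by positivity
  obtain ⟨ρ₁, hρ₁, h1⟩ := hf (η / m) (by positivity)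
  obtain ⟨ρ₂, hρ₂, h2⟩ := hg (η / m) (by positivity)
  set b : ℝ := ‖v‖ + ‖v'‖ + 1 with hb
  have hb0 : 0 < b := by positivity
  refine ⟨min r (min ρ₁ ρ₂) / b, by positivity, fun τ hτ => ?_⟩
  rw [lt_div_iff₀ hb0] at hτ
  have n1 : ‖τ • v‖ < min r (min ρ₁ ρ₂) := by
    refine lt_of_le_of_lt ?_ hτ
    rw [norm_smul, Real.norm_eq_abs]
    exact mul_le_mul_of_nonneg_left (by linarith [norm_nonneg v']) (abs_nonneg _)
  have n2 : ‖τ • v'‖ < min r (min ρ₁ ρ₂) := by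
    refine lt_of_le_of_lt ?_ hτ
    rw [norm_smul, Real.norm_eq_abs]
    exact mul_le_mul_of_nonneg_left (by linarith [norm_nonneg v]) (abs_nonneg _)
  have h3 := hmax (τ • v) (τ • v') (n1.le.trans (min_le_left _ _)) (n2.le.trans (min_le_left _ _))
  have h4 := h1 (τ • v) (n1.trans_le ((min_le_right _ _).trans (min_le_left _ _)))
  have h5 := h2 (τ • v') (n2.trans_le ((min_le_right _ _).trans (min_le_right _ _)))
  have e1 : ((τ • v, τ • v') : Vec3 × Vec3) = τ • (v, v') := rfl
  rw [e1, map_smul, ← smul_sub, sqn_add, sqn_smul, map_smul] at h3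
  simp only [map_smul, _root_.smul_apply, smul_eq_mul, norm_smul, Real.norm_eq_abs, mul_pow,
    sq_abs] at h3 h4 h5
  have h6 : η / m * (τ ^ 2 * ‖v‖ ^ 2) + η / m * (τ ^ 2 * ‖v'‖ ^ 2) ≤ η * τ ^ 2 := by
    have : η / m * (τ ^ 2 * ‖v‖ ^ 2) + η / m * (τ ^ 2 * ‖v'‖ ^ 2) + η / m * τ ^ 2 = η * τ ^ 2 := by
      rw [hm]; field_simp
    have : 0 ≤ η / m * τ ^ 2 := by positivity
    linarith
  linarith

/-- The parabolic theorem on sums at a common time: the upper jets of both functions are attached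
to the same time whenever their time slopes are bounded by `K₀`. -/
lemma exists_upperJets {w₁ w₂ : ℝ × Vec3 → ℝ} {T κ M : ℝ} {B : Set Vec3} (hB : IsCompact B)
    (hw₁ : Continuous w₁) (hw₂ : Continuous w₂) (hκ : 0 < κ)
    (hM : ∀ t ∈ Icc 0 T, ∀ x ∈ B, ∀ y ∈ B, doubled w₁ w₂ κ t x y ≤ M)
    (hatt : ∃ t ∈ Icc 0 T, ∃ x ∈ B, ∃ y ∈ B, doubled w₁ w₂ κ t x y = M)
    (hmax : ∀ t ∈ Icc 0 T, ∀ x ∈ B, ∀ y ∈ B, doubled w₁ w₂ κ t x y = M →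
      t < T ∧ x ∈ interior B ∧ y ∈ interior B) {ϑ : ℝ} (hϑ : 0 < ϑ) (K₀ : ℝ) :
    ∃ t ∈ Icc 0 T, ∃ x ∈ B, ∃ y ∈ B, ∃ q₁ ∈ Ico 0 T ×ˢ interior B,
      ∃ q₂ ∈ Ico 0 T ×ˢ interior B, ∃ (a₁ a₂ : ℝ) (p₁ p₂ : Vec3 →L[ℝ] ℝ)
        (L₁ L₂ : Vec3 →L[ℝ] Vec3 →L[ℝ] ℝ),
      M - ϑ ≤ doubled w₁ w₂ κ t x y ∧ (|t - q₁.1| ≤ ϑ ∧ ‖x - q₁.2‖ ≤ ϑ) ∧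
      (|t - q₂.1| ≤ ϑ ∧ ‖y - q₂.2‖ ≤ ϑ) ∧
      UpperJet w₁ (Icc 0 T ×ˢ B) q₁ a₁ p₁ L₁ ∧ UpperJet w₂ (Icc 0 T ×ˢ B) q₂ a₂ p₂ L₂ ∧
      a₁ + a₂ ≤ ϑ ∧ ‖p₁ - dotCLM ((1 / κ) • (x - y))‖ ≤ ϑ ∧
      ‖p₂ + dotCLM ((1 / κ) • (x - y))‖ ≤ ϑ ∧
      (∀ v v', L₁ v v + L₂ v' v' ≤ 1 / κ * sqn (v - v')) ∧
      (|a₁| < K₀ → q₁.1 = t) ∧ (|a₂| < K₀ → q₂.1 = t) := by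
  obtain ⟨r₀, hr₀, hmar⟩ := exists_margin hB hw₁ hw₂ hM
    fun t ht x hx y hy h => (hmax t ht x hx y hy h).2
  obtain ⟨th, hth, xh, hxh, yh, hyh, hth_eq⟩ := hatt
  have hthT : th < T := (hmax th hth xh hxh yh hyh hth_eq).1
  set Ω : Set (ℝ × Vec3) := Icc 0 T ×ˢ B with hΩdef
  have hΩ : IsCompact Ω := isCompact_Icc.prod hB
  have hΩne : Ω.Nonempty := ⟨(th, xh), hth, hxh⟩
  set k : ℝ := 1 / (2 * κ) with hk
  have hk0 : 0 < k := by positivity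
  have hk2 : 2 * k = 1 / κ := by rw [hk]; field_simp
  have hdbl : ∀ t x y, doubled w₁ w₂ κ t x y = w₁ (t, x) + w₂ (t, y) - k * sqn (x - y) := by
    intro t x y; rw [doubled, hk]; ring
  set τ : ℝ := min ϑ r₀ with hτ
  have hτ0 : 0 < τ := lt_min hϑ hr₀
  obtain ⟨h, hh, hT2, hhM⟩ : ∃ h > 0, th + 2 * h ≤ T ∧ ∀ s ∈ Icc th (th + h),
      M - τ / 4 ≤ doubled w₁ w₂ κ s xh yh := by
    have hc : Continuous fun s => doubled w₁ w₂ κ s xh yh := by unfold doubled; fun_prop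
    have hev : ∀ᶠ s in 𝓝 th, M - τ / 4 < doubled w₁ w₂ κ s xh yh :=
      hc.continuousAt.eventually (lt_mem_nhds (by
        change M - τ / 4 < doubled w₁ w₂ κ th xh yh
        linarith))
    obtain ⟨e, he, h1⟩ := Metric.eventually_nhds_iff.1 hev
    refine ⟨min (e / 2) ((T - th) / 2), lt_min (by positivity) (by linarith), ?_, ?_⟩
    · linarith [min_le_right (e / 2) ((T - th) / 2)]
    · intro s hs
      refine (h1 ?_).le
      rw [Real.dist_eq, abs_of_nonneg (by linarith [hs.1])]
      linarith [hs.2, min_le_left (e / 2) ((T - th) / 2)]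
  set Z : Set (Vec3 × Vec3) := B ×ˢ B with hZ
  have hZc : IsCompact Z := hB.prod hB
  have hzh : (xh, yh) ∈ Z := ⟨hxh, hyh⟩
  obtain ⟨b, hb⟩ := hZc.isBounded.exists_norm_le
  set Rz : ℝ := |b| + 1 with hRz
  have hRz0 : 0 < Rz := by positivity
  have hbR : ∀ z ∈ Z, ‖z‖ ≤ Rz := fun z hz => (hb z hz).trans (by linarith [le_abs_self b])
  set ρ₀ : ℝ := min ϑ (min (τ / (16 * Rz)) (ϑ * h / (8 * Rz))) with hρ₀
  have hρ0 : 0 < ρ₀ := by positivity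
  have hρ1 : ρ₀ ≤ ϑ := min_le_left _ _
  have hρ2 : ρ₀ * Rz ≤ τ / 16 := by
    have : ρ₀ ≤ τ / (16 * Rz) := (min_le_right _ _).trans (min_le_left _ _)
    rw [le_div_iff₀ (by positivity)] at this
    linarith
  have hρ3 : ρ₀ * Rz ≤ ϑ * h / 8 := by
    have : ρ₀ ≤ ϑ * h / (8 * Rz) := (min_le_right _ _).trans (min_le_right _ _)
    rw [le_div_iff₀ (by positivity)] at this
    linarith
  set δ : ℝ := min (min ϑ (h / 2)) (min (r₀ / 2) (min (τ / 16) (ϑ * h / 16))) with hδ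
  have hδ0 : 0 < δ := by positivity
  have hδ1 : δ ≤ ϑ := (min_le_left _ _).trans (min_le_left _ _)
  have hδ2 : δ ≤ h / 2 := (min_le_left _ _).trans (min_le_right _ _)
  have hδ3 : δ ≤ r₀ / 2 := (min_le_right _ _).trans (min_le_left _ _)
  have hδ4 : δ ≤ τ / 16 := (min_le_right _ _).trans ((min_le_right _ _).trans (min_le_left _ _))
  have hδ5 : δ ≤ ϑ * h / 16 :=
    (min_le_right _ _).trans ((min_le_right _ _).trans (min_le_right _ _))
  obtain ⟨K₁, hK₁, c₁, hc₁, ap₁⟩ := supConv_approx hw₁ hΩ hδ0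
  obtain ⟨K₂, hK₂, c₂, hc₂, ap₂⟩ := supConv_approx hw₂ hΩ hδ0
  set K : ℝ := max K₀ (max K₁ K₂) with hKdef
  have hKK₀ : K₀ ≤ K := le_max_left _ _
  have hKK₁ : K₁ ≤ K := (le_max_left _ _).trans (le_max_right _ _)
  have hKK₂ : K₂ ≤ K := (le_max_right _ _).trans (le_max_right _ _)
  have hK0 : 0 ≤ K := hK₁.le.trans hKK₁
  set c : ℝ := max c₁ c₂ with hcdef
  have hcc₁ : c₁ ≤ c := le_max_left _ _
  have hcc₂ : c₂ ≤ c := le_max_right _ _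
  have hc0 : 0 ≤ c := hc₁.le.trans hcc₁
  have ap₁' := ap₁ K hKK₁ c hcc₁
  have ap₂' := ap₂ K hKK₂ c hcc₂
  set F₁ := supConv w₁ Ω K c with hF₁
  set F₂ := supConv w₂ Ω K c with hF₂
  have up₁ : ∀ t x, (t, x) ∈ Ω → F₁ t x ≤ w₁ (t, x) + δ := fun t x htx => by
    obtain ⟨q, hq, e⟩ := supConv_attained (K := K) (c := c) hw₁ hΩ hΩne t x
    exact (ap₁' t x q htx hq e).2.2
  have up₂ : ∀ t x, (t, x) ∈ Ω → F₂ t x ≤ w₂ (t, x) + δ := fun t x htx => by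
    obtain ⟨q, hq, e⟩ := supConv_attained (K := K) (c := c) hw₂ hΩ hΩne t x
    exact (ap₂' t x q htx hq e).2.2
  have lip₁ : ∀ s s' y, |F₁ s y - F₁ s' y| ≤ K * |s - s'| :=
    fun s s' y => supConv_lipschitz hw₁ hΩ hΩne hK0 s s' y
  have lip₂ : ∀ s s' y, |F₂ s y - F₂ s' y| ≤ K * |s - s'| :=
    fun s s' y => supConv_lipschitz hw₂ hΩ hΩne hK0 s s' y
  have cont₁ : Continuous fun q : ℝ × Vec3 => F₁ q.1 q.2 := continuous_supConv hw₁ hΩ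
  have cont₂ : Continuous fun q : ℝ × Vec3 => F₂ q.1 q.2 := continuous_supConv hw₂ hΩ
  set C : ℝ := 3 * c + 3 * k with hC
  have hC0 : 0 ≤ C := by positivity
  have low₁ : ∀ s y, ∃ q : Vec3 →L[ℝ] ℝ, ∀ v, F₁ s y + q v - C * ‖v‖ ^ 2 ≤ F₁ s (y + v) := by
    intro s y
    obtain ⟨q, hq⟩ := supConv_lower (K := K) hw₁ hΩ hΩne hc0 s y
    refine ⟨q, fun v => (hq v).trans' ?_⟩
    have : 0 ≤ 3 * k * ‖v‖ ^ 2 := by positivity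
    rw [hC, add_mul]; linarith
  have low₂ : ∀ s y, ∃ q : Vec3 →L[ℝ] ℝ, ∀ v, F₂ s y + q v - C * ‖v‖ ^ 2 ≤ F₂ s (y + v) := by
    intro s y
    obtain ⟨q, hq⟩ := supConv_lower (K := K) hw₂ hΩ hΩne hc0 s y
    refine ⟨q, fun v => (hq v).trans' ?_⟩
    have : 0 ≤ 3 * k * ‖v‖ ^ 2 := by positivity
    rw [hC, add_mul]; linarith
  have good₁ := ae_ae_hasExpansionIfTouched hC0 hK0 hr₀ cont₁ lip₁ low₁
  have good₂ := ae_ae_hasExpansionIfTouched hC0 hK0 hr₀ cont₂ lip₂ low₂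
  set u : ℝ → Vec3 × Vec3 → ℝ := fun t z => F₁ t z.1 + F₂ t z.2 - k * sqn (z.1 - z.2) with hu
  set N : ℝ → Set (Vec3 × Vec3) := fun t =>
    {z | ¬ (HasExpansionIfTouched F₁ C r₀ t z.1 ∧ HasExpansionIfTouched F₂ C r₀ t z.2)} with hN
  have hN0 : ∀ᵐ t : ℝ, (volume : Measure (Vec3 × Vec3)) (N t) = 0 := by
    filter_upwards [good₁, good₂] with t h1 h2
    have g1 : ∀ᵐ z : Vec3 × Vec3, HasExpansionIfTouched F₁ C r₀ t z.1 :=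
      (Measure.quasiMeasurePreserving_fst (μ := (volume : Measure Vec3))
        (ν := (volume : Measure Vec3))).ae h1
    have g2 : ∀ᵐ z : Vec3 × Vec3, HasExpansionIfTouched F₂ C r₀ t z.2 :=
      (Measure.quasiMeasurePreserving_snd (μ := (volume : Measure Vec3))
        (ν := (volume : Measure Vec3))).ae h2
    exact ae_iff.1 (g1.and g2)
  have hucont : Continuous fun q : ℝ × (Vec3 × Vec3) => u q.1 q.2 := by
    have h1 : Continuous fun q : ℝ × (Vec3 × Vec3) => F₁ q.1 q.2.1 :=
      cont₁.comp (f := fun q : ℝ × (Vec3 × Vec3) => (q.1, q.2.1)) (by fun_prop)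
    have h2 : Continuous fun q : ℝ × (Vec3 × Vec3) => F₂ q.1 q.2.2 :=
      cont₂.comp (f := fun q : ℝ × (Vec3 × Vec3) => (q.1, q.2.2)) (by fun_prop)
    have := continuous_sqn
    change Continuous fun q : ℝ × (Vec3 × Vec3) =>
      F₁ q.1 q.2.1 + F₂ q.1 q.2.2 - k * sqn (q.2.1 - q.2.2)
    fun_prop
  have hulip : ∀ s s' z, |u s z - u s' z| ≤ (2 * K) * |s - s'| := by
    intro s s' z
    have h1 := abs_le.1 (lip₁ s s' z.1)
    have h2 := abs_le.1 (lip₂ s s' z.2)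
    simp only [hu]
    exact abs_le.2 ⟨by linarith [h1.1, h2.1], by linarith [h1.2, h2.2]⟩
  have hulow : ∀ s z, ∃ q : Vec3 × Vec3 →L[ℝ] ℝ, ∀ v,
      u s z + q v - (2 * C + 12 * k) * ‖v‖ ^ 2 ≤ u s (z + v) := by
    intro s z
    obtain ⟨q₁, hq₁⟩ := low₁ s z.1
    obtain ⟨q₂, hq₂⟩ := low₂ s z.2
    refine ⟨q₁.comp (ContinuousLinearMap.fst ℝ Vec3 Vec3)
      + q₂.comp (ContinuousLinearMap.snd ℝ Vec3 Vec3)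
      - (2 * k) • (dotCLM (z.1 - z.2)).comp
        (ContinuousLinearMap.fst ℝ Vec3 Vec3 - ContinuousLinearMap.snd ℝ Vec3 Vec3),
      fun v => ?_⟩
    have h1 := hq₁ v.1
    have h2 := hq₂ v.2
    have e1 : (z + v).1 - (z + v).2 = (z.1 - z.2) + (v.1 - v.2) := by
      simp only [Prod.fst_add, Prod.snd_add]; abel
    have n1 : ‖v.1‖ ^ 2 ≤ ‖v‖ ^ 2 := by gcongr; exact norm_fst_le v
    have n2 : ‖v.2‖ ^ 2 ≤ ‖v‖ ^ 2 := by gcongr; exact norm_snd_le v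
    have n3 : ‖v.1 - v.2‖ ^ 2 ≤ (2 * ‖v‖) ^ 2 := by
      gcongr
      exact (norm_sub_le _ _).trans (by linarith [norm_fst_le v, norm_snd_le v])
    have n4 : k * sqn (v.1 - v.2) ≤ k * (3 * (2 * ‖v‖) ^ 2) := by
      refine mul_le_mul_of_nonneg_left ((sqn_le _).trans ?_) hk0.le
      linarith
    have m1 := mul_le_mul_of_nonneg_left n1 hC0
    have m2 := mul_le_mul_of_nonneg_left n2 hC0
    simp only [hu]
    rw [e1, sqn_add]
    simp only [Prod.fst_add, Prod.snd_add, _root_.sub_apply, _root_.add_apply,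
      ContinuousLinearMap.comp_apply, ContinuousLinearMap.coe_fst', ContinuousLinearMap.coe_snd',
      _root_.smul_apply, smul_eq_mul]
    linarith
  have huM : ∀ s ∈ Icc 0 T, ∀ z ∈ Z, u s z ≤ doubled w₁ w₂ κ s z.1 z.2 + 2 * δ := by
    intro s hs z hz
    have h1 := up₁ s z.1 ⟨hs, hz.1⟩
    have h2 := up₂ s z.2 ⟨hs, hz.2⟩
    simp only [hu, hdbl]
    linarith
  have huge : ∀ s ∈ Icc 0 T, ∀ z ∈ Z, doubled w₁ w₂ κ s z.1 z.2 ≤ u s z := by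
    intro s hs z hz
    have h1 := le_supConv_self (K := K) (c := c) hw₁ hΩ (t := s) (x := z.1) ⟨hs, hz.1⟩
    have h2 := le_supConv_self (K := K) (c := c) hw₂ hΩ (t := s) (x := z.2) ⟨hs, hz.2⟩
    simp only [hu, hdbl]
    linarith
  have hI : ∀ s ∈ Icc th (th + h), s ∈ Icc 0 T := fun s hs =>
    ⟨hth.1.trans hs.1, by linarith [hs.2]⟩
  have hpz : ∀ p : Vec3 × Vec3 →L[ℝ] ℝ, ‖p‖ < ρ₀ → ∀ z ∈ Z, |p z| ≤ ρ₀ * Rz :=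
    fun p hp z hz => (p.le_opNorm z).trans (by gcongr; exact hbR z hz)
  have hnear : ∀ p : Vec3 × Vec3 →L[ℝ] ℝ, ‖p‖ < ρ₀ → ∀ s ∈ Icc th (th + h), ∀ z ∈ Z,
      (∀ z' ∈ Z, u s z' - p z' ≤ u s z - p z) → M - τ ≤ doubled w₁ w₂ κ s z.1 z.2 := by
    intro p hp s hs z hz hzm
    have h1 := hzm _ hzh
    have h2 := huge s (hI s hs) _ hzh
    have h3 := huM s (hI s hs) z hz
    have h4 := (abs_le.1 (hpz p hp z hz)).1
    have h5 := (abs_le.1 (hpz p hp _ hzh)).2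
    have h6 := hhM s hs
    simp only at h2
    linarith
  have : (volume : Measure (Vec3 × Vec3)).IsAddHaarMeasure :=
    Measure.prod.instIsAddHaarMeasure _ _
  obtain ⟨t, htI, p, hp, z, hz, hzN, hzmax, hβ⟩ := exists_perturbed_max_off_null
    (μ := (volume : Measure (Vec3 × Vec3))) (u := u) (C := 2 * C + 12 * k) (K := 2 * K) (r := r₀)
    (ρ₀ := ρ₀) (η := ϑ) (t₀ := th) (t₁ := th + h) (Z := Z)
    (Z₀ := {z | z ∈ Z ∧ closedBall z.1 r₀ ⊆ B ∧ closedBall z.2 r₀ ⊆ B}) (N := N)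
    (by positivity) hr₀ hρ0 (by linarith) hucont hulip hulow hZc ⟨_, hzh⟩
    (by
      intro z hz v hv
      have m1 : z.1 + v.1 ∈ closedBall z.1 r₀ := by
        rw [mem_closedBall, dist_eq_norm, add_sub_cancel_left]
        exact (norm_fst_le v).trans hv
      have m2 : z.2 + v.2 ∈ closedBall z.2 r₀ := by
        rw [mem_closedBall, dist_eq_norm, add_sub_cancel_left]
        exact (norm_snd_le v).trans hv
      exact ⟨hz.2.1 m1, hz.2.2 m2⟩)
    (by
      intro p hp s hs z hz hzm
      have h1 := hnear p hp s hs z hz hzm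
      exact ⟨hz, hmar s (hI s hs) z.1 hz.1 z.2 hz.2
        (by linarith [min_le_right ϑ r₀])⟩)
    (by
      intro p hp z₁ hz₁
      refine ⟨(xh, yh), hzh, ?_⟩
      have i1 : th + h ∈ Icc 0 T := ⟨by linarith [hth.1], by linarith⟩
      have h1 := huM _ i1 z₁ hz₁
      have h2 := hM _ i1 z₁.1 hz₁.1 z₁.2 hz₁.2
      have h3 := huge th hth _ hzh
      have h4 := (abs_le.1 (hpz p hp z₁ hz₁)).1
      have h5 := (abs_le.1 (hpz p hp _ hzh)).2
      have h6 : 0 < ϑ * h := by positivity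
      simp only at h3
      rw [hth_eq] at h3
      rw [add_sub_cancel_left]
      linarith)
    hN0
  obtain ⟨x, y⟩ := z
  obtain ⟨hzZ, hbx, hby⟩ := hz
  simp only at hbx hby
  have htI' : t ∈ Icc th (th + h) := ⟨htI.1.le, htI.2.le⟩
  have ht0T := hI t htI'
  have hxB : x ∈ B := hzZ.1
  have hyB : y ∈ B := hzZ.2
  have hnr := hnear p hp t htI' (x, y) hzZ hzmax
  simp only at hnr
  obtain ⟨⟨hd₁, hg₁⟩, hd₂, hg₂⟩ := not_not.1 hzN
  simp only at hd₁ hg₁ hd₂ hg₂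
  have hmx : ∀ v v', ‖v‖ ≤ r₀ → ‖v'‖ ≤ r₀ →
      F₁ t (x + v) + F₂ t (y + v') - k * sqn (x - y + (v - v')) - p (v, v')
        ≤ F₁ t x + F₂ t y - k * sqn (x - y) := by
    intro v v' hv hv'
    have hm : (x + v, y + v') ∈ Z := by
      refine ⟨hbx ?_, hby ?_⟩ <;>
        rwa [mem_closedBall, dist_eq_norm, add_sub_cancel_left]
    have h1 := hzmax _ hm
    have e1 : ((x + v, y + v') : Vec3 × Vec3) = (x, y) + (v, v') := rfl
    have e2 : x + v - (y + v') = x - y + (v - v') := by abel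
    simp only [hu] at h1
    rw [e2, e1, map_add] at h1
    linarith
  obtain ⟨p₁, L₁, ex₁⟩ := hg₁ ⟨dotCLM ((2 * k) • (x - y))
      + p.comp (ContinuousLinearMap.inl ℝ Vec3 Vec3), fun v hv => by
    have h1 := hmx v 0 hv (by rw [norm_zero]; exact hr₀.le)
    rw [sub_zero, add_zero, sqn_add] at h1
    have h2 := mul_le_mul_of_nonneg_left (sqn_le v) hk0.le
    have h3 : 0 ≤ 3 * c * ‖v‖ ^ 2 := by positivity
    rw [_root_.add_apply, dotCLM_smul, ContinuousLinearMap.comp_apply,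
      ContinuousLinearMap.inl_apply, hC]
    linarith⟩
  obtain ⟨p₂, L₂, ex₂⟩ := hg₂ ⟨-dotCLM ((2 * k) • (x - y))
      + p.comp (ContinuousLinearMap.inr ℝ Vec3 Vec3), fun v hv => by
    have h1 := hmx 0 v (by rw [norm_zero]; exact hr₀.le) hv
    rw [zero_sub, add_zero, sqn_add, sqn_neg, map_neg] at h1
    have h2 := mul_le_mul_of_nonneg_left (sqn_le v) hk0.le
    have h3 : 0 ≤ 3 * c * ‖v‖ ^ 2 := by positivity
    rw [_root_.add_apply, _root_.neg_apply, dotCLM_smul, ContinuousLinearMap.comp_apply,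
      ContinuousLinearMap.inr_apply, hC]
    linarith⟩
  have loc : ∀ {F : ℝ → Vec3 → ℝ} {x : Vec3} {a : ℝ} {p : Vec3 →L[ℝ] ℝ}
      {L : Vec3 →L[ℝ] Vec3 →L[ℝ] ℝ},
      (∀ η > 0, ∃ ρ > 0, ∀ s w, |s - t| < ρ → ‖w - x‖ < ρ →
        |F s w - F t x - a * (s - t) - p (w - x) - 1 / 2 * L (w - x) (w - x)|
          ≤ η * (|s - t| + ‖w - x‖ ^ 2)) →
      ∀ η > 0, ∃ ρ > 0, ∀ v, ‖v‖ < ρ →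
        F t x + p v + 1 / 2 * L v v - η * ‖v‖ ^ 2 ≤ F t (x + v) := by
    intro F x a p L hF η hη
    obtain ⟨ρ, hρ, h1⟩ := hF η hη
    refine ⟨ρ, hρ, fun v hv => ?_⟩
    have h2 := h1 t (x + v) (by rwa [sub_self, abs_zero]) (by rwa [add_sub_cancel_left])
    rw [add_sub_cancel_left, sub_self, mul_zero, abs_zero, zero_add] at h2
    linarith [(abs_le.1 h2).1]
  have second := jets_of_isMax_penalized (f := F₁ t) (g := F₂ t) hr₀ hmx (loc ex₁) (loc ex₂)
  obtain ⟨q₁, hq₁, e₁⟩ := supConv_attained (K := K) (c := c) hw₁ hΩ hΩne t x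
  obtain ⟨q₂, hq₂, e₂⟩ := supConv_attained (K := K) (c := c) hw₂ hΩ hΩne t y
  have n₁ := ap₁' t x q₁ ⟨ht0T, hxB⟩ hq₁ e₁
  have n₂ := ap₂' t y q₂ ⟨ht0T, hyB⟩ hq₂ e₂
  have interior_of : ∀ {x : Vec3} {q : ℝ × Vec3}, closedBall x r₀ ⊆ B → q ∈ Ω →
      |t - q.1| ≤ δ → ‖x - q.2‖ ≤ δ → q ∈ Ico 0 T ×ˢ interior B := by
    intro x q hx hq h1 h2
    refine ⟨⟨hq.1.1, ?_⟩, ?_⟩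
    · linarith [(abs_le.1 h1).1, htI.2]
    · refine mem_interior.2 ⟨ball x r₀, ball_subset_closedBall.trans hx, isOpen_ball, ?_⟩
      rw [mem_ball', dist_eq_norm]
      linarith
  refine ⟨t, ht0T, x, hxB, y, hyB, q₁, interior_of hbx hq₁ n₁.1 n₁.2.1, q₂,
    interior_of hby hq₂ n₂.1 n₂.2.1, deriv (fun s => F₁ s x) t, deriv (fun s => F₂ s y) t,
    p₁, p₂, L₁, L₂, ?_, ⟨n₁.1.trans hδ1, n₁.2.1.trans hδ1⟩, ⟨n₂.1.trans hδ1, n₂.2.1.trans hδ1⟩,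
    upperJet_of_supConv hw₁ hΩ e₁ ex₁, upperJet_of_supConv hw₂ hΩ e₂ ex₂, ?_, ?_, ?_, ?_, ?_, ?_⟩
  · linarith [min_le_left ϑ r₀]
  · exact hβ _ ((hd₁.hasDerivAt.add hd₂.hasDerivAt).sub_const _)
  · refine ContinuousLinearMap.opNorm_le_bound _ hϑ.le fun v => ?_
    have h1 := (second v 0).1
    rw [map_zero, add_zero, sub_zero] at h1
    rw [_root_.sub_apply, dotCLM_smul, ← hk2, h1, add_sub_cancel_left]
    refine (p.le_opNorm _).trans ?_
    have : ‖((v, 0) : Vec3 × Vec3)‖ = ‖v‖ := by simp [Prod.norm_def]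
    rw [this]
    gcongr
    linarith
  · refine ContinuousLinearMap.opNorm_le_bound _ hϑ.le fun v => ?_
    have h1 := (second 0 v).1
    rw [map_zero, zero_add, zero_sub, map_neg] at h1
    have e3 : p₂ v + 2 * k * dotCLM (x - y) v = p (0, v) := by rw [h1]; ring
    rw [_root_.add_apply, dotCLM_smul, ← hk2, e3]
    refine (p.le_opNorm _).trans ?_
    have : ‖((0, v) : Vec3 × Vec3)‖ = ‖v‖ := by simp [Prod.norm_def]
    rw [this]
    gcongr
    linarith
  · intro v v'
    rw [← hk2]; exact (second v v').2
  · intro ha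
    by_contra hne
    have := abs_deriv_supConv_eq hw₁ hΩ hq₁ hK0 e₁ hd₁.hasDerivAt hne
    linarith
  · intro ha
    by_contra hne
    have := abs_deriv_supConv_eq hw₂ hΩ hq₂ hK0 e₂ hd₂.hasDerivAt hne
    linarith

end SameTimeMaximumPrinciple

section TestFunctions

/-- A family of values that is `o(|τ|)` is dominated by a `C¹` function of `τ` that vanishes to
first order at the origin. -/
lemma exists_hasDerivAt_majorant {S : Set (ℝ × ℝ)}
    (hS : ∀ η > 0, ∃ ρ > 0, ∀ z ∈ S, |z.1| < ρ → z.2 ≤ η * |z.1|) :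
    ∃ g g' : ℝ → ℝ, (∀ τ, HasDerivAt g (g' τ) τ) ∧ Continuous g' ∧ g 0 = 0 ∧ g' 0 = 0 ∧
      ∃ ρ > 0, ∀ z ∈ S, |z.1| < ρ → z.2 ≤ g z.1 := by
  choose r hr hrS using fun k : ℕ => hS ((1 / 2) ^ k) (by positivity)
  set ρ : ℕ → ℝ := fun k => min (r k) (1 / (k + 1)) with hρ
  have hρ0 : ∀ k, 0 < ρ k := fun k => lt_min (hr k) (by positivity)
  set f : ℕ → ℝ → ℝ := fun k τ =>
    3 * (1 / 2) ^ k * (√(τ ^ 2 + ρ (k + 1) ^ 2) - ρ (k + 1)) with hf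
  set f' : ℕ → ℝ → ℝ := fun k τ => 3 * (1 / 2) ^ k * (τ / √(τ ^ 2 + ρ (k + 1) ^ 2)) with hf'
  have hpos : ∀ k τ, 0 < τ ^ 2 + ρ (k + 1) ^ 2 := fun k τ => by have := hρ0 (k + 1); positivity
  have hder : ∀ k τ, HasDerivAt (f k) (f' k τ) τ := by
    intro k τ
    have h1 : HasDerivAt (fun τ : ℝ => τ ^ 2 + ρ (k + 1) ^ 2) (2 * τ) τ := by
      simpa using (hasDerivAt_pow 2 τ).add_const (ρ (k + 1) ^ 2)
    have h2 := ((h1.sqrt (hpos k τ).ne').sub_const (ρ (k + 1))).const_mul (3 * (1 / 2 : ℝ) ^ k)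
    refine h2.congr_deriv ?_
    simp only [hf']
    rw [mul_div_mul_left _ _ two_ne_zero]
  have hu : Summable fun k : ℕ => 3 * (1 / 2 : ℝ) ^ k :=
    (summable_geometric_of_lt_one (by norm_num) (by norm_num)).mul_left 3
  have hb : ∀ k τ, ‖f' k τ‖ ≤ 3 * (1 / 2 : ℝ) ^ k := by
    intro k τ
    have h1 : |τ / √(τ ^ 2 + ρ (k + 1) ^ 2)| ≤ 1 := by
      rw [abs_div, abs_of_nonneg (Real.sqrt_nonneg _), div_le_one (Real.sqrt_pos.2 (hpos k τ))]
      exact Real.abs_le_sqrt (by nlinarith [sq_nonneg (ρ (k + 1))])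
    simp only [hf']
    rw [norm_mul, Real.norm_eq_abs, Real.norm_eq_abs, abs_of_nonneg (by positivity)]
    exact mul_le_of_le_one_right (by positivity) h1
  have f0 : ∀ k, f k 0 = 0 := by
    intro k
    simp only [hf]
    rw [zero_pow two_ne_zero, zero_add, Real.sqrt_sq (hρ0 _).le, sub_self, mul_zero]
  have hs0 : Summable fun k => f k 0 := by simp only [f0]; exact summable_zero
  have hs : ∀ τ, Summable fun k => f k τ := fun τ =>
    summable_of_summable_hasDerivAt hu hder hb hs0 τ
  have fnn : ∀ k τ, 0 ≤ f k τ := by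
    intro k τ
    refine mul_nonneg (by positivity) (sub_nonneg.2 ?_)
    exact Real.le_sqrt_of_sq_le (by nlinarith [sq_nonneg τ])
  refine ⟨fun τ => ∑' k, f k τ, fun τ => ∑' k, f' k τ,
    fun τ => hasDerivAt_tsum hu hder hb hs0 τ, ?_, ?_, ?_, ρ 0, hρ0 0, ?_⟩
  · refine continuous_tsum (fun k => ?_) hu hb
    have h1 : Continuous fun τ : ℝ => √(τ ^ 2 + ρ (k + 1) ^ 2) := by fun_prop
    exact continuous_const.mul (continuous_id.div h1 fun τ => (Real.sqrt_pos.2 (hpos k τ)).ne')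
  · simp [f0]
  · simp [hf']
  · rintro ⟨τ, e⟩ hz hτ
    simp only at hτ ⊢
    rcases eq_or_ne τ 0 with rfl | hne
    · have := hrS 0 _ hz (by simpa using hr 0)
      simp only [abs_zero, mul_zero] at this
      simpa [f0] using this
    have hτ0 : 0 < |τ| := abs_pos.2 hne
    have hex : ∃ k : ℕ, ρ k ≤ |τ| := by
      obtain ⟨k, hk⟩ := exists_nat_one_div_lt hτ0
      exact ⟨k, (min_le_right _ _).trans hk.le⟩
    classical
    obtain ⟨j, hj⟩ : ∃ j, Nat.find hex = j + 1 := Nat.exists_eq_succ_of_ne_zero fun h => by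
      have := Nat.find_spec hex
      rw [h] at this
      exact absurd hτ (not_lt.2 this)
    have h1 : ρ (j + 1) ≤ |τ| := hj ▸ Nat.find_spec hex
    have h2 : |τ| < ρ j := not_le.1 (Nat.find_min hex (by rw [hj]; exact Nat.lt_succ_self j))
    have h3 := hrS j _ hz (h2.trans_le (min_le_left _ _))
    simp only at h3
    have h4 : |τ| / 3 + ρ (j + 1) ≤ √(τ ^ 2 + ρ (j + 1) ^ 2) := by
      refine Real.le_sqrt_of_sq_le ?_
      have := hρ0 (j + 1)
      rw [← sq_abs τ]
      nlinarith
    calc e ≤ (1 / 2) ^ j * |τ| := h3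
      _ ≤ f j τ := by
          have h5 : (0 : ℝ) ≤ (1 / 2) ^ j := by positivity
          have := mul_le_mul_of_nonneg_left h4 h5
          simp only [hf]
          linarith
      _ ≤ ∑' k, f k τ := (hs τ).le_tsum j fun k _ => fnn k τ

/-- The error in an upper jet can be absorbed by a `C¹` function of time and a small
quadratic term. -/
lemma UpperJet.exists_time_majorant {w : ℝ × Vec3 → ℝ} {Ω : Set (ℝ × Vec3)} {q : ℝ × Vec3} {a : ℝ}
    {p : Vec3 →L[ℝ] ℝ} {L : Vec3 →L[ℝ] Vec3 →L[ℝ] ℝ} (h : UpperJet w Ω q a p L) {σ : ℝ}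
    (hσ : 0 < σ) :
    ∃ g g' : ℝ → ℝ, (∀ τ, HasDerivAt g (g' τ) τ) ∧ Continuous g' ∧ g 0 = 0 ∧ g' 0 = 0 ∧
      ∃ ρ > 0, ∀ s v, (s, v) ∈ Ω → |s - q.1| < ρ → ‖v - q.2‖ < ρ →
        w (s, v) ≤ w q + a * (s - q.1) + p (v - q.2) + 1 / 2 * L (v - q.2) (v - q.2)
          + σ * ‖v - q.2‖ ^ 2 + g (s - q.1) := by
  obtain ⟨ρ₀, hρ₀, h0⟩ := h (σ / 2) (by positivity)
  set e : ℝ × Vec3 → ℝ := fun z => w z - (w q + a * (z.1 - q.1) + p (z.2 - q.2)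
    + 1 / 2 * L (z.2 - q.2) (z.2 - q.2) + σ * ‖z.2 - q.2‖ ^ 2) with he
  obtain ⟨g, g', hg, hg', g0, g0', ρ₁, hρ₁, h1⟩ := exists_hasDerivAt_majorant
    (S := (fun z => (z.1 - q.1, e z)) '' {z | z ∈ Ω ∧ |z.1 - q.1| < ρ₀ ∧ ‖z.2 - q.2‖ < ρ₀}) (by
      intro η hη
      obtain ⟨ρ, hρ, h1⟩ := h (min η σ) (lt_min hη hσ)
      refine ⟨min ρ (ρ ^ 2), by positivity, ?_⟩
      rintro _ ⟨z, ⟨hz, hz1, hz2⟩, rfl⟩ hτ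
      simp only at hτ ⊢
      rcases lt_or_ge ‖z.2 - q.2‖ ρ with hlt | hge
      · have h2 := h1 z.1 z.2 hz (hτ.trans_le (min_le_left _ _)) hlt
        have h3 : min η σ * |z.1 - q.1| ≤ η * |z.1 - q.1| := by gcongr; exact min_le_left _ _
        have h4 : min η σ * ‖z.2 - q.2‖ ^ 2 ≤ σ * ‖z.2 - q.2‖ ^ 2 := by
          gcongr; exact min_le_right _ _
        simp only [he]
        linarith
      · have h2 := h0 z.1 z.2 hz hz1 hz2
        have h3 : σ / 2 * |z.1 - q.1| ≤ σ / 2 * ‖z.2 - q.2‖ ^ 2 := by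
          gcongr
          exact (hτ.le.trans (min_le_right _ _)).trans (by gcongr)
        have h4 : 0 ≤ η * |z.1 - q.1| := by positivity
        simp only [he]
        linarith)
  refine ⟨g, g', hg, hg', g0, g0', min ρ₀ ρ₁, lt_min hρ₀ hρ₁, fun s v hsv hs hv => ?_⟩
  have h2 := h1 _ ⟨(s, v), ⟨hsv, hs.trans_le (min_le_left _ _), hv.trans_le (min_le_left _ _)⟩, rfl⟩
    (hs.trans_le (min_le_right _ _))
  simp only [he] at h2
  linarith

lemma dotCLM_add (a b : Vec3) : dotCLM (a + b) = dotCLM a + dotCLM b := by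
  ext v; simp [dotCLM_apply, add_mul, Finset.sum_add_distrib]

lemma matCLM_apply (M : Mat3) (v : Vec3) : matCLM M v = M *ᵥ v := by
  ext i; simp [matCLM, dotCLM_apply, Matrix.mulVec, dotProduct]

lemma matCLM_add (M N : Mat3) : matCLM (M + N) = matCLM M + matCLM N := by
  ext1 v; simp [matCLM_apply, Matrix.add_mulVec]

lemma matCLM_smul (c : ℝ) (M : Mat3) : matCLM (c • M) = c • matCLM M := by
  ext1 v; simp [matCLM_apply, Matrix.smul_mulVec]

variable {T R H : ℝ}

lemma IsC12.add {φ φt ψ ψt : ℝ × Vec3 → ℝ} {φx ψx : ℝ × Vec3 → Vec3} {φxx ψxx : ℝ × Vec3 → Mat3}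
    (h : IsC12 T R H φ φt φx φxx) (h' : IsC12 T R H ψ ψt ψx ψxx) :
    IsC12 T R H (fun z => φ z + ψ z) (fun z => φt z + ψt z) (fun z => φx z + ψx z)
      (fun z => φxx z + ψxx z) where
  contPhi := h.contPhi.add h'.contPhi
  hasDerivT z hz := (h.hasDerivT z hz).add (h'.hasDerivT z hz)
  hasFDerivX z hz := by rw [dotCLM_add]; exact (h.hasFDerivX z hz).add (h'.hasFDerivX z hz)
  hasFDerivXX z hz := by rw [matCLM_add]; exact (h.hasFDerivXX z hz).add (h'.hasFDerivXX z hz)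
  contT := h.contT.add h'.contT
  contX := h.contX.add h'.contX
  contXX := h.contXX.add h'.contXX

/-- Products of a `C¹` function of time and a `C²` function of space. -/
lemma isC12_mul {f f' : ℝ → ℝ} {g : Vec3 → ℝ} {g' : Vec3 → Vec3} {g'' : Vec3 → Mat3}
    (hf : ∀ t, HasDerivAt f (f' t) t) (hf' : Continuous f')
    (hg : ∀ x, HasFDerivAt g (dotCLM (g' x)) x) (hg' : ∀ x, HasFDerivAt g' (matCLM (g'' x)) x)
    (hg'' : Continuous g'') :
    IsC12 T R H (fun z => f z.1 * g z.2) (fun z => f' z.1 * g z.2) (fun z => f z.1 • g' z.2)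
      (fun z => f z.1 • g'' z.2) := by
  have cf : Continuous f := continuous_iff_continuousAt.2 fun t => (hf t).continuousAt
  have cg : Continuous g := continuous_iff_continuousAt.2 fun t => (hg t).continuousAt
  have cg' : Continuous g' := continuous_iff_continuousAt.2 fun t => (hg' t).continuousAt
  refine ⟨Continuous.continuousOn (by fun_prop), fun z _ => ?_, fun z _ => ?_, fun z _ => ?_,
    Continuous.continuousOn (by fun_prop), Continuous.continuousOn (by fun_prop),
    Continuous.continuousOn (by fun_prop)⟩
  · exact ((hf z.1).mul_const (g z.2)).hasDerivWithinAt
  · have : dotCLM (f z.1 • g' z.2) = f z.1 • dotCLM (g' z.2) := by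
      ext v; simp [dotCLM_smul]
    rw [this]
    exact ((hg z.2).const_mul (f z.1)).hasFDerivWithinAt
  · rw [matCLM_smul]
    exact ((hg' z.2).const_smul (f z.1)).hasFDerivWithinAt

lemma isC12_time {f f' : ℝ → ℝ} (hf : ∀ t, HasDerivAt f (f' t) t) (hf' : Continuous f') :
    IsC12 T R H (fun z => f z.1) (fun z => f' z.1) 0 0 := by
  have := isC12_mul (T := T) (R := R) (H := H) (g := fun _ => 1) (g' := fun _ => 0)
    (g'' := fun _ => 0) hf hf' (fun x => by
      have : dotCLM 0 = 0 := by ext v; simp [dotCLM_apply]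
      rw [this]; exact hasFDerivAt_const _ _) (fun x => by
      have : matCLM 0 = 0 := by ext1 v; simp [matCLM_apply]
      rw [this]; exact hasFDerivAt_const _ _) continuous_const
  simp only [mul_one, smul_zero] at this
  exact this

lemma isC12_space {g : Vec3 → ℝ} {g' : Vec3 → Vec3} {g'' : Vec3 → Mat3}
    (hg : ∀ x, HasFDerivAt g (dotCLM (g' x)) x) (hg' : ∀ x, HasFDerivAt g' (matCLM (g'' x)) x)
    (hg'' : Continuous g'') :
    IsC12 T R H (fun z => g z.2) 0 (fun z => g' z.2) (fun z => g'' z.2) := by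
  have := isC12_mul (T := T) (R := R) (H := H) (f := fun _ => 1) (f' := fun _ => 0)
    (fun t => hasDerivAt_const _ _) continuous_const hg hg' hg''
  simp only [one_mul, zero_mul, one_smul] at this
  exact this

/-- A second order Taylor polynomial on `Vec3` with symmetric Hessian. -/
lemma hasFDerivAt_quadratic {M : Mat3} (hM : M.IsSymm) (c : ℝ) (b y x : Vec3) :
    HasFDerivAt (fun x => c + b ⬝ᵥ (x - y) + 1 / 2 * ((x - y) ⬝ᵥ M *ᵥ (x - y)))
      (dotCLM (b + M *ᵥ (x - y))) x := by
  have hd : ∀ i, HasFDerivAt (fun x : Vec3 => x i - y i) (ContinuousLinearMap.proj i) x := fun i =>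
    (ContinuousLinearMap.proj (R := ℝ) (φ := fun _ : Fin 3 => ℝ) i).hasFDerivAt.sub_const (y i)
  have h01 : M 1 0 = M 0 1 := hM.apply 0 1
  have h02 : M 2 0 = M 0 2 := hM.apply 0 2
  have h12 : M 2 1 = M 1 2 := hM.apply 1 2
  have h1 : HasFDerivAt (fun x : Vec3 => c + ∑ i, b i * (x i - y i)
      + 1 / 2 * ∑ i, ∑ j, M i j * ((x i - y i) * (x j - y j))) _ x :=
    ((HasFDerivAt.fun_sum fun i (_ : i ∈ Finset.univ) => (hd i).const_mul (b i)).const_add c).add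
      ((HasFDerivAt.fun_sum fun i (_ : i ∈ Finset.univ) => HasFDerivAt.fun_sum
        fun j (_ : j ∈ Finset.univ) => ((hd i).mul (hd j)).const_mul (M i j)).const_mul (1 / 2))
  have h2 := h1.congr_fderiv (g' := dotCLM (b + M *ᵥ (x - y))) (by
    ext v
    simp [dotCLM_apply, Matrix.mulVec, dotProduct, Fin.sum_univ_three, h01, h02, h12]
    ring)
  refine h2.congr_of_eventuallyEq (Eventually.of_forall fun z => ?_)
  simp only [dotProduct, Matrix.mulVec, Fin.sum_univ_three, Pi.sub_apply]
  ring

lemma hasFDerivAt_affine (M : Mat3) (b y x : Vec3) :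
    HasFDerivAt (fun x => b + M *ᵥ (x - y)) (matCLM M) x := by
  have h := ((matCLM M).hasFDerivAt (x := x)).const_add (b - M *ᵥ y)
  refine h.congr_of_eventuallyEq (Eventually.of_forall fun z => ?_)
  simp only
  rw [matCLM_apply, Matrix.mulVec_sub]; abel

end TestFunctions

section JetInequalities

variable {T R H : ℝ}

lemma dotCLM_neg (a : Vec3) : dotCLM (-a) = -dotCLM a := by
  ext v; simp [dotCLM_apply]

lemma IsC12.neg {φ φt : ℝ × Vec3 → ℝ} {φx : ℝ × Vec3 → Vec3} {φxx : ℝ × Vec3 → Mat3}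
    (h : IsC12 T R H φ φt φx φxx) :
    IsC12 T R H (fun z => -φ z) (fun z => -φt z) (fun z => -φx z) (fun z => -φxx z) where
  contPhi := h.contPhi.neg
  hasDerivT z hz := (h.hasDerivT z hz).neg
  hasFDerivX z hz := by
    rw [dotCLM_neg]; exact (h.hasFDerivX z hz).neg
  hasFDerivXX z hz := by
    have : matCLM (-φxx z) = -matCLM (φxx z) := by ext1 v; simp [matCLM_apply, Matrix.neg_mulVec]
    rw [this]; exact (h.hasFDerivXX z hz).neg
  contT := h.contT.neg
  contX := h.contX.neg
  contXX := h.contXX.neg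

lemma apply_eq_sum (p : Vec3 →L[ℝ] ℝ) (v : Vec3) : p v = ∑ i, v i * p (Pi.single i 1) := by
  conv_lhs => rw [← Finset.univ_sum_single v]
  rw [map_sum]
  refine Finset.sum_congr rfl fun i _ => ?_
  have : (Pi.single i (v i) : Vec3) = v i • Pi.single i 1 := by
    rw [← Pi.single_smul, smul_eq_mul, mul_one]
  rw [this, map_smul, smul_eq_mul]

lemma apply_apply_eq_sum (L : Vec3 →L[ℝ] Vec3 →L[ℝ] ℝ) (v : Vec3) :
    L v v = ∑ i, ∑ j, v i * v j * L (Pi.single i 1) (Pi.single j 1) := by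
  have h1 := apply_eq_sum (L.flip v) v
  rw [ContinuousLinearMap.flip_apply] at h1
  rw [h1]
  refine Finset.sum_congr rfl fun i _ => ?_
  rw [ContinuousLinearMap.flip_apply, apply_eq_sum _ v, Finset.mul_sum]
  exact Finset.sum_congr rfl fun j _ => by ring

/-- The symmetric matrix of the quadratic form `v ↦ L v v + 2 σ |v|²`. -/
def symMat (L : Vec3 →L[ℝ] Vec3 →L[ℝ] ℝ) (σ : ℝ) : Mat3 :=
  Matrix.of (fun i j => (L (Pi.single i 1) (Pi.single j 1) + L (Pi.single j 1) (Pi.single i 1)) / 2)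
    + (2 * σ) • (1 : Mat3)

lemma symMat_isSymm (L : Vec3 →L[ℝ] Vec3 →L[ℝ] ℝ) (σ : ℝ) : (symMat L σ).IsSymm := by
  refine Matrix.IsSymm.add ?_ (Matrix.isSymm_one.smul _)
  ext i j
  simp [add_comm]

lemma dotProduct_symMat (L : Vec3 →L[ℝ] Vec3 →L[ℝ] ℝ) (σ : ℝ) (v : Vec3) :
    v ⬝ᵥ symMat L σ *ᵥ v = L v v + 2 * σ * sqn v := by
  rw [symMat, Matrix.add_mulVec, dotProduct_add, Matrix.smul_mulVec, Matrix.one_mulVec,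
    dotProduct_smul, apply_apply_eq_sum L v]
  simp only [sqn, dotProduct, Matrix.mulVec, Matrix.of_apply, Fin.sum_univ_three, smul_eq_mul]
  ring

/-- Upper jets are realized by `C^{1,2}` test functions, up to a small quadratic term. -/
lemma UpperJet.exists_test {w : ℝ × Vec3 → ℝ} {B : Set Vec3} {q : ℝ × Vec3} {a : ℝ}
    {p : Vec3 →L[ℝ] ℝ} {L : Vec3 →L[ℝ] Vec3 →L[ℝ] ℝ} (h : UpperJet w (Icc 0 T ×ˢ B) q a p L)
    (hqB : q.2 ∈ interior B) {σ : ℝ} (hσ : 0 < σ) :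
    ∃ φ φt φx φxx, IsC12 T R H φ φt φx φxx ∧ φ q = w q ∧ φt q = a ∧ dotCLM (φx q) = p ∧
      (∀ v, v ⬝ᵥ φxx q *ᵥ v = L v v + 2 * σ * sqn v) ∧
      ∀ᶠ z in 𝓝 q, z.1 ∈ Icc 0 T → w z ≤ φ z := by
  obtain ⟨g, g', hg, hg', g0, g0', ρ, hρ, h1⟩ := h.exists_time_majorant hσ
  set b : Vec3 := fun i => p (Pi.single i 1) with hb
  have hbp : dotCLM b = p := by
    ext1 v
    rw [dotCLM_apply, apply_eq_sum p v]
    exact Finset.sum_congr rfl fun i _ => by rw [hb, mul_comm]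
  have ht : ∀ t, HasDerivAt (fun t => a * (t - q.1) + g (t - q.1)) (a + g' (t - q.1)) t := by
    intro t
    have h2 := (hg (t - q.1)).comp_sub_const t q.1
    have h3 := ((hasDerivAt_id t).sub_const q.1).const_mul a
    rw [mul_one] at h3
    exact h3.add h2
  have c1 := isC12_time (T := T) (R := R) (H := H) ht (by fun_prop)
  have c2 := isC12_space (T := T) (R := R) (H := H)
    (hasFDerivAt_quadratic (symMat_isSymm L σ) (w q) b q.2)
    (hasFDerivAt_affine (symMat L σ) b q.2) continuous_const
  refine ⟨_, _, _, _, c1.add c2, ?_, ?_, ?_, ?_, ?_⟩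
  · simp [g0]
  · simp [g0']
  · simp [hbp]
  · intro v
    simp only [Pi.zero_apply, zero_add]
    exact dotProduct_symMat L σ v
  · have e1 : ∀ᶠ z : ℝ × Vec3 in 𝓝 q, z.2 ∈ B :=
      continuous_snd.continuousAt.eventually (mem_interior_iff_mem_nhds.1 hqB)
    filter_upwards [e1, Metric.ball_mem_nhds q hρ] with z hzB hz hzT
    rw [Metric.mem_ball, Prod.dist_eq, max_lt_iff, Real.dist_eq, dist_eq_norm] at hz
    have h2 := h1 z.1 z.2 ⟨hzT, hzB⟩ hz.1 hz.2
    have h3 : b ⬝ᵥ (z.2 - q.2) = p (z.2 - q.2) := by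
      rw [← hbp, dotCLM_apply]; rfl
    rw [h3, dotProduct_symMat]
    have h4 := mul_le_mul_of_nonneg_left (norm_sq_le_sqn (z.2 - q.2)) hσ.le
    change w (z.1, z.2) ≤ _
    linarith

namespace HJBData

variable {D : HJBData}

/-- The expression inside the supremum defining the Hamiltonian. -/
def hamArg (D : HJBData) (t : ℝ) (x z : Vec3) (M : Mat3) (u : ℝ × ℝ) : ℝ :=
  -(∑ j, D.drift t x u j * z j) - (1 / 2) * (D.aMat t x u * M).trace - D.runCost x u

lemma trace_aMat_mul (t : ℝ) (x : Vec3) (u : ℝ × ℝ) (M : Mat3) :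
    (D.aMat t x u * M).trace = D.vol t x u ⬝ᵥ M *ᵥ D.vol t x u := by
  simp only [aMat, Matrix.trace, Matrix.diag, Matrix.mul_apply, Matrix.vecMulVec_apply,
    dotProduct, Matrix.mulVec, Fin.sum_univ_three]
  ring

/-- The set of Hamiltonian arguments is bounded above when the coefficients are bounded. -/
lemma bddAbove_hamArg {t C : ℝ} {x : Vec3} (hC : ∀ u ∈ D.ctrl, ∀ i, |D.drift t x u i| ≤ C ∧
      |D.vol t x u i| ≤ C) (hL : ∀ u ∈ D.ctrl, 0 ≤ D.runCost x u) (z : Vec3) (M : Mat3) :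
    BddAbove (D.hamArg t x z M '' D.ctrl) := by
  refine ⟨(∑ j, C * |z j|) + 1 / 2 * ∑ i, ∑ j, C * (|M i j| * C), ?_⟩
  rintro _ ⟨u, hu, rfl⟩
  have h1 : -(∑ j, D.drift t x u j * z j) ≤ ∑ j, C * |z j| := by
    rw [← Finset.sum_neg_distrib]
    refine Finset.sum_le_sum fun j _ => ?_
    refine (neg_le_abs _).trans ?_
    rw [abs_mul]
    exact mul_le_mul_of_nonneg_right (hC u hu j).1 (abs_nonneg _)
  have h2 : -(D.vol t x u ⬝ᵥ M *ᵥ D.vol t x u) ≤ ∑ i, ∑ j, C * (|M i j| * C) := by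
    simp only [dotProduct, Matrix.mulVec]
    rw [← Finset.sum_neg_distrib]
    refine Finset.sum_le_sum fun i _ => ?_
    rw [Finset.mul_sum, ← Finset.sum_neg_distrib]
    refine Finset.sum_le_sum fun j _ => ?_
    refine (neg_le_abs _).trans ?_
    rw [abs_mul, abs_mul]
    have hC0 : 0 ≤ C := (abs_nonneg _).trans (hC u hu i).2
    have := (hC u hu i).2
    have := (hC u hu j).2
    gcongr
  rw [hamArg, trace_aMat_mul]
  linarith [hL u hu]

lemma hamArg_le_Ham {t : ℝ} {x z : Vec3} {M : Mat3} (h : BddAbove (D.hamArg t x z M '' D.ctrl))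
    {u : ℝ × ℝ} (hu : u ∈ D.ctrl) : D.hamArg t x z M u ≤ D.Ham t x z M :=
  le_csSup h (mem_image_of_mem _ hu)

lemma exists_Ham_lt {t : ℝ} {x z : Vec3} {M : Mat3} (hne : D.ctrl.Nonempty) {ε : ℝ} (hε : 0 < ε) :
    ∃ u ∈ D.ctrl, D.Ham t x z M - ε < D.hamArg t x z M u := by
  obtain ⟨_, ⟨u, hu, rfl⟩, h⟩ := exists_lt_of_lt_csSup (hne.image (D.hamArg t x z M))
    (sub_lt_self (D.Ham t x z M) hε)
  exact ⟨u, hu, h⟩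

end HJBData

variable {D : HJBData} {ψ ψt w : ℝ × Vec3 → ℝ} {ψx : ℝ × Vec3 → Vec3} {ψxx : ℝ × Vec3 → Mat3}
  {B : Set Vec3} {q : ℝ × Vec3} {a : ℝ} {p : Vec3 →L[ℝ] ℝ} {L : Vec3 →L[ℝ] Vec3 →L[ℝ] ℝ} {σ : ℝ}

lemma sum_mul_dotCLM (f z : Vec3) : ∑ j, f j * z j = dotCLM z f := by
  rw [dotCLM_apply]; exact Finset.sum_congr rfl fun _ _ => mul_comm _ _

lemma IsViscositySubsolution.jet_inequality {W : ℝ × Vec3 → ℝ} (hW : IsViscositySubsolution D W)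
    (hψ : IsC12 D.T D.R D.H ψ ψt ψx ψxx) (h : UpperJet w (Icc 0 D.T ×ˢ B) q a p L)
    (hq : q ∈ D.intO) (hqB : q.2 ∈ interior B) (hw : ∀ z ∈ Icc 0 D.T ×ˢ B, w z = W z - ψ z)
    (hσ : 0 < σ) (hb : ∀ z M, BddAbove (D.hamArg q.1 q.2 z M '' D.ctrl)) {u : ℝ × ℝ}
    (hu : u ∈ D.ctrl) :
    -ψt q ≤ a + p (D.drift q.1 q.2 u) + 1 / 2 * L (D.vol q.1 q.2 u) (D.vol q.1 q.2 u)
      + σ * sqn (D.vol q.1 q.2 u) + (dotCLM (ψx q) (D.drift q.1 q.2 u)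
        + 1 / 2 * (D.vol q.1 q.2 u ⬝ᵥ ψxx q *ᵥ D.vol q.1 q.2 u)) + D.runCost q.2 u := by
  obtain ⟨φ, φt, φx, φxx, hφ, e0, e1, e2, e3, hle⟩ := h.exists_test (R := D.R) (H := D.H) hqB hσ
  have hqO : q ∈ Icc 0 D.T ×ˢ B := ⟨⟨hq.1.1, hq.1.2.le⟩, interior_subset hqB⟩
  have hmax : IsLocalMaxOn (fun z => W z - (φ z + ψ z)) D.dom q := by
    have hB : ∀ᶠ z : ℝ × Vec3 in 𝓝 q, z.2 ∈ B :=
      continuous_snd.continuousAt.eventually (mem_interior_iff_mem_nhds.1 hqB)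
    filter_upwards [nhdsWithin_le_nhds hle, nhdsWithin_le_nhds hB, self_mem_nhdsWithin]
      with z h1 h2 h3
    have h4 := h1 h3.1
    have h5 := hw z ⟨h3.1, h2⟩
    have h6 := hw q hqO
    linarith
  have h1 := hW.2.2 _ _ _ _ (hφ.add hψ) q hq hmax
  have h2 := HJBData.hamArg_le_Ham (hb (φx q + ψx q) (φxx q + ψxx q)) hu
  rw [HJBData.hamArg, HJBData.trace_aMat_mul, sum_mul_dotCLM, dotCLM_add, e2, _root_.add_apply,
    Matrix.add_mulVec, dotProduct_add, e3] at h2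
  linarith

lemma IsViscositySupersolution.jet_inequality {V : ℝ × Vec3 → ℝ}
    (hV : IsViscositySupersolution D V)
    (hψ : IsC12 D.T D.R D.H ψ ψt ψx ψxx) (h : UpperJet w (Icc 0 D.T ×ˢ B) q a p L)
    (hq : q ∈ D.intO) (hqB : q.2 ∈ interior B) (hw : ∀ z ∈ Icc 0 D.T ×ˢ B, w z = -V z - ψ z)
    (hσ : 0 < σ) (hne : D.ctrl.Nonempty) {ε : ℝ} (hε : 0 < ε) :
    ∃ u ∈ D.ctrl,
      -ψt q ≤ a + p (D.drift q.1 q.2 u) + 1 / 2 * L (D.vol q.1 q.2 u) (D.vol q.1 q.2 u)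
      + σ * sqn (D.vol q.1 q.2 u) + (dotCLM (ψx q) (D.drift q.1 q.2 u)
        + 1 / 2 * (D.vol q.1 q.2 u ⬝ᵥ ψxx q *ᵥ D.vol q.1 q.2 u)) - D.runCost q.2 u + ε := by
  obtain ⟨φ, φt, φx, φxx, hφ, e0, e1, e2, e3, hle⟩ := h.exists_test (R := D.R) (H := D.H) hqB hσ
  have hqO : q ∈ Icc 0 D.T ×ˢ B := ⟨⟨hq.1.1, hq.1.2.le⟩, interior_subset hqB⟩
  have hmin : IsLocalMinOn (fun z => V z - -(φ z + ψ z)) D.dom q := by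
    have hB : ∀ᶠ z : ℝ × Vec3 in 𝓝 q, z.2 ∈ B :=
      continuous_snd.continuousAt.eventually (mem_interior_iff_mem_nhds.1 hqB)
    filter_upwards [nhdsWithin_le_nhds hle, nhdsWithin_le_nhds hB, self_mem_nhdsWithin]
      with z h1 h2 h3
    have h4 := h1 h3.1
    have h5 := hw z ⟨h3.1, h2⟩
    have h6 := hw q hqO
    linarith
  have h1 := hV.2.2 _ _ _ _ (hφ.add hψ).neg q hq hmin
  obtain ⟨u, hu, h2⟩ := HJBData.exists_Ham_lt (D := D) (t := q.1) (x := q.2)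
    (z := -(φx q + ψx q)) (M := -(φxx q + ψxx q)) hne hε
  refine ⟨u, hu, ?_⟩
  have e4 : dotCLM (-(φx q + ψx q)) = -(p + dotCLM (ψx q)) := by
    rw [← e2, ← dotCLM_add, dotCLM_neg]
  rw [HJBData.hamArg, HJBData.trace_aMat_mul, sum_mul_dotCLM, e4, _root_.neg_apply,
    _root_.add_apply, Matrix.neg_mulVec, dotProduct_neg, Matrix.add_mulVec, dotProduct_add,
    e3] at h2
  linarith

end JetInequalities

section Penalty

/-- A polynomial weight on `Vec3` of even degree `2 n + 2`. -/
def polyWeight (n : ℕ) (x : Vec3) : ℝ := 1 + ∑ i, x i ^ (2 * n + 2)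

/-- The gradient of `polyWeight`. -/
def polyWeightGrad (n : ℕ) (x : Vec3) : Vec3 := fun i => (2 * n + 2 : ℝ) * x i ^ (2 * n + 1)

/-- The Hessian of `polyWeight`. -/
def polyWeightHess (n : ℕ) (x : Vec3) : Mat3 :=
  Matrix.diagonal fun i => (2 * n + 2 : ℝ) * ((2 * n + 1 : ℝ) * x i ^ (2 * n))

lemma even_two_mul_add_two (n : ℕ) : Even (2 * n + 2) := ⟨n + 1, by ring⟩

lemma polyWeight_term_nonneg (n : ℕ) (r : ℝ) : 0 ≤ r ^ (2 * n + 2) :=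
  (even_two_mul_add_two n).pow_nonneg r

lemma one_le_polyWeight (n : ℕ) (x : Vec3) : 1 ≤ polyWeight n x :=
  le_add_of_nonneg_right (Finset.sum_nonneg fun i _ => polyWeight_term_nonneg n (x i))

lemma le_polyWeight (n : ℕ) (x : Vec3) (i : Fin 3) : 1 + x i ^ (2 * n + 2) ≤ polyWeight n x :=
  (add_le_add_iff_left 1).2 (Finset.single_le_sum (f := fun i => x i ^ (2 * n + 2))
    (fun i _ => polyWeight_term_nonneg n (x i)) (Finset.mem_univ i))

lemma norm_pow_le_polyWeight (n : ℕ) (x : Vec3) : ‖x‖ ^ (2 * n + 2) ≤ polyWeight n x := by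
  obtain ⟨i, -, hi⟩ := Finset.exists_mem_eq_sup' (Finset.univ_nonempty (α := Fin 3))
    fun i => ‖x i‖₊
  have h : ‖x‖ = |x i| := by
    rw [Pi.norm_def, ← Finset.sup'_eq_sup Finset.univ_nonempty, hi]; rfl
  rw [h, (even_two_mul_add_two n).pow_abs]
  linarith [le_polyWeight n x i]

lemma hasFDerivAt_polyWeight (n : ℕ) (x : Vec3) :
    HasFDerivAt (polyWeight n) (dotCLM (polyWeightGrad n x)) x := by
  have hd : ∀ i, HasFDerivAt (fun x : Vec3 => x i) (ContinuousLinearMap.proj i) x := fun i =>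
    (ContinuousLinearMap.proj (R := ℝ) (φ := fun _ : Fin 3 => ℝ) i).hasFDerivAt
  have h := (HasFDerivAt.fun_sum fun i (_ : i ∈ Finset.univ) => (hd i).pow (2 * n + 2)).const_add 1
  refine h.congr_fderiv ?_
  ext v
  simp [dotCLM_apply, polyWeightGrad]

lemma hasFDerivAt_polyWeightGrad (n : ℕ) (x : Vec3) :
    HasFDerivAt (polyWeightGrad n) (matCLM (polyWeightHess n x)) x := by
  have hd : ∀ i, HasFDerivAt (fun x : Vec3 => x i) (ContinuousLinearMap.proj i) x := fun i =>
    (ContinuousLinearMap.proj (R := ℝ) (φ := fun _ : Fin 3 => ℝ) i).hasFDerivAt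
  refine hasFDerivAt_pi'.2 fun i => ?_
  have h := ((hd i).pow (2 * n + 1)).const_mul (2 * n + 2 : ℝ)
  refine h.congr_fderiv ?_
  ext v
  simp [matCLM_apply, polyWeightHess, Matrix.mulVec_diagonal]
  ring

lemma continuous_polyWeightHess (n : ℕ) : Continuous (polyWeightHess n) := by
  unfold polyWeightHess; fun_prop

lemma continuous_polyWeight (n : ℕ) : Continuous (polyWeight n) := by
  unfold polyWeight; fun_prop

/-- The generator of a diffusion with linear growth is controlled by the polynomial weight. -/
lemma generator_polyWeight_le (n : ℕ) {C : ℝ} {x f v : Vec3}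
    (hf : ∀ i, |f i| ≤ C * (1 + |x i|)) (hv : ∀ i, |v i| ≤ C * (1 + |x i|)) :
    dotCLM (polyWeightGrad n x) f + 1 / 2 * (v ⬝ᵥ polyWeightHess n x *ᵥ v)
      ≤ 3 * (2 * (2 * n + 2) * C + 2 * (2 * n + 2) * (2 * n + 1) * C ^ 2) * polyWeight n x := by
  have hC : 0 ≤ C := by
    by_contra h
    have h1 := (abs_nonneg _).trans (hf 0)
    have h2 : 0 < 1 + |x 0| := by positivity
    nlinarith
  set c : ℝ := 2 * (2 * n + 2) * C + 2 * (2 * n + 2) * (2 * n + 1) * C ^ 2 with hc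
  have key : ∀ i, (2 * n + 2 : ℝ) * x i ^ (2 * n + 1) * f i
      + 1 / 2 * (v i * ((2 * n + 2 : ℝ) * ((2 * n + 1 : ℝ) * x i ^ (2 * n)) * v i))
        ≤ c * polyWeight n x := by
    intro i
    set r : ℝ := |x i| with hr
    have hr0 : 0 ≤ r := abs_nonneg _
    have hS : 1 + r ^ (2 * n + 2) ≤ polyWeight n x := by
      rw [hr, (even_two_mul_add_two n).pow_abs]; exact le_polyWeight n x i
    have hk : ∀ k ≤ 2 * n + 2, r ^ k ≤ polyWeight n x := by
      intro k hk
      refine le_trans ?_ hS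
      rcases le_total r 1 with h | h
      · have := pow_le_one₀ (n := k) hr0 h
        have : 0 ≤ r ^ (2 * n + 2) := by positivity
        linarith
      · have := pow_le_pow_right₀ h hk
        linarith
    have h1 : x i ^ (2 * n + 1) * f i ≤ C * (2 * polyWeight n x) := by
      refine (le_abs_self _).trans ?_
      rw [abs_mul, abs_pow, ← hr]
      calc r ^ (2 * n + 1) * |f i| ≤ r ^ (2 * n + 1) * (C * (1 + r)) := by gcongr; exact hf i
        _ = C * (r ^ (2 * n + 1) + r ^ (2 * n + 2)) := by ring
        _ ≤ C * (2 * polyWeight n x) := by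
          gcongr
          linarith [hk (2 * n + 1) (by lia), hk (2 * n + 2) le_rfl]
    have h2 : x i ^ (2 * n) * v i ^ 2 ≤ C ^ 2 * (4 * polyWeight n x) := by
      have e : x i ^ (2 * n) = r ^ (2 * n) := by rw [hr, (even_two_mul n).pow_abs]
      rw [e, ← sq_abs (v i)]
      calc r ^ (2 * n) * |v i| ^ 2 ≤ r ^ (2 * n) * (C * (1 + r)) ^ 2 := by gcongr; exact hv i
        _ = C ^ 2 * (r ^ (2 * n) + 2 * r ^ (2 * n + 1) + r ^ (2 * n + 2)) := by ring
        _ ≤ C ^ 2 * (4 * polyWeight n x) := by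
          gcongr
          linarith [hk (2 * n) (by lia), hk (2 * n + 1) (by lia), hk (2 * n + 2) le_rfl]
    have h3 := mul_le_mul_of_nonneg_left h1 (by positivity : (0 : ℝ) ≤ 2 * n + 2)
    have h4 := mul_le_mul_of_nonneg_left h2
      (by positivity : (0 : ℝ) ≤ 1 / 2 * ((2 * n + 2) * (2 * n + 1)))
    calc _ = (2 * n + 2 : ℝ) * (x i ^ (2 * n + 1) * f i)
          + 1 / 2 * ((2 * n + 2) * (2 * n + 1)) * (x i ^ (2 * n) * v i ^ 2) := by ring
      _ ≤ _ := add_le_add h3 h4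
      _ = c * polyWeight n x := by rw [hc]; ring
  have e : dotCLM (polyWeightGrad n x) f + 1 / 2 * (v ⬝ᵥ polyWeightHess n x *ᵥ v)
      = ∑ i, ((2 * n + 2 : ℝ) * x i ^ (2 * n + 1) * f i
      + 1 / 2 * (v i * ((2 * n + 2 : ℝ) * ((2 * n + 1 : ℝ) * x i ^ (2 * n)) * v i))) := by
    rw [dotCLM_apply, Finset.sum_add_distrib, ← Finset.mul_sum]
    simp only [polyWeightGrad, polyWeightHess, Matrix.mulVec_diagonal, dotProduct]
  rw [e]
  have := Finset.sum_le_card_nsmul Finset.univ _ _ fun i _ => key i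
  simp only [Finset.card_univ, Fintype.card_fin, nsmul_eq_mul, Nat.cast_ofNat] at this
  linarith

/-- The penalty `δ e^{-λ t} G(x)`. -/
def penalty (δ l : ℝ) (n : ℕ) (z : ℝ × Vec3) : ℝ := δ * Real.exp (-l * z.1) * polyWeight n z.2

lemma isC12_penalty {T R H : ℝ} (δ l : ℝ) (n : ℕ) :
    IsC12 T R H (penalty δ l n) (fun z => -l * (δ * Real.exp (-l * z.1)) * polyWeight n z.2)
      (fun z => (δ * Real.exp (-l * z.1)) • polyWeightGrad n z.2)
      (fun z => (δ * Real.exp (-l * z.1)) • polyWeightHess n z.2) := by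
  refine isC12_mul (f := fun t => δ * Real.exp (-l * t))
    (f' := fun t => -l * (δ * Real.exp (-l * t))) (fun t => ?_) (by fun_prop)
    (hasFDerivAt_polyWeight n) (hasFDerivAt_polyWeightGrad n) (continuous_polyWeightHess n)
  have h1 : HasDerivAt (fun t => -l * t) (-l) t := by
    simpa using (hasDerivAt_id t).const_mul (-l)
  refine (h1.exp.const_mul δ).congr_deriv ?_
  ring

lemma continuous_penalty (δ l : ℝ) (n : ℕ) : Continuous (penalty δ l n) := by
  have := continuous_polyWeight n
  unfold penalty
  fun_prop

/-- The penalty dominates every polynomial of lower degree far from the origin. -/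
lemma exists_growth_radius {K c m : ℝ} (hc : 0 < c) {n : ℕ} (hmn : m ≤ 2 * n) :
    ∃ r₀ ≥ 1, ∀ r ≥ r₀, K * (((2 : ℝ) * r) ^ m + 1) < c * r ^ (2 * n + 2) := by
  refine ⟨1 + |K| * (2 ^ m + 1) / c, by have : 0 < (2 : ℝ) ^ m := by positivity
                                        have : 0 ≤ |K| * (2 ^ m + 1) / c := by positivity
                                        linarith, fun r hr => ?_⟩
  have h2 : 0 < (2 : ℝ) ^ m := by positivity
  have h0 : 0 ≤ |K| * (2 ^ m + 1) / c := by positivity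
  have hr1 : 1 ≤ r := by linarith
  have h3 : r ^ m ≤ r ^ (2 * n) := by
    rw [← Real.rpow_natCast r (2 * n)]
    exact Real.rpow_le_rpow_of_exponent_le hr1 (by push_cast; exact hmn)
  have h4 : 1 ≤ r ^ (2 * n) := one_le_pow₀ hr1
  have h5 : |K| * (2 ^ m + 1) < c * r := by
    have : |K| * (2 ^ m + 1) / c < r := by linarith
    rw [div_lt_iff₀ hc] at this
    linarith
  calc K * ((2 * r) ^ m + 1) ≤ |K| * ((2 * r) ^ m + 1) := by
        have : 0 < r := by linarith
        gcongr; exact le_abs_self K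
    _ = |K| * (2 ^ m * r ^ m + 1) := by rw [Real.mul_rpow (by norm_num) (by linarith)]
    _ ≤ |K| * (2 ^ m * r ^ (2 * n) + r ^ (2 * n)) := by gcongr
    _ = |K| * (2 ^ m + 1) * r ^ (2 * n) := by ring
    _ < c * r * r ^ (2 * n) := by gcongr
    _ ≤ c * r * r ^ (2 * n) * r := le_mul_of_one_le_right (by positivity) hr1
    _ = c * r ^ (2 * n + 2) := by ring

end Penalty

section Coefficients

namespace HJBData

variable {D : HJBData}

/-- Lipschitz bound for a product. -/
lemma abs_mul_sub_mul_le {a a' b b' K K' d e : ℝ} (hb : |b| ≤ K) (ha : |a'| ≤ K')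
    (h : |a - a'| ≤ d) (h' : |b - b'| ≤ e) : |a * b - a' * b'| ≤ d * K + K' * e := by
  have : a * b - a' * b' = (a - a') * b + a' * (b - b') := by ring
  rw [this]
  refine (abs_add_le _ _).trans ?_
  rw [abs_mul, abs_mul]
  have := (abs_nonneg _).trans h
  have := (abs_nonneg _).trans ha
  gcongr

lemma abs_ctrl_term_le (hA : 0 < D.A) (hα : 0 < D.α) (hβ : 0 < D.β) {u : ℝ × ℝ}
    (hu : u ∈ D.ctrl) : |D.A * u.2 ^ D.α * u.1 ^ D.β| ≤ D.A * D.C ^ D.α * D.N ^ D.β := by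
  obtain ⟨⟨h1, h2⟩, h3, h4⟩ := hu
  rw [abs_of_nonneg (by positivity)]
  have := h3.trans h4
  gcongr

lemma runCost_nonneg (hk : 0 < D.k) {x : Vec3} (hx : x ∈ Qbar D.R D.H) {u : ℝ × ℝ}
    (hu : u ∈ D.ctrl) : 0 ≤ D.runCost x u := by
  have h1 := hx.2.1
  have h2 := hu.1.1
  unfold runCost
  positivity

lemma exists_linear_growth {L₂ : ℝ} (hA : 0 < D.A) (hα : 0 < D.α) (hβ : 0 < D.β)
    (hL₂ : 0 < L₂)
    (hC2 : ∀ t ∈ Icc 0 D.T, ∀ P ∈ Ici D.R, ∀ u ∈ D.ctrl,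
      |D.b t P u| ^ 2 + |D.σ t P u| ^ 2 ≤ L₂ ^ 2 * (1 + P ^ 2))
    (hθ : ContinuousOn D.θf (Icc 0 D.T)) (hs : ContinuousOn D.sf (Icc 0 D.T))
    (hℓ : ContinuousOn D.ℓf (Icc 0 D.T)) (hζ01 : ∀ r : ℝ, D.ζ r ∈ Icc (0 : ℝ) 1) :
    ∃ C > 0, ∀ t ∈ Icc 0 D.T, ∀ x ∈ Qbar D.R D.H, ∀ u ∈ D.ctrl, ∀ i,
      |D.drift t x u i| ≤ C * (1 + |x i|) ∧ |D.vol t x u i| ≤ C * (1 + |x i|) := by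
  obtain ⟨Kθ, hKθ⟩ := isCompact_Icc.exists_bound_of_continuousOn hθ
  obtain ⟨Ks, hKs⟩ := isCompact_Icc.exists_bound_of_continuousOn hs
  obtain ⟨Kℓ, hKℓ⟩ := isCompact_Icc.exists_bound_of_continuousOn hℓ
  set Kg := D.A * D.C ^ D.α * D.N ^ D.β with hKg
  set Kv := |D.ϱ⁻¹| * (|D.H| + |Kg| + |Kℓ|) with hKv
  have hKv0 : 0 ≤ Kv := by positivity
  refine ⟨L₂ + |Kθ| + |Ks| + Kv, by positivity, fun t ht x hx u hu i => ?_⟩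
  have hz : |D.ζ (x 2)| ≤ 1 := abs_le.2 ⟨by linarith [(hζ01 (x 2)).1], (hζ01 (x 2)).2⟩
  have hlin : ∀ r : ℝ, r ^ 2 ≤ L₂ ^ 2 * (1 + x 0 ^ 2) → |r| ≤ L₂ * (1 + |x 0|) := by
    intro r hr
    refine abs_le_of_sq_le_sq (hr.trans ?_) (by positivity)
    rw [mul_pow, ← sq_abs (x 0)]
    gcongr
    nlinarith [abs_nonneg (x 0)]
  have h2 := hC2 t ht (x 0) hx.1 u hu
  rw [sq_abs, sq_abs] at h2
  have hb := hlin (D.b t (x 0) u) (by linarith [sq_nonneg (D.σ t (x 0) u)])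
  have hσ := hlin (D.σ t (x 0) u) (by linarith [sq_nonneg (D.b t (x 0) u)])
  have e1 : |D.θf t * D.ζ (x 2)| ≤ |Kθ| := by
    have h3 : |D.θf t| ≤ |Kθ| := (hKθ t ht).trans (le_abs_self _)
    rw [abs_mul]
    exact (mul_le_mul h3 hz (abs_nonneg _) (abs_nonneg _)).trans_eq (mul_one _)
  have e2 : |D.sf t * D.ζ (x 2)| ≤ |Ks| := by
    have h3 : |D.sf t| ≤ |Ks| := (hKs t ht).trans (le_abs_self _)
    rw [abs_mul]
    exact (mul_le_mul h3 hz (abs_nonneg _) (abs_nonneg _)).trans_eq (mul_one _)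
  have e3 : |-(D.ϱ⁻¹) * x 1 * (x 2 + D.A * u.2 ^ D.α * u.1 ^ D.β - D.ℓf t)| ≤ Kv * |x 1| := by
    have h3 : |x 2 + D.A * u.2 ^ D.α * u.1 ^ D.β - D.ℓf t| ≤ |D.H| + |Kg| + |Kℓ| := by
      have h4 : |x 2| ≤ |D.H| := (abs_le.2 hx.2.2).trans (le_abs_self _)
      have h5 : |D.A * u.2 ^ D.α * u.1 ^ D.β| ≤ |Kg| :=
        (abs_ctrl_term_le hA hα hβ hu).trans (le_abs_self _)
      have h6 : |D.ℓf t| ≤ |Kℓ| := (hKℓ t ht).trans (le_abs_self _)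
      refine (abs_sub _ _).trans (add_le_add ((abs_add_le _ _).trans (add_le_add h4 h5)) h6)
    rw [abs_mul, abs_mul, abs_neg]
    calc _ ≤ |D.ϱ⁻¹| * |x 1| * (|D.H| + |Kg| + |Kℓ|) := by gcongr
      _ = Kv * |x 1| := by rw [hKv]; ring
  have a0 := abs_nonneg (x 0)
  have a1 := abs_nonneg (x 1)
  have a2 := abs_nonneg (x 2)
  have b1 := abs_nonneg Kθ
  have b2 := abs_nonneg Ks
  fin_cases i <;> simp only [drift, vol, Fin.zero_eta, Fin.mk_one, Fin.reduceFinMk,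
    Matrix.cons_val_zero, Matrix.cons_val_one, Matrix.cons_val, abs_zero]
  · exact ⟨by nlinarith, by nlinarith⟩
  · exact ⟨by positivity, by nlinarith⟩
  · exact ⟨by nlinarith, by nlinarith⟩

lemma exists_lipschitz {L₁ : ℝ} (hA : 0 < D.A) (hα : 0 < D.α) (hβ : 0 < D.β) (hk : 0 < D.k)
    (hγ : 0 < D.γ) (hL₁ : 0 < L₁)
    (hC1b : ∀ t ∈ Icc 0 D.T, ∀ P ∈ Ici D.R, ∀ P' ∈ Ici D.R, ∀ u ∈ D.ctrl,
      |D.b t P u - D.b t P' u| ≤ L₁ * |P - P'|)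
    (hC1σ : ∀ t ∈ Icc 0 D.T, ∀ P ∈ Ici D.R, ∀ P' ∈ Ici D.R, ∀ u ∈ D.ctrl,
      |D.σ t P u - D.σ t P' u| ≤ L₁ * |P - P'|)
    (hθ : ContinuousOn D.θf (Icc 0 D.T)) (hs : ContinuousOn D.sf (Icc 0 D.T))
    (hℓ : ContinuousOn D.ℓf (Icc 0 D.T)) (hζ : ContDiff ℝ 1 D.ζ) (r : ℝ) :
    ∃ C > 0, ∀ t ∈ Icc 0 D.T, ∀ x ∈ Qbar D.R D.H, ∀ y ∈ Qbar D.R D.H, ‖x‖ ≤ r → ‖y‖ ≤ r →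
      ∀ u ∈ D.ctrl, (∀ i, |D.drift t x u i - D.drift t y u i| ≤ C * ‖x - y‖) ∧
      (∀ i, |D.vol t x u i - D.vol t y u i| ≤ C * ‖x - y‖) ∧
      |D.runCost x u - D.runCost y u| ≤ C * ‖x - y‖ := by
  obtain ⟨Kθ, hKθ⟩ := isCompact_Icc.exists_bound_of_continuousOn hθ
  obtain ⟨Ks, hKs⟩ := isCompact_Icc.exists_bound_of_continuousOn hs
  obtain ⟨Kℓ, hKℓ⟩ := isCompact_Icc.exists_bound_of_continuousOn hℓ
  obtain ⟨Kζ, hKζ⟩ := hζ.contDiffOn.exists_lipschitzOnWith one_ne_zero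
    (convex_Icc (-D.H) D.H) isCompact_Icc
  set Kg := D.A * D.C ^ D.α * D.N ^ D.β with hKg
  set Kv := |D.ϱ⁻¹| * (|D.H| + |Kg| + |Kℓ| + |r|) with hKv
  have hKv0 : 0 ≤ Kv := by positivity
  set Kc := |D.k * D.N ^ D.γ| with hKc
  have hKc0 : 0 ≤ Kc := abs_nonneg _
  refine ⟨L₁ + |Kθ| * Kζ + |Ks| * Kζ + Kv + Kc, by positivity,
    fun t ht x hx y hy hxr hyr u hu => ?_⟩
  have hd : ∀ i, |x i - y i| ≤ ‖x - y‖ := fun i => norm_le_pi_norm (x - y) i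
  have hz : |D.ζ (x 2) - D.ζ (y 2)| ≤ Kζ * ‖x - y‖ := by
    have := hKζ.dist_le_mul (x 2) hx.2.2 (y 2) hy.2.2
    rw [Real.dist_eq, Real.dist_eq] at this
    exact this.trans (by gcongr; exact hd 2)
  have hb := (hC1b t ht (x 0) hx.1 (y 0) hy.1 u hu).trans (by gcongr; exact hd 0 :
    L₁ * |x 0 - y 0| ≤ L₁ * ‖x - y‖)
  have hσ := (hC1σ t ht (x 0) hx.1 (y 0) hy.1 u hu).trans (by gcongr; exact hd 0 :
    L₁ * |x 0 - y 0| ≤ L₁ * ‖x - y‖)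
  have e1 : |D.θf t * D.ζ (x 2) - D.θf t * D.ζ (y 2)| ≤ |Kθ| * Kζ * ‖x - y‖ := by
    have h3 : |D.θf t| ≤ |Kθ| := (hKθ t ht).trans (le_abs_self _)
    rw [← mul_sub, abs_mul, mul_assoc]
    gcongr
  have e2 : |D.sf t * D.ζ (x 2) - D.sf t * D.ζ (y 2)| ≤ |Ks| * Kζ * ‖x - y‖ := by
    have h3 : |D.sf t| ≤ |Ks| := (hKs t ht).trans (le_abs_self _)
    rw [← mul_sub, abs_mul, mul_assoc]
    gcongr
  set g := D.A * u.2 ^ D.α * u.1 ^ D.β with hg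
  have e3 : |-(D.ϱ⁻¹) * x 1 * (x 2 + g - D.ℓf t) - -(D.ϱ⁻¹) * y 1 * (y 2 + g - D.ℓf t)|
      ≤ Kv * ‖x - y‖ := by
    have h3 : |x 2 + g - D.ℓf t| ≤ |D.H| + |Kg| + |Kℓ| := by
      have h4 : |x 2| ≤ |D.H| := (abs_le.2 hx.2.2).trans (le_abs_self _)
      have h5 : |g| ≤ |Kg| := (abs_ctrl_term_le hA hα hβ hu).trans (le_abs_self _)
      have h6 : |D.ℓf t| ≤ |Kℓ| := (hKℓ t ht).trans (le_abs_self _)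
      refine (abs_sub _ _).trans (add_le_add ((abs_add_le _ _).trans (add_le_add h4 h5)) h6)
    have h4 : |y 1| ≤ |r| := (norm_le_pi_norm y 1).trans (hyr.trans (le_abs_self _))
    have h5 : |(x 2 + g - D.ℓf t) - (y 2 + g - D.ℓf t)| ≤ ‖x - y‖ := by
      refine le_trans (le_of_eq ?_) (hd 2)
      congr 1; ring
    have h6 := abs_mul_sub_mul_le h3 h4 (hd 1) h5
    have : -(D.ϱ⁻¹) * x 1 * (x 2 + g - D.ℓf t) - -(D.ϱ⁻¹) * y 1 * (y 2 + g - D.ℓf t)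
        = -(D.ϱ⁻¹) * (x 1 * (x 2 + g - D.ℓf t) - y 1 * (y 2 + g - D.ℓf t)) := by ring
    rw [this, abs_mul, abs_neg, hKv, mul_assoc]
    gcongr
    linarith
  have e4 : |D.runCost x u - D.runCost y u| ≤ Kc * ‖x - y‖ := by
    obtain ⟨⟨h1, h2⟩, -⟩ := hu
    rw [runCost, runCost, ← mul_sub, abs_mul]
    have h3 : |D.k * u.1 ^ D.γ| ≤ Kc := by
      rw [hKc, abs_of_nonneg (by positivity), abs_of_nonneg (by have := h1.trans h2; positivity)]
      gcongr
    gcongr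
    exact hd 1
  have hn := norm_nonneg (x - y)
  have n1 : 0 ≤ |Kθ| * Kζ * ‖x - y‖ := by positivity
  have n2 : 0 ≤ |Ks| * Kζ * ‖x - y‖ := by positivity
  have n3 := mul_nonneg hKv0 hn
  have n4 := mul_nonneg hKc0 hn
  have n5 := mul_nonneg hL₁.le hn
  refine ⟨fun i => ?_, fun i => ?_, by linarith⟩
  · fin_cases i <;> simp only [drift, Fin.zero_eta, Fin.mk_one, Fin.reduceFinMk,
      Matrix.cons_val_zero, Matrix.cons_val_one, Matrix.cons_val, sub_self, abs_zero]
    · linarith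
    · positivity
    · linarith
  · fin_cases i <;> simp only [vol, Fin.zero_eta, Fin.mk_one, Fin.reduceFinMk,
      Matrix.cons_val_zero, Matrix.cons_val_one, Matrix.cons_val]
    · linarith
    · linarith
    · linarith

end HJBData

end Coefficients

/-- Penalization in the doubled variables: near-maximizers of the doubled functional are nearly
diagonal and stay away from the parabolic boundary. -/
lemma exists_penalization {w₁ w₂ : ℝ × Vec3 → ℝ} {T M₀ ι : ℝ} {B : Set Vec3} (hB : IsCompact B)
    (hw₁ : Continuous w₁) (hw₂ : Continuous w₂)
    (hM : ∀ t ∈ Icc 0 T, ∀ x ∈ B, w₁ (t, x) + w₂ (t, x) ≤ M₀)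
    (hbd : ∀ t ∈ Icc 0 T, ∀ x ∈ B, (t = T ∨ x ∉ interior B) → w₁ (t, x) + w₂ (t, x) ≤ 0)
    (hι : 0 < ι) (hιM : ι < M₀) :
    ∃ κ > 0, ∀ t ∈ Icc 0 T, ∀ x ∈ B, ∀ y ∈ B, M₀ - ι / 4 ≤ doubled w₁ w₂ κ t x y →
      ‖x - y‖ ^ 2 / κ ≤ ι ∧ ‖x - y‖ ≤ ι ∧ t < T ∧ x ∈ interior B ∧ y ∈ interior B := by
  have hΩ : IsCompact (Icc 0 T ×ˢ B) := isCompact_Icc.prod hB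
  obtain ⟨b₁, hb₁⟩ := hΩ.exists_bound_of_continuousOn hw₁.continuousOn
  obtain ⟨b₂, hb₂⟩ := hΩ.exists_bound_of_continuousOn hw₂.continuousOn
  obtain ⟨d₁, hd₁, h₁⟩ := Metric.uniformContinuousOn_iff.1
    (hΩ.uniformContinuousOn_of_continuous hw₁.continuousOn) (ι / 4) (by positivity)
  obtain ⟨d₂, hd₂, h₂⟩ := Metric.uniformContinuousOn_iff.1
    (hΩ.uniformContinuousOn_of_continuous hw₂.continuousOn) (ι / 4) (by positivity)
  set e := min ι (min d₁ d₂) with he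
  have he0 : 0 < e := by positivity
  set b := |b₁| + |b₂| with hb
  have hb0 : 0 ≤ b := by positivity
  refine ⟨e ^ 2 / (2 * b + 1), by positivity, fun t ht x hx y hy h => ?_⟩
  set κ := e ^ 2 / (2 * b + 1) with hκ
  have hκ0 : 0 < κ := by positivity
  have hκb : 2 * κ * b < e ^ 2 := by
    have : κ * (2 * b + 1) = e ^ 2 := by rw [hκ]; field_simp
    linarith
  rw [doubled] at h
  have k1 : w₁ (t, x) ≤ |b₁| := (le_abs_self _).trans ((hb₁ (t, x) ⟨ht, hx⟩).trans (le_abs_self _))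
  have k2 : w₂ (t, y) ≤ |b₂| := (le_abs_self _).trans ((hb₂ (t, y) ⟨ht, hy⟩).trans (le_abs_self _))
  have k3 : sqn (x - y) / (2 * κ) ≤ b := by linarith
  rw [div_le_iff₀ (by positivity)] at k3
  have hn := norm_sq_le_sqn (x - y)
  have k4 : ‖x - y‖ < e := by
    refine lt_of_pow_lt_pow_left₀ 2 he0.le ?_
    linarith
  have hdist : dist (t, x) (t, y) < e := by
    rwa [Prod.dist_eq, dist_self, max_eq_right dist_nonneg, dist_eq_norm]
  have u1 := h₁ (t, x) ⟨ht, hx⟩ (t, y) ⟨ht, hy⟩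
    (hdist.trans_le ((min_le_right _ _).trans (min_le_left _ _)))
  have u2 := h₂ (t, x) ⟨ht, hx⟩ (t, y) ⟨ht, hy⟩
    (hdist.trans_le ((min_le_right _ _).trans (min_le_right _ _)))
  rw [Real.dist_eq, abs_lt] at u1 u2
  have k5 : 0 ≤ sqn (x - y) / (2 * κ) := div_nonneg (sqn_nonneg _) (by positivity)
  refine ⟨?_, k4.le.trans (min_le_left _ _), ?_, ?_, ?_⟩
  · have k6 : sqn (x - y) / (2 * κ) ≤ ι / 2 := by linarith [hM t ht x hx, u2.1]
    rw [div_le_iff₀ (by positivity)] at k6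
    rw [div_le_iff₀ hκ0]
    linarith
  · refine lt_of_le_of_ne ht.2 fun hT => ?_
    linarith [hbd t ht x hx (Or.inl hT), u2.1]
  · by_contra hxi
    linarith [hbd t ht x hx (Or.inr hxi), u2.1]
  · by_contra hyi
    linarith [hbd t ht y hy (Or.inr hyi), u1.2]

lemma abs_dotCLM_le (a v : Vec3) : |dotCLM a v| ≤ 3 * ‖a‖ * ‖v‖ := by
  rw [dotCLM_apply]
  refine (Finset.abs_sum_le_sum_abs _ _).trans ?_
  have h : ∀ i ∈ Finset.univ, |a i * v i| ≤ ‖a‖ * ‖v‖ := fun i _ => by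
    rw [abs_mul]
    exact mul_le_mul (norm_le_pi_norm a i) (norm_le_pi_norm v i) (abs_nonneg _) (norm_nonneg _)
  have := Finset.sum_le_card_nsmul _ _ _ h
  simp only [Finset.card_univ, Fintype.card_fin, nsmul_eq_mul, Nat.cast_ofNat] at this
  linarith

lemma exists_continuous_extension {S : Set (ℝ × Vec3)} (hS : IsClosed S) {f : ℝ × Vec3 → ℝ}
    (hf : ContinuousOn f S) : ∃ g : ℝ × Vec3 → ℝ, Continuous g ∧ ∀ z ∈ S, g z = f z := by
  obtain ⟨g, hg⟩ := ContinuousMap.exists_restrict_eq hS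
    (⟨S.domRestrict f, continuousOn_iff_continuous_domRestrict.1 hf⟩ : C(S, ℝ))
  exact ⟨g, g.continuous, fun z hz => DFunLike.congr_fun hg ⟨z, hz⟩⟩

/-- The penalty is a strict supersolution of the linear part of the equation. -/
lemma penalty_strict {T δ l C t : ℝ} {n : ℕ} {x f v : Vec3} (hδ : 0 < δ)
    (hl : l = 3 * (2 * (2 * n + 2) * C + 2 * (2 * n + 2) * (2 * n + 1) * C ^ 2) + 1)
    (hC : 0 < C) (ht : t ≤ T)
    (hf : ∀ i, |f i| ≤ C * (1 + |x i|)) (hv : ∀ i, |v i| ≤ C * (1 + |x i|)) :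
    δ * Real.exp (-l * T) + (dotCLM ((δ * Real.exp (-l * t)) • polyWeightGrad n x) f
      + 1 / 2 * (v ⬝ᵥ ((δ * Real.exp (-l * t)) • polyWeightHess n x) *ᵥ v))
      ≤ -(-l * (δ * Real.exp (-l * t)) * polyWeight n x) := by
  have h1 := generator_polyWeight_le n hf hv
  have hl0 : 0 ≤ l := by rw [hl]; positivity
  set c := δ * Real.exp (-l * t) with hc
  have hc0 : 0 < c := by positivity
  have h2 : δ * Real.exp (-l * T) ≤ c := by
    rw [hc]; gcongr δ * Real.exp ?_; nlinarith
  have h3 : c ≤ c * polyWeight n x := le_mul_of_one_le_right hc0.le (one_le_polyWeight n x)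
  have h4 := mul_le_mul_of_nonneg_left h1 hc0.le
  rw [dotCLM_smul, Matrix.smul_mulVec, dotProduct_smul, smul_eq_mul]
  have e : -(-l * c * polyWeight n x) = c * (3 * (2 * (2 * n + 2) * C
      + 2 * (2 * n + 2) * (2 * n + 1) * C ^ 2) * polyWeight n x) + c * polyWeight n x := by
    rw [hl]; ring
  rw [e]
  linarith

lemma sqn_le_of_abs_le {v : Vec3} {C : ℝ} (h : ∀ i, |v i| ≤ C) : sqn v ≤ 3 * C ^ 2 := by
  have hC := (abs_nonneg _).trans (h 0)
  refine (sqn_le v).trans ?_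
  have : ‖v‖ ≤ C := (pi_norm_le_iff_of_nonneg hC).2 h
  gcongr

lemma apply_le_dotCLM_add {p : Vec3 →L[ℝ] ℝ} {a f : Vec3} {ϑ C : ℝ} (hp : ‖p - dotCLM a‖ ≤ ϑ)
    (hC : 0 ≤ C) (hf : ∀ i, |f i| ≤ C) : p f ≤ dotCLM a f + ϑ * C := by
  have h1 : ‖f‖ ≤ C := (pi_norm_le_iff_of_nonneg hC).2 hf
  have h2 := (p - dotCLM a).le_of_opNorm_le_of_le hp h1
  have h3 : p f - dotCLM a f ≤ ϑ * C := (le_abs_self _).trans h2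
  linarith

/-- The contribution of two jets satisfying the matrix inequality of the maximum principle,
evaluated at nearby drift and volatility vectors. -/
lemma jet_sum_le {p₁ p₂ : Vec3 →L[ℝ] ℝ} {L₁ L₂ : Vec3 →L[ℝ] Vec3 →L[ℝ] ℝ}
    {z f₁ f₂ v₁ v₂ : Vec3} {κ ϑ ι K C r : ℝ} (hκ : 0 < κ) (hK : 0 ≤ K) (hC : 0 ≤ C)
    (hz : ‖z‖ ^ 2 / κ ≤ ι) (hzι : ‖z‖ ≤ ι) (hϑ0 : 0 ≤ ϑ) (hϑι : ϑ ≤ ι / 4) (hϑκ : ϑ ≤ κ)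
    (hr : r ≤ ‖z‖ + 2 * ϑ)
    (hp₁ : ‖p₁ - dotCLM ((1 / κ) • z)‖ ≤ ϑ) (hp₂ : ‖p₂ + dotCLM ((1 / κ) • z)‖ ≤ ϑ)
    (hL : ∀ v v', L₁ v v + L₂ v' v' ≤ 1 / κ * sqn (v - v'))
    (hf₁ : ∀ i, |f₁ i| ≤ K) (hf₂ : ∀ i, |f₂ i| ≤ K)
    (hf : ∀ i, |f₁ i - f₂ i| ≤ C * r) (hv : ∀ i, |v₁ i - v₂ i| ≤ C * r) :
    p₁ f₁ + p₂ f₂ + 1 / 2 * (L₁ v₁ v₁ + L₂ v₂ v₂) ≤ ι * (K + 9 * C + 6 * C ^ 2) := by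
  have hS := norm_nonneg z
  set S := ‖z‖ with hSdef
  have hCr : C * r ≤ C * (S + 2 * ϑ) := mul_le_mul_of_nonneg_left hr hC
  have e1 := apply_le_dotCLM_add hp₁ hK hf₁
  have e2 : p₂ f₂ ≤ -dotCLM ((1 / κ) • z) f₂ + ϑ * K := by
    have : ‖p₂ - dotCLM (-((1 / κ) • z))‖ ≤ ϑ := by rwa [dotCLM_neg, sub_neg_eq_add]
    have := apply_le_dotCLM_add this hK hf₂
    rwa [dotCLM_neg] at this
  have e3 : dotCLM ((1 / κ) • z) f₁ - dotCLM ((1 / κ) • z) f₂ ≤ 9 * C * ι := by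
    have hfn : ‖f₁ - f₂‖ ≤ C * (S + 2 * ϑ) :=
      (pi_norm_le_iff_of_nonneg (by positivity)).2 fun i => (hf i).trans hCr
    have h1 : dotCLM z (f₁ - f₂) ≤ 3 * S * (C * (S + 2 * ϑ)) :=
      (le_abs_self _).trans ((abs_dotCLM_le z _).trans
        (mul_le_mul_of_nonneg_left hfn (by positivity)))
    have h2 : S * (S + 2 * ϑ) ≤ 3 * ι * κ := by
      rw [div_le_iff₀ hκ] at hz
      nlinarith [mul_le_mul hzι hϑκ hϑ0 (hS.trans hzι)]
    rw [← map_sub, dotCLM_smul, one_div, inv_mul_le_iff₀ hκ]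
    nlinarith [mul_le_mul_of_nonneg_left h2 hC]
  have e4 : L₁ v₁ v₁ + L₂ v₂ v₂ ≤ 12 * C ^ 2 * ι := by
    refine (hL v₁ v₂).trans ?_
    have h1 : sqn (v₁ - v₂) ≤ 3 * (C * (S + 2 * ϑ)) ^ 2 :=
      sqn_le_of_abs_le fun i => (hv i).trans hCr
    have h2 : (S + 2 * ϑ) ^ 2 ≤ 4 * ι * κ := by
      rw [div_le_iff₀ hκ] at hz
      nlinarith [sq_nonneg (S - 2 * ϑ), mul_le_mul hϑι hϑκ hϑ0 (by linarith)]
    rw [one_div, inv_mul_le_iff₀ hκ]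
    nlinarith [mul_le_mul_of_nonneg_left h2 (sq_nonneg C)]
  have e5 : ϑ * K ≤ ι / 4 * K := mul_le_mul_of_nonneg_right hϑι hK
  have hι : 0 ≤ ι := hS.trans hzι
  nlinarith [mul_nonneg hι hK]

/-- A crude bound on the contribution of a single jet. -/
lemma jet_le {p : Vec3 →L[ℝ] ℝ} {L : Vec3 →L[ℝ] Vec3 →L[ℝ] ℝ} {z f v : Vec3} {κ ϑ K σ : ℝ}
    (hκ : 0 < κ) (hK : 0 ≤ K) (hz : ‖z‖ ≤ 1) (hϑ : ϑ ≤ 1) (hσ : σ ≤ 1)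
    (hp : ‖p - dotCLM ((1 / κ) • z)‖ ≤ ϑ) (hL : ∀ v, L v v ≤ 1 / κ * sqn v)
    (hf : ∀ i, |f i| ≤ K) (hv : ∀ i, |v i| ≤ K) :
    p f + 1 / 2 * L v v + σ * sqn v ≤ (3 / κ + 1) * K + 2 * K ^ 2 / κ + 3 * K ^ 2 := by
  have h1 := apply_le_dotCLM_add hp hK hf
  have h2 : ϑ * K ≤ K := by nlinarith
  have h3 := sqn_le_of_abs_le hv
  have h4 : σ * sqn v ≤ 3 * K ^ 2 := by nlinarith [sqn_nonneg v]
  have hfn : ‖f‖ ≤ K := (pi_norm_le_iff_of_nonneg hK).2 hf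
  have h5 : dotCLM ((1 / κ) • z) f ≤ 3 / κ * K := by
    have : dotCLM z f ≤ 3 * K := (le_abs_self _).trans ((abs_dotCLM_le z f).trans (by
      nlinarith [mul_le_mul hz hfn (norm_nonneg f) zero_le_one]))
    rw [dotCLM_smul, one_div, inv_mul_le_iff₀ hκ]
    calc dotCLM z f ≤ 3 * K := this
      _ = κ * (3 / κ * K) := by field_simp
  have h6 : L v v ≤ 3 * K ^ 2 / κ := by
    refine (hL v).trans ?_
    rw [one_div, inv_mul_le_iff₀ hκ]
    calc sqn v ≤ 3 * K ^ 2 := h3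
      _ = κ * (3 * K ^ 2 / κ) := by field_simp
  have h7 : 1 / 2 * (3 * K ^ 2 / κ) ≤ 2 * K ^ 2 / κ := by
    rw [← mul_div_assoc]
    exact div_le_div_of_nonneg_right (by nlinarith [sq_nonneg K]) hκ.le
  linarith

/-- Comparison on a compact set, for the difference corrected by a strict supersolution penalty. -/
lemma sub_sub_penalty_nonpos {D : HJBData} {W V : ℝ × Vec3 → ℝ}
    (hW : IsViscositySubsolution D W) (hV : IsViscositySupersolution D V) {B : Set Vec3}
    (hB : IsCompact B) (hBbar : B ⊆ Qbar D.R D.H) (hBint : interior B ⊆ Qset D.R D.H)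
    (hne : D.ctrl.Nonempty) (hk : 0 < D.k) {G C K δ l : ℝ} {n : ℕ} (hG : 0 < G) (hC : 0 < C)
    (hK : 0 < K) (hδ : 0 < δ)
    (hl : l = 3 * (2 * (2 * n + 2) * G + 2 * (2 * n + 2) * (2 * n + 1) * G ^ 2) + 1)
    (hgrow : ∀ t ∈ Icc 0 D.T, ∀ x ∈ B, ∀ u ∈ D.ctrl, ∀ i,
      |D.drift t x u i| ≤ G * (1 + |x i|) ∧ |D.vol t x u i| ≤ G * (1 + |x i|))
    (hbdd : ∀ t ∈ Icc 0 D.T, ∀ x ∈ B, ∀ u ∈ D.ctrl,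
      (∀ i, |D.drift t x u i| ≤ K ∧ |D.vol t x u i| ≤ K) ∧ D.runCost x u ≤ K)
    (hlip : ∀ t ∈ Icc 0 D.T, ∀ x ∈ B, ∀ y ∈ B, ∀ u ∈ D.ctrl,
      (∀ i, |D.drift t x u i - D.drift t y u i| ≤ C * ‖x - y‖) ∧
      (∀ i, |D.vol t x u i - D.vol t y u i| ≤ C * ‖x - y‖) ∧
      |D.runCost x u - D.runCost y u| ≤ C * ‖x - y‖)
    (hbd : ∀ t ∈ Icc 0 D.T, ∀ x ∈ B, (t = D.T ∨ x ∉ interior B) →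
      W (t, x) - V (t, x) - 2 * penalty δ l n (t, x) ≤ 0) :
    ∀ t ∈ Icc 0 D.T, ∀ x ∈ B, W (t, x) - V (t, x) - 2 * penalty δ l n (t, x) ≤ 0 := by
  have hΩ : IsCompact (Icc 0 D.T ×ˢ B) := isCompact_Icc.prod hB
  have hΩdom : Icc 0 D.T ×ˢ B ⊆ D.dom := prod_mono_right hBbar
  have hψc := continuous_penalty δ l n
  obtain ⟨w₁, hw₁c, hw₁⟩ := exists_continuous_extension hΩ.isClosed
    ((hW.1.mono hΩdom).sub hψc.continuousOn)
  obtain ⟨w₂, hw₂c, hw₂⟩ := exists_continuous_extension hΩ.isClosed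
    ((hV.1.mono hΩdom).neg.sub hψc.continuousOn)
  simp only [Pi.sub_apply, Pi.neg_apply] at hw₁ hw₂
  have hsum : ∀ t ∈ Icc 0 D.T, ∀ x ∈ B,
      w₁ (t, x) + w₂ (t, x) = W (t, x) - V (t, x) - 2 * penalty δ l n (t, x) := by
    intro t ht x hx
    rw [hw₁ _ ⟨ht, hx⟩, hw₂ _ ⟨ht, hx⟩]; ring
  by_contra! hcon
  obtain ⟨t₀, ht₀, x₀, hx₀, hpos⟩ := hcon
  obtain ⟨⟨tm, xm⟩, ⟨htm, hxm⟩, hmaxm⟩ :=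
    hΩ.exists_isMaxOn ⟨(t₀, x₀), ht₀, hx₀⟩ (hw₁c.add hw₂c).continuousOn
  set M₀ := w₁ (tm, xm) + w₂ (tm, xm) with hM₀
  have hM₀le : ∀ t ∈ Icc 0 D.T, ∀ x ∈ B, w₁ (t, x) + w₂ (t, x) ≤ M₀ :=
    fun t ht x hx => hmaxm (show (t, x) ∈ Icc 0 D.T ×ˢ B from ⟨ht, hx⟩)
  have hM₀pos : 0 < M₀ := lt_of_lt_of_le (by rwa [hsum _ ht₀ _ hx₀]) (hM₀le _ ht₀ _ hx₀)
  set c₀ := δ * Real.exp (-l * D.T) with hc₀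
  have hc₀pos : 0 < c₀ := by positivity
  set A := 2 + K + 11 * C + 6 * C ^ 2 + 6 * K ^ 2 with hA
  have hApos : 0 < A := by positivity
  set ι := min 1 (min (M₀ / 2) (c₀ / A)) with hι
  have hι0 : 0 < ι := by positivity
  have hι1 : ι ≤ 1 := min_le_left _ _
  have hιM : ι < M₀ := ((min_le_right _ _).trans (min_le_left _ _)).trans_lt (by linarith)
  have hιA : ι * A ≤ c₀ := (le_div_iff₀ hApos).1 ((min_le_right _ _).trans (min_le_right _ _))
  obtain ⟨κ, hκ, hpen⟩ := exists_penalization hB hw₁c hw₂c hM₀le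
    (fun t ht x hx h => by rw [hsum t ht x hx]; exact hbd t ht x hx h) hι0 hιM
  have hdc : Continuous fun z : ℝ × Vec3 × Vec3 => doubled w₁ w₂ κ z.1 z.2.1 z.2.2 := by
    unfold doubled
    have := continuous_sqn
    fun_prop
  obtain ⟨⟨tM, xM, yM⟩, ⟨htM, hxM, hyM⟩, hmaxM⟩ :=
    (isCompact_Icc.prod (hB.prod hB)).exists_isMaxOn ⟨(t₀, x₀, x₀), ht₀, hx₀, hx₀⟩
      (hdc.continuousOn (s := Icc 0 D.T ×ˢ B ×ˢ B))
  set M := doubled w₁ w₂ κ tM xM yM with hM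
  have hMle : ∀ t ∈ Icc 0 D.T, ∀ x ∈ B, ∀ y ∈ B, doubled w₁ w₂ κ t x y ≤ M :=
    fun t ht x hx y hy => hmaxM (show (t, x, y) ∈ Icc 0 D.T ×ˢ B ×ˢ B from ⟨ht, hx, hy⟩)
  have hM₀M : M₀ ≤ M := by
    have := hMle tm htm xm hxm xm hxm
    simpa [doubled, sqn] using this
  set ϑ := min (ι / 4) (min κ 1) with hϑ
  have hϑ0 : 0 < ϑ := by positivity
  have hϑι : ϑ ≤ ι / 4 := min_le_left _ _
  have hϑκ : ϑ ≤ κ := (min_le_right _ _).trans (min_le_left _ _)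
  have hϑ1 : ϑ ≤ 1 := (min_le_right _ _).trans (min_le_right _ _)
  set K₁ := (3 / κ + 1) * K + 2 * K ^ 2 / κ + 3 * K ^ 2 with hK₁
  obtain ⟨t, ht, x, hx, y, hy, q₁, hq₁, q₂, hq₂, a₁, a₂, p₁, p₂, L₁, L₂, hval, ⟨-, hxq⟩,
      ⟨-, hyq⟩, hj₁, hj₂, ha, hp₁, hp₂, hL, ht₁, ht₂⟩ :=
    exists_upperJets hB hw₁c hw₂c hκ hMle ⟨tM, htM, xM, hxM, yM, hyM, rfl⟩
      (fun t ht x hx y hy h => (hpen t ht x hx y hy (by linarith)).2.2) hϑ0 (K₁ + K + 3)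
  obtain ⟨hS, hSι, -⟩ := hpen t ht x hx y hy (by linarith)
  have hS1 : ‖x - y‖ ≤ 1 := hSι.trans hι1
  have hI : ∀ q ∈ Ico 0 D.T ×ˢ interior B, q ∈ D.intO := fun q hq => ⟨hq.1, hBint hq.2⟩
  have hI' : ∀ q ∈ Ico 0 D.T ×ˢ interior B, q.1 ∈ Icc 0 D.T ∧ q.2 ∈ B :=
    fun q hq => ⟨Ico_subset_Icc_self hq.1, interior_subset hq.2⟩
  have hψ := isC12_penalty (T := D.T) (R := D.R) (H := D.H) δ l n
  have hrun : ∀ q ∈ Ico 0 D.T ×ˢ interior B, ∀ u ∈ D.ctrl, 0 ≤ D.runCost q.2 u :=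
    fun q hq u hu => D.runCost_nonneg hk (hBbar (hI' q hq).2) hu
  have hstrict : ∀ q ∈ Ico 0 D.T ×ˢ interior B, ∀ u ∈ D.ctrl, _ := fun q hq u hu =>
    penalty_strict (T := D.T) (n := n) (x := q.2) hδ hl hG (hI' q hq).1.2
      (fun i => (hgrow q.1 (hI' q hq).1 q.2 (hI' q hq).2 u hu i).1)
      (fun i => (hgrow q.1 (hI' q hq).1 q.2 (hI' q hq).2 u hu i).2)
  have hsub : ∀ u ∈ D.ctrl, c₀ ≤ a₁ + p₁ (D.drift q₁.1 q₁.2 u)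
      + 1 / 2 * L₁ (D.vol q₁.1 q₁.2 u) (D.vol q₁.1 q₁.2 u) + ι * sqn (D.vol q₁.1 q₁.2 u)
      + D.runCost q₁.2 u := by
    intro u hu
    have h1 := hW.jet_inequality hψ hj₁ (hI _ hq₁) hq₁.2 hw₁ hι0
      (D.bddAbove_hamArg (fun u hu => (hbdd _ (hI' _ hq₁).1 _ (hI' _ hq₁).2 u hu).1)
        (hrun q₁ hq₁)) hu
    have h2 := hstrict q₁ hq₁ u hu
    linarith
  obtain ⟨u, hu, hsup⟩ := hV.jet_inequality hψ hj₂ (hI _ hq₂) hq₂.2 hw₂ hι0 hne hι0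
  have hsup' := hstrict q₂ hq₂ u hu
  have hsub' := hsub u hu
  obtain ⟨hb₁, hr₁⟩ := hbdd _ (hI' _ hq₁).1 _ (hI' _ hq₁).2 u hu
  obtain ⟨hb₂, hr₂⟩ := hbdd _ (hI' _ hq₂).1 _ (hI' _ hq₂).2 u hu
  have hr₂' := hrun q₂ hq₂ u hu
  have hj₁' := jet_le hκ hK.le hS1 hϑ1 hι1 hp₁ (fun v => by simpa using hL v 0)
    (fun i => (hb₁ i).1) (fun i => (hb₁ i).2)
  have hj₂' := jet_le (z := -(x - y)) (p := p₂) hκ hK.le (by rwa [norm_neg]) hϑ1 hι1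
    (by rwa [smul_neg, dotCLM_neg, sub_neg_eq_add])
    (fun v => by simpa [sqn_neg] using hL 0 v) (fun i => (hb₂ i).1) (fun i => (hb₂ i).2)
  have h1 : q₁.1 = t := ht₁ (abs_lt.2 ⟨by linarith, by linarith⟩)
  have h2 : q₂.1 = t := ht₂ (abs_lt.2 ⟨by linarith, by linarith⟩)
  obtain ⟨t₁, x₁⟩ := q₁
  obtain ⟨t₂, y₁⟩ := q₂
  simp only at *
  subst h1
  subst h2
  obtain ⟨hlf, hlv, hlr⟩ := hlip _ ht _ (hI' _ hq₁).2 _ (hI' _ hq₂).2 u hu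
  have hr : ‖x₁ - y₁‖ ≤ ‖x - y‖ + 2 * ϑ := by
    have : x₁ - y₁ = (x - y) - (x - x₁) + (y - y₁) := by abel
    rw [this]
    linarith [norm_add_le ((x - y) - (x - x₁)) (y - y₁), norm_sub_le (x - y) (x - x₁)]
  have hjs := jet_sum_le hκ hK.le hC.le hS hSι hϑ0.le hϑι hϑκ hr hp₁ hp₂ hL
    (fun i => (hb₁ i).1) (fun i => (hb₂ i).1) hlf hlv
  have s₁ := sqn_le_of_abs_le fun i => (hb₁ i).2
  have s₂ := sqn_le_of_abs_le fun i => (hb₂ i).2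
  have s₃ := mul_le_mul_of_nonneg_left (add_le_add s₁ s₂) hι0.le
  have hrr : C * ‖x₁ - y₁‖ ≤ C * (2 * ι) := mul_le_mul_of_nonneg_left (by linarith) hC.le
  have hlr' := (abs_le.1 hlr).2
  rw [hA] at hιA
  linarith

lemma enorm3_le (x : Vec3) : enorm3 x ≤ 2 * ‖x‖ := by
  refine Real.sqrt_le_iff.2 ⟨by positivity, ?_⟩
  have h := sqn_le x
  rw [sqn] at h
  nlinarith [sq_nonneg ‖x‖]

/-- A truncation of `Qbar R H`. -/
def truncBox (R H ρ : ℝ) : Set Vec3 := Icc ![R, 0, -H] ![ρ, ρ, H]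

lemma mem_truncBox {R H ρ : ℝ} {x : Vec3} : x ∈ truncBox R H ρ ↔
    (R ≤ x 0 ∧ 0 ≤ x 1 ∧ -H ≤ x 2) ∧ x 0 ≤ ρ ∧ x 1 ≤ ρ ∧ x 2 ≤ H := by
  simp [truncBox, Pi.le_def, Fin.forall_fin_succ]

lemma isCompact_truncBox (R H ρ : ℝ) : IsCompact (truncBox R H ρ) := isCompact_Icc

lemma truncBox_subset_Qbar (R H ρ : ℝ) : truncBox R H ρ ⊆ Qbar R H := fun _ hx =>
  have h := mem_truncBox.1 hx
  ⟨h.1.1, h.1.2.1, h.1.2.2, h.2.2.2⟩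

lemma mem_interior_truncBox {R H ρ : ℝ} {x : Vec3} : x ∈ interior (truncBox R H ρ) ↔
    (R < x 0 ∧ x 0 < ρ) ∧ (0 < x 1 ∧ x 1 < ρ) ∧ -H < x 2 ∧ x 2 < H := by
  rw [truncBox, ← pi_univ_Icc, interior_pi_set finite_univ]
  simp [Fin.forall_fin_succ]

lemma norm_le_of_mem_truncBox {R H ρ : ℝ} (hR : 0 < R) (hρ : 0 ≤ ρ) (hH : 0 ≤ H) {x : Vec3}
    (hx : x ∈ truncBox R H ρ) : ‖x‖ ≤ ρ + H := by
  obtain ⟨⟨h0, h1, h2⟩, h3, h4, h5⟩ := mem_truncBox.1 hx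
  refine (pi_norm_le_iff_of_nonneg (by positivity)).2 fun i => ?_
  rw [Real.norm_eq_abs, abs_le]
  fin_cases i <;> constructor <;> simp <;> linarith

/-- A point of a truncated box that is not interior lies on the lateral boundary or far out. -/
lemma notMem_Qset_or_le_norm {R H ρ : ℝ} {x : Vec3}
    (hx : x ∉ interior (truncBox R H ρ)) : x ∉ Qset R H ∨ ρ ≤ ‖x‖ := by
  by_contra! h
  obtain ⟨⟨h0, h1, h2⟩, h3⟩ := h
  have k (i : Fin 3) : x i < ρ := ((le_abs_self _).trans (norm_le_pi_norm x i)).trans_lt h3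
  exact hx (mem_interior_truncBox.2 ⟨⟨h0, k 0⟩, ⟨h1, k 1⟩, h2⟩)

/-!
STATEMENT 1 (comparison principle, Theorem 5.5 of the paper): under (C1), (C2), any
viscosity subsolution `W` and supersolution `V` of the HJB equation with polynomial
growth (of order `m > 3`) attaining the boundary/terminal values `−Pξ` on `∂*O`
satisfy `W ≤ V` on `[0,T]×Q̄`.
-/

theorem comparison_principle (D : HJBData)
    (hT : 0 < D.T) (hR : 0 < D.R) (hH : 1 < D.H) (hN : 0 < D.N) (hC : 0 < D.C)
    (hA : 0 < D.A) (hα : 0 < D.α) (hβ : 0 < D.β) (hϱ : 0 < D.ϱ)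
    (hk : 0 < D.k) (hγ : 0 < D.γ)
    (L₁ L₂ : ℝ) (hL₁ : 0 < L₁) (hL₂ : 0 < L₂)
    -- condition (C1)
    (hC1b : ∀ t ∈ Icc 0 D.T, ∀ P ∈ Ici D.R, ∀ P' ∈ Ici D.R, ∀ u ∈ D.ctrl,
      |D.b t P u - D.b t P' u| ≤ L₁ * |P - P'|)
    (hC1σ : ∀ t ∈ Icc 0 D.T, ∀ P ∈ Ici D.R, ∀ P' ∈ Ici D.R, ∀ u ∈ D.ctrl,
      |D.σ t P u - D.σ t P' u| ≤ L₁ * |P - P'|)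
    -- condition (C2)
    (hC2 : ∀ t ∈ Icc 0 D.T, ∀ P ∈ Ici D.R, ∀ u ∈ D.ctrl,
      |D.b t P u| ^ 2 + |D.σ t P u| ^ 2 ≤ L₂ ^ 2 * (1 + P ^ 2))
    -- regularity of the coefficients θ, s̄, ℓ and of the cut-off ζ_H
    (hθ : ContDiffOn ℝ 1 D.θf (Icc 0 D.T))
    (hs : ContDiffOn ℝ 1 D.sf (Icc 0 D.T))
    (hℓ : ContDiffOn ℝ 1 D.ℓf (Icc 0 D.T))
    (hζ : ContDiff ℝ (⊤ : ℕ∞) D.ζ) (hζ01 : ∀ r : ℝ, D.ζ r ∈ Icc (0 : ℝ) 1)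
    (hζone : ∀ r : ℝ, |r| ≤ D.H - 1 → D.ζ r = 1)
    (hζzero : ∀ r : ℝ, D.H < |r| → D.ζ r = 0)
    -- the sub- and supersolutions and their growth/boundary conditions
    (W V : ℝ × Vec3 → ℝ)
    (hW : IsViscositySubsolution D W) (hV : IsViscositySupersolution D V)
    (L₀ m : ℝ) (hL₀ : 0 < L₀) (hm : 3 < m)
    (hWgrow : ∀ p ∈ D.dom, |W p| ≤ L₀ * (enorm3 p.2 ^ m + 1))
    (hVgrow : ∀ p ∈ D.dom, |V p| ≤ L₀ * (enorm3 p.2 ^ m + 1))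
    (hWbd : ∀ p ∈ D.parBdry, W p = -(p.2 0 * p.2 1))
    (hVbd : ∀ p ∈ D.parBdry, V p = -(p.2 0 * p.2 1)) :
    ∀ p ∈ D.dom, W p ≤ V p := by
  by_contra! hcon
  obtain ⟨⟨t₀, x₀⟩, ⟨ht₀, hx₀⟩, hlt⟩ := hcon
  have hne : D.ctrl.Nonempty := ⟨(0, 0), ⟨le_rfl, hN.le⟩, le_rfl, hC.le⟩
  obtain ⟨G, hG, hgrow⟩ := D.exists_linear_growth hA hα hβ hL₂ hC2 hθ.continuousOn
    hs.continuousOn hℓ.continuousOn hζ01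
  obtain ⟨n, hn⟩ := exists_nat_ge (m / 2)
  obtain ⟨l, hl⟩ : ∃ l, l = 3 * (2 * (2 * (n : ℝ) + 2) * G
    + 2 * (2 * n + 2) * (2 * n + 1) * G ^ 2) + 1 := ⟨_, rfl⟩
  have hl0 : 0 < l := by rw [hl]; positivity
  have hw0 : 0 < polyWeight n x₀ := zero_lt_one.trans_le (one_le_polyWeight n x₀)
  set δ := (W (t₀, x₀) - V (t₀, x₀)) / (4 * polyWeight n x₀) with hδ
  have hδ0 : 0 < δ := div_pos (sub_pos.2 hlt) (by positivity)
  have hexp : ∀ t ∈ Icc 0 D.T, Real.exp (-l * D.T) ≤ Real.exp (-l * t) := fun t ht =>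
    Real.exp_le_exp.2 (by nlinarith [ht.2])
  obtain ⟨r₀, hr₀1, hr₀⟩ := exists_growth_radius (K := 2 * L₀) (m := m)
    (c := 2 * (δ * Real.exp (-l * D.T))) (by positivity) (n := n) (by linarith)
  have hfar : ∀ t ∈ Icc 0 D.T, ∀ x ∈ Qbar D.R D.H, r₀ ≤ ‖x‖ →
      W (t, x) - V (t, x) - 2 * penalty δ l n (t, x) ≤ 0 := by
    intro t ht x hx hr
    have h1 := (abs_le.1 (hWgrow (t, x) ⟨ht, hx⟩)).2
    have h2 := (abs_le.1 (hVgrow (t, x) ⟨ht, hx⟩)).1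
    have h3 : enorm3 x ^ m ≤ (2 * ‖x‖) ^ m :=
      Real.rpow_le_rpow (Real.sqrt_nonneg _) (enorm3_le x) (by linarith)
    have h4 := mul_le_mul_of_nonneg_left h3 hL₀.le
    have h5 := hr₀ _ hr
    have h6 : δ * Real.exp (-l * D.T) * ‖x‖ ^ (2 * n + 2) ≤ penalty δ l n (t, x) := by
      have := hexp t ht
      have := norm_pow_le_polyWeight n x
      unfold penalty
      gcongr
    simp only at h1 h2
    linarith
  have hpar : ∀ p ∈ D.parBdry, W p - V p - 2 * penalty δ l n p ≤ 0 := by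
    intro p hp
    rw [hWbd p hp, hVbd p hp]
    have : 0 ≤ penalty δ l n p :=
      mul_nonneg (by positivity) (zero_le_one.trans (one_le_polyWeight n p.2))
    linarith
  set ρ := max r₀ ‖x₀‖ with hρ
  have hρ0 : 0 ≤ ρ := (norm_nonneg _).trans (le_max_right _ _)
  have hnorm : ∀ x ∈ truncBox D.R D.H ρ, ‖x‖ ≤ ρ + D.H := fun x hx =>
    norm_le_of_mem_truncBox hR hρ0 (by linarith) hx
  have hbar : truncBox D.R D.H ρ ⊆ Qbar D.R D.H := truncBox_subset_Qbar _ _ _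
  obtain ⟨C, hC0, hlip⟩ := D.exists_lipschitz hA hα hβ hk hγ hL₁ hC1b hC1σ hθ.continuousOn
    hs.continuousOn hℓ.continuousOn (hζ.of_le (by exact_mod_cast le_top)) (ρ + D.H)
  have hx₀B : x₀ ∈ truncBox D.R D.H ρ := by
    obtain ⟨h0, h1, h2, h3⟩ := hx₀
    have k (i : Fin 3) : x₀ i ≤ ρ :=
      ((le_abs_self _).trans (norm_le_pi_norm x₀ i)).trans (le_max_right _ _)
    exact mem_truncBox.2 ⟨⟨h0, h1, h2⟩, k 0, k 1, h3⟩
  have hkγ : 0 ≤ D.k * D.N ^ D.γ * ρ := by positivity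
  have hcmp := sub_sub_penalty_nonpos (K := G * (1 + (ρ + D.H)) + D.k * D.N ^ D.γ * ρ) hW hV
    (isCompact_truncBox D.R D.H ρ) hbar
    (fun x hx => by
      obtain ⟨h0, h1, h2⟩ := mem_interior_truncBox.1 hx
      exact ⟨h0.1, h1.1, h2⟩) hne hk hG hC0 (by positivity) hδ0 hl
    (fun t ht x hx u hu i => hgrow t ht x (hbar hx) u hu i)
    (fun t ht x hx u hu => by
      refine ⟨fun i => ?_, ?_⟩
      · have h1 : G * (1 + |x i|) ≤ G * (1 + (ρ + D.H)) := by
          have := (norm_le_pi_norm x i).trans (hnorm x hx)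
          rw [Real.norm_eq_abs] at this
          gcongr
        obtain ⟨h2, h3⟩ := hgrow t ht x (hbar hx) u hu i
        exact ⟨by linarith, by linarith⟩
      · have h1 : D.k * u.1 ^ D.γ * x 1 ≤ D.k * D.N ^ D.γ * ρ := by
          have h2 := mem_truncBox.1 hx
          have h3 : u.1 ^ D.γ ≤ D.N ^ D.γ := Real.rpow_le_rpow hu.1.1 hu.1.2 hγ.le
          exact mul_le_mul (mul_le_mul_of_nonneg_left h3 hk.le) h2.2.2.1 h2.1.2.1 (by positivity)
        have : 0 ≤ G * (1 + (ρ + D.H)) := by positivity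
        rw [HJBData.runCost]
        linarith)
    (fun t ht x hx y hy u hu => hlip t ht x (hbar hx) y (hbar hy) (hnorm x hx) (hnorm y hy) u hu)
    (fun t ht x hx h => by
      rcases h with rfl | h
      · by_cases hxQ : x ∈ Qset D.R D.H
        · exact hpar _ (Or.inr ⟨rfl, hxQ⟩)
        · exact hpar _ (Or.inl ⟨ht, hbar hx, hxQ⟩)
      · rcases notMem_Qset_or_le_norm h with hxQ | hxn
        · exact hpar _ (Or.inl ⟨ht, hbar hx, hxQ⟩)
        · exact hfar t ht x (hbar hx) ((le_max_left _ _).trans hxn))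
    t₀ ht₀ x₀ hx₀B
  have hexp1 : Real.exp (-l * t₀) ≤ 1 := Real.exp_le_one_iff.2 (by nlinarith [ht₀.1])
  have hfin : penalty δ l n (t₀, x₀) ≤ (W (t₀, x₀) - V (t₀, x₀)) / 4 := by
    calc penalty δ l n (t₀, x₀) ≤ δ * 1 * polyWeight n x₀ := by unfold penalty; gcongr
      _ = (W (t₀, x₀) - V (t₀, x₀)) / 4 := by rw [hδ]; field_simp
  linarith
end
end

section
/- Let ε₁, ε₂ > 0 and let X, Y ∈ S⁴ be written in block form X = [[X₁₁, X₁ᵀ],[X₁, X̃]], Y = [[Y₁₁, Y₁ᵀ],[Y₁, Ỹ]] with X̃, Ỹ ∈ S³. Let A ∈ S⁸ be the matrix (in coordinates ordered (t, x, s, y) ∈ ℝ×ℝ³×ℝ×ℝ³) with block form A = [[ε₂⁻¹, 0, −ε₂⁻¹, 0],[0, ε₁⁻¹I₃, 0, −ε₁⁻¹I₃],[−ε₂⁻¹, 0, ε₂⁻¹, 0],[0, −ε₁⁻¹I₃, 0, ε₁⁻¹I₃]]. If the block-diagonal matrix diag(X, −Y) ∈ S⁸ satisfies diag(X, −Y)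 ≤ A + ε₁A² in the Loewner order, then the 6×6 principal submatrix obtained by deleting the rows and columns corresponding to the two time coordinates satisfies [[X̃, 0],[0, −Ỹ]] ≤ (3/ε₁)[[I₃, −I₃],[−I₃, I₃]]. -/
/-!
STATEMENT 9: Ishii-lemma matrix reduction.  If diag(X, −Y) ≤ A + ε₁A² in the Loewner
order, where A is the 8×8 matrix (coordinates ordered (t,x,s,y) ∈ ℝ×ℝ³×ℝ×ℝ³) given in
block form by A = [[ε₂⁻¹,0,−ε₂⁻¹,0],[0,ε₁⁻¹I₃,0,−ε₁⁻¹I₃],[−ε₂⁻¹,0,ε₂⁻¹,0],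
[0,−ε₁⁻¹I₃,0,ε₁⁻¹I₃]], and X = [[X₁₁,X₁ᵀ],[X₁,X̃]], Y = [[Y₁₁,Y₁ᵀ],[Y₁,Ỹ]] with
X̃, Ỹ ∈ S³, then the 6×6 principal submatrix obtained by deleting the rows and columns
of the two time coordinates satisfies [[X̃,0],[0,−Ỹ]] ≤ (3/ε₁)[[I₃,−I₃],[−I₃,I₃]].
-/

open Matrix

noncomputable section

/-- The 4×4 matrix `[[x₁₁, x₁ᵀ],[x₁, X̃]]` with scalar time–time block `x₁₁`,
time–space block given by the vector `x₁`, and space–space block `X̃`. -/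
def blockMat4 (x₁₁ : ℝ) (x₁ : Fin 3 → ℝ) (Xt : Matrix (Fin 3) (Fin 3) ℝ) :
    Matrix (Fin 1 ⊕ Fin 3) (Fin 1 ⊕ Fin 3) ℝ :=
  Matrix.fromBlocks (Matrix.of fun _ _ => x₁₁) (Matrix.of fun _ j => x₁ j)
    (Matrix.of fun i _ => x₁ i) Xt

/-- The 4×4 matrix `[[ε₂⁻¹, 0],[0, ε₁⁻¹ I₃]]`, i.e. the diagonal block of the
penalization Hessian. -/
def penBlock (ε₁ ε₂ : ℝ) : Matrix (Fin 1 ⊕ Fin 3) (Fin 1 ⊕ Fin 3) ℝ :=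
  Matrix.fromBlocks (Matrix.of fun _ _ => ε₂⁻¹) 0 0 (ε₁⁻¹ • (1 : Matrix (Fin 3) (Fin 3) ℝ))

theorem ishii_matrix_reduction (ε₁ ε₂ : ℝ) (hε₁ : 0 < ε₁) (hε₂ : 0 < ε₂)
    (X₁₁ Y₁₁ : ℝ) (X₁ Y₁ : Fin 3 → ℝ) (Xt Yt : Matrix (Fin 3) (Fin 3) ℝ)
    (hXt : Xt.IsSymm) (hYt : Yt.IsSymm)
    (hLoewner :
      ((Matrix.fromBlocks (penBlock ε₁ ε₂) (-(penBlock ε₁ ε₂)) (-(penBlock ε₁ ε₂))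
            (penBlock ε₁ ε₂) +
          ε₁ • (Matrix.fromBlocks (penBlock ε₁ ε₂) (-(penBlock ε₁ ε₂)) (-(penBlock ε₁ ε₂))
            (penBlock ε₁ ε₂) *
            Matrix.fromBlocks (penBlock ε₁ ε₂) (-(penBlock ε₁ ε₂)) (-(penBlock ε₁ ε₂))
            (penBlock ε₁ ε₂))) -
        Matrix.fromBlocks (blockMat4 X₁₁ X₁ Xt) 0 0 (-(blockMat4 Y₁₁ Y₁ Yt))).PosSemidef) :
    ((3 / ε₁) • Matrix.fromBlocks (1 : Matrix (Fin 3) (Fin 3) ℝ) (-1) (-1) 1 -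
      Matrix.fromBlocks Xt 0 0 (-Yt)).PosSemidef := by
  have hs : ε₁ * (ε₁⁻¹ * ε₁⁻¹) = ε₁⁻¹ := mul_inv_cancel_left₀ hε₁.ne' _
  convert hLoewner.submatrix (Sum.map (Sum.inr : Fin 3 → Fin 1 ⊕ Fin 3)
    (Sum.inr : Fin 3 → Fin 1 ⊕ Fin 3)) using 1
  simp only [penBlock, blockMat4, fromBlocks_neg, fromBlocks_multiply, fromBlocks_smul,
    fromBlocks_add]
  ext (i | i) (j | j) <;>
    simp [Matrix.one_apply, div_eq_mul_inv] <;>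
    split_ifs <;> linarith [hs]

end
end
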